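/- Let g be an integrable function on (0,∞) (identified with an odd integrable function on ℝ) such that its Hilbert transform H_0 g is also Lebesgue integrable on (0,∞), i.e., g ∈ H_0^1(ℝ_+). Then H_0(T_g) is Lebesgue integrable on (0,∞) and there is an absolute constant C > 0 such that ‖H_0(T_g)‖_{L^1(0,∞)} ≤ C (‖g‖_{L^1(0,∞)} + ‖H_0 g‖_{L^1(0,∞)}). -/

import Mathlib

open MeasureTheory Filter Set Real

/-! ### Hardy's inequality for polynomials on the unit circle -/

section PolynomialHardy

open Polynomial in
/-- `P = G * H` on the unit disc with `|G|², |H|²` dominated by a polynomial of modulus `|P|` on the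
unit circle. -/
def HasDiscFactorization (P : ℂ[X]) : Prop :=
  ∃ Q : ℂ[X], ∃ G H : ℂ → ℂ, DifferentiableOn ℂ G (Metric.ball 0 1) ∧
    DifferentiableOn ℂ H (Metric.ball 0 1) ∧
    (∀ w ∈ Metric.ball (0 : ℂ) 1, P.eval w = G w * H w ∧ ‖G w‖ ^ 2 ≤ ‖Q.eval w‖ ∧
      ‖H w‖ ^ 2 ≤ ‖Q.eval w‖) ∧
    ∀ w : ℂ, ‖w‖ = 1 → ‖Q.eval w‖ = ‖P.eval w‖

open Polynomial in
lemma HasDiscFactorization.mul {P₁ P₂ : ℂ[X]} (h₁ : HasDiscFactorization P₁)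
    (h₂ : HasDiscFactorization P₂) : HasDiscFactorization (P₁ * P₂) := by
  obtain ⟨Q₁, G₁, H₁, dG₁, dH₁, hb₁, hs₁⟩ := h₁
  obtain ⟨Q₂, G₂, H₂, dG₂, dH₂, hb₂, hs₂⟩ := h₂
  refine ⟨Q₁ * Q₂, fun w => G₁ w * G₂ w, fun w => H₁ w * H₂ w, dG₁.mul dG₂, dH₁.mul dH₂, ?_, ?_⟩
  · intro w hw
    obtain ⟨e₁, g₁, k₁⟩ := hb₁ w hw
    obtain ⟨e₂, g₂, k₂⟩ := hb₂ w hw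
    refine ⟨by rw [eval_mul, e₁, e₂]; ring, ?_, ?_⟩
    · rw [eval_mul, norm_mul, norm_mul, mul_pow]; gcongr
    · rw [eval_mul, norm_mul, norm_mul, mul_pow]; gcongr
  · intro w hw
    rw [eval_mul, eval_mul, norm_mul, norm_mul, hs₁ w hw, hs₂ w hw]

open Polynomial in
lemma hasDiscFactorization_C (c : ℂ) : HasDiscFactorization (C c) := by
  obtain ⟨s, hs⟩ := IsAlgClosed.exists_pow_nat_eq c (n := 2) (by norm_num)
  refine ⟨C c, fun _ => s, fun _ => s, by fun_prop, by fun_prop, ?_, fun _ _ => rfl⟩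
  intro w _
  have : ‖s‖ ^ 2 = ‖c‖ := by rw [← norm_pow, hs]
  exact ⟨by rw [eval_C, ← hs, sq], by simp [this], by simp [this]⟩

lemma cpow_half_sq (z : ℂ) : z ^ (1 / 2 : ℂ) * z ^ (1 / 2 : ℂ) = z := by
  rw [← sq, ← Complex.cpow_nat_mul]
  norm_num

lemma differentiableOn_sqrt_one_sub_mul {b : ℂ} (hb : ‖b‖ ≤ 1) :
    DifferentiableOn ℂ (fun w : ℂ => (1 - b * w) ^ (1 / 2 : ℂ)) (Metric.ball 0 1) := by
  intro w hw
  refine DifferentiableAt.differentiableWithinAt ?_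
  refine DifferentiableAt.cpow (by fun_prop) (by fun_prop) ?_
  left
  have hw' : ‖w‖ < 1 := by simpa using hw
  have h1 : ‖b * w‖ < 1 := by
    rw [norm_mul]; nlinarith [norm_nonneg b, norm_nonneg w]
  have := (Complex.abs_re_le_norm (b * w)).trans_lt h1
  simp only [Complex.sub_re, Complex.one_re]
  linarith [(abs_lt.1 this).2]

lemma normSq_one_sub_conj_mul (a w : ℂ) :
    ‖1 - (starRingEnd ℂ) a * w‖ ^ 2 - ‖w - a‖ ^ 2 = (1 - ‖a‖ ^ 2) * (1 - ‖w‖ ^ 2) := by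
  simp only [Complex.sq_norm, Complex.normSq_apply]
  simp
  ring

open Polynomial in
lemma hasDiscFactorization_X_sub_C (a : ℂ) : HasDiscFactorization (X - C a) := by
  rcases le_or_gt 1 ‖a‖ with ha | ha
  · have ha0 : a ≠ 0 := by
      rintro rfl; simp at ha; linarith
    have h : HasDiscFactorization (C 1 - C a⁻¹ * X) := by
      have hd := differentiableOn_sqrt_one_sub_mul (b := a⁻¹)
        (by rw [norm_inv]; exact inv_le_one_of_one_le₀ ha)
      refine ⟨C 1 - C a⁻¹ * X, _, _, hd, hd, fun w _ => ?_, fun _ _ => rfl⟩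
      have e : eval w (C 1 - C a⁻¹ * X) = 1 - a⁻¹ * w := by simp
      have e2 : ‖(1 - a⁻¹ * w) ^ (1 / 2 : ℂ)‖ ^ 2 = ‖1 - a⁻¹ * w‖ := by
        rw [sq, ← norm_mul, cpow_half_sq]
      rw [e]
      exact ⟨(cpow_half_sq _).symm, e2.le, e2.le⟩
    have h2 := (hasDiscFactorization_C (-a)).mul h
    convert h2 using 1
    rw [mul_sub, ← mul_assoc, ← C_mul, ← C_mul, mul_one, neg_mul, mul_inv_cancel₀ ha0]
    simp
    ring
  · have hd := differentiableOn_sqrt_one_sub_mul (b := (starRingEnd ℂ) a) (by simpa using ha.le)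
    have hne : ∀ w ∈ Metric.ball (0 : ℂ) 1, 1 - (starRingEnd ℂ) a * w ≠ 0 := by
      intro w hw h0
      have hw' : ‖w‖ < 1 := by simpa using hw
      have h1 : ‖(starRingEnd ℂ) a * w‖ < 1 := by
        rw [norm_mul, RCLike.norm_conj]; nlinarith [norm_nonneg a, norm_nonneg w]
      rw [← sub_eq_zero.1 h0] at h1
      simp at h1
    refine ⟨C 1 - C ((starRingEnd ℂ) a) * X, _,
      fun w => (1 - (starRingEnd ℂ) a * w) ^ (1 / 2 : ℂ) *
        ((w - a) / (1 - (starRingEnd ℂ) a * w)), hd, hd.mul ?_, ?_, ?_⟩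
    · exact DifferentiableOn.div (by fun_prop) (by fun_prop) hne
    · intro w hw
      have hw' : ‖w‖ < 1 := by simpa using hw
      have e : eval w (C 1 - C ((starRingEnd ℂ) a) * X) = 1 - (starRingEnd ℂ) a * w := by simp
      have e2 : ‖(1 - (starRingEnd ℂ) a * w) ^ (1 / 2 : ℂ)‖ ^ 2 =
          ‖1 - (starRingEnd ℂ) a * w‖ := by
        rw [sq, ← norm_mul, cpow_half_sq]
      rw [e]
      refine ⟨?_, e2.le, ?_⟩
      · rw [← mul_assoc, cpow_half_sq, mul_div_cancel₀ _ (hne w hw)]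
        simp
      · rw [norm_mul, mul_pow, e2]
        refine mul_le_of_le_one_right (norm_nonneg _) (pow_le_one₀ (norm_nonneg _) ?_)
        rw [norm_div]
        refine div_le_one_of_le₀ ?_ (norm_nonneg _)
        refine le_of_sq_le_sq ?_ (norm_nonneg _)
        have := normSq_one_sub_conj_mul a w
        have h3 : 0 ≤ (1 - ‖a‖ ^ 2) * (1 - ‖w‖ ^ 2) := by
          apply mul_nonneg <;> nlinarith [norm_nonneg a, norm_nonneg w]
        linarith
    · intro w hw
      have e : eval w (C 1 - C ((starRingEnd ℂ) a) * X) = 1 - (starRingEnd ℂ) a * w := by simp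
      have := normSq_one_sub_conj_mul a w
      rw [hw] at this
      rw [e, eval_sub, eval_X, eval_C]
      refine (sq_eq_sq₀ (norm_nonneg _) (norm_nonneg _)).1 ?_
      linarith

open Polynomial in
lemma hasDiscFactorization (P : ℂ[X]) : HasDiscFactorization P := by
  rw [(IsAlgClosed.splits P).eq_prod_roots]
  refine (hasDiscFactorization_C _).mul ?_
  refine Multiset.prod_induction HasDiscFactorization _ (fun _ _ => HasDiscFactorization.mul)
    (by simpa using hasDiscFactorization_C 1) ?_
  intro p hp
  obtain ⟨a, _, rfl⟩ := Multiset.mem_map.1 hp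
  exact hasDiscFactorization_X_sub_C a

lemma integral_exp_int_mul_I (n : ℤ) :
    ∫ θ in (0 : ℝ)..2 * π, Complex.exp (n * θ * Complex.I) = if n = 0 then (2 * π : ℂ) else 0 := by
  split_ifs with h
  · simp [h]
  · have hc : (n : ℂ) * Complex.I ≠ 0 := by simp [h]
    have := integral_exp_mul_complex (a := 0) (b := 2 * π) hc
    simp_rw [mul_right_comm (n : ℂ) _ Complex.I]
    rw [this]
    have : (n : ℂ) * Complex.I * ((2 * π : ℝ) : ℂ) = n * (2 * π * Complex.I) := by
      push_cast; ring
    rw [this, Complex.exp_int_mul_two_pi_mul_I]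
    simp

lemma integral_norm_sq_trigPolynomial (a : ℕ → ℂ) (N : ℕ) :
    ∫ θ in (0 : ℝ)..2 * π, ‖∑ n ∈ Finset.range N, a n * Complex.exp (n * θ * Complex.I)‖ ^ 2 =
      2 * π * ∑ n ∈ Finset.range N, ‖a n‖ ^ 2 := by
  have key : ∀ θ : ℝ, ((‖∑ n ∈ Finset.range N, a n * Complex.exp (n * θ * Complex.I)‖ ^ 2 : ℝ) : ℂ)
      = ∑ n ∈ Finset.range N, ∑ m ∈ Finset.range N, a n * (starRingEnd ℂ) (a m) *
          Complex.exp (((n - m : ℤ) : ℂ) * θ * Complex.I) := by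
    intro θ
    rw [Complex.ofReal_pow, ← Complex.mul_conj', map_sum, Finset.sum_mul_sum]
    refine Finset.sum_congr rfl fun n _ => Finset.sum_congr rfl fun m _ => ?_
    rw [map_mul, ← Complex.exp_conj]
    have : Complex.exp (((n - m : ℤ) : ℂ) * θ * Complex.I) = Complex.exp (n * θ * Complex.I) *
        Complex.exp ((starRingEnd ℂ) (m * θ * Complex.I)) := by
      rw [← Complex.exp_add]
      congr 1
      simp
      ring
    rw [this]
    ring
  have : ((∫ θ in (0 : ℝ)..2 * π,
      ‖∑ n ∈ Finset.range N, a n * Complex.exp (n * θ * Complex.I)‖ ^ 2 : ℝ) : ℂ) =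
      ((2 * π * ∑ n ∈ Finset.range N, ‖a n‖ ^ 2 : ℝ) : ℂ) := by
    rw [← intervalIntegral.integral_ofReal]
    simp_rw [key]
    rw [intervalIntegral.integral_finsetSum
      (fun n _ => Continuous.intervalIntegrable (by fun_prop) _ _)]
    have : ∀ n ∈ Finset.range N, ∫ θ in (0 : ℝ)..2 * π, ∑ m ∈ Finset.range N,
        a n * (starRingEnd ℂ) (a m) * Complex.exp (((n - m : ℤ) : ℂ) * θ * Complex.I) =
        2 * π * (‖a n‖ ^ 2 : ℝ) := by
      intro n hn
      rw [intervalIntegral.integral_finsetSum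
        (fun n _ => Continuous.intervalIntegrable (by fun_prop) _ _)]
      simp_rw [intervalIntegral.integral_const_mul, integral_exp_int_mul_I]
      rw [Finset.sum_eq_single n]
      · simp [Complex.mul_conj']; ring
      · intro m _ hm
        have : (n : ℤ) - m ≠ 0 := by omega
        simp [this]
      · intro h; exact absurd hn h
    rw [Finset.sum_congr rfl this]
    push_cast
    rw [Finset.mul_sum]
  exact_mod_cast this

/-- Bessel's inequality for the Taylor coefficients of a function holomorphic on the unit disc. -/
lemma sum_norm_sq_taylorCoeff_le {G : ℂ → ℂ} (hG : DifferentiableOn ℂ G (Metric.ball 0 1))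
    {ρ : ℝ} (h0 : 0 < ρ) (h1 : ρ < 1) (M : ℕ) :
    2 * π * ∑ n ∈ Finset.range M, ‖((n.factorial : ℂ))⁻¹ * iteratedDeriv n G 0 * ρ ^ n‖ ^ 2 ≤
      ∫ θ in (0 : ℝ)..2 * π, ‖G (ρ * Complex.exp (θ * Complex.I))‖ ^ 2 := by
  set a : ℕ → ℂ := fun n => ((n.factorial : ℂ))⁻¹ * iteratedDeriv n G 0 * ρ ^ n with ha
  have hmem : ∀ θ : ℝ, (ρ * Complex.exp (θ * Complex.I) : ℂ) ∈ Metric.ball (0 : ℂ) 1 := by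
    intro θ
    simp [Complex.norm_exp_ofReal_mul_I, abs_of_pos h0, h1]
  have hsum : ∀ θ : ℝ, HasSum (fun n => a n * Complex.exp (n * θ * Complex.I))
      (G (ρ * Complex.exp (θ * Complex.I))) := by
    intro θ
    have := Complex.hasSum_taylorSeries_on_ball hG (hmem θ)
    have e : (fun n : ℕ => a n * Complex.exp (n * θ * Complex.I)) = fun n : ℕ =>
        ((n.factorial : ℂ))⁻¹ • (ρ * Complex.exp (θ * Complex.I) - 0) ^ n •
          iteratedDeriv n G 0 := by
      ext n
      rw [ha, sub_zero, mul_pow, ← Complex.exp_nat_mul]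
      simp only [smul_eq_mul]
      ring_nf
    rw [e]
    exact this
  have habs : Summable (fun n => ‖a n‖) := by
    have := (hsum 0).summable.norm
    simpa using this
  have hlim : Tendsto (fun N => ∫ θ in (0 : ℝ)..2 * π,
      ‖∑ n ∈ Finset.range N, a n * Complex.exp (n * θ * Complex.I)‖ ^ 2) atTop
      (nhds (∫ θ in (0 : ℝ)..2 * π, ‖G (ρ * Complex.exp (θ * Complex.I))‖ ^ 2)) := by
    refine intervalIntegral.tendsto_integral_filter_of_dominated_convergence
      (fun _ => (∑' n, ‖a n‖) ^ 2) ?_ ?_ (by simp) ?_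
    · exact Eventually.of_forall fun N => Continuous.aestronglyMeasurable (by fun_prop)
    · refine Eventually.of_forall fun N => Eventually.of_forall fun θ _ => ?_
      rw [norm_pow, norm_norm]
      gcongr
      refine (norm_sum_le _ _).trans ?_
      refine le_trans (Finset.sum_le_sum fun n _ => ?_)
        (habs.sum_le_tsum (Finset.range N) (fun _ _ => norm_nonneg _))
      rw [norm_mul]
      have : ‖Complex.exp (n * θ * Complex.I)‖ = 1 := by
        have := Complex.norm_exp_ofReal_mul_I (n * θ)
        push_cast at this
        exact this
      rw [this, mul_one]
    · exact Eventually.of_forall fun θ _ => ((hsum θ).tendsto_sum_nat.norm).pow 2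
  refine ge_of_tendsto hlim ?_
  filter_upwards [eventually_ge_atTop M] with N hN
  rw [integral_norm_sq_trigPolynomial]
  gcongr

lemma sum_inv_sqrt_mul_le (j N : ℕ) :
    ∑ k ∈ Finset.range N, 1 / (√(k + 1) * (j + k + 1)) ≤ 4 / √(j + 1) := by
  have sq : ∀ n : ℕ, √((n : ℝ) + 1) * √((n : ℝ) + 1) = n + 1 :=
    fun n => Real.mul_self_sqrt (by positivity)
  have pos : ∀ n : ℕ, 0 < √((n : ℝ) + 1) := fun n => Real.sqrt_pos.2 (by positivity)
  have first : ∀ N : ℕ, N ≤ j + 1 →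
      ∑ k ∈ Finset.range N, 1 / (√((k : ℝ) + 1) * (j + k + 1)) ≤ 2 * √N / (j + 1) := by
    intro N
    induction N with
    | zero => intro _; simp
    | succ N ih =>
      intro hN
      rw [Finset.sum_range_succ]
      have h1 := ih (by omega)
      have hs : √(N : ℝ) * √(N : ℝ) = N := Real.mul_self_sqrt (by positivity)
      have hs2 := sq N
      have hp := pos N
      have hn : 0 ≤ √(N : ℝ) := Real.sqrt_nonneg _
      have h2 : 1 / (√((N : ℝ) + 1) * (j + N + 1)) ≤ (2 * √((N : ℝ) + 1) - 2 * √N) / (j + 1) := by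
        have h3 : 1 / √((N : ℝ) + 1) ≤ 2 * √((N : ℝ) + 1) - 2 * √N := by
          rw [div_le_iff₀ hp]
          nlinarith [sq_nonneg (√((N : ℝ) + 1) - √N)]
        calc 1 / (√((N : ℝ) + 1) * (j + N + 1)) = (1 / √((N : ℝ) + 1)) / (j + N + 1) := by
              rw [div_div]
          _ ≤ (1 / √((N : ℝ) + 1)) / (j + 1) := by
              gcongr; linarith [(Nat.cast_nonneg N : (0 : ℝ) ≤ N)]
          _ ≤ _ := by gcongr
      push_cast
      calc _ ≤ 2 * √N / (j + 1 : ℝ) + (2 * √((N : ℝ) + 1) - 2 * √N) / (j + 1) := add_le_add h1 h2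
        _ = _ := by ring
  have second : ∀ M : ℕ, ∑ k ∈ Finset.range (j + 1 + M), 1 / (√((k : ℝ) + 1) * (j + k + 1)) ≤
      4 / √((j : ℝ) + 1) - 2 / √((j : ℝ) + 1 + M) := by
    intro M
    induction M with
    | zero =>
      have := first (j + 1) le_rfl
      push_cast at this
      rw [add_zero]
      refine this.trans (le_of_eq ?_)
      have h := sq j
      have hp := pos j
      push_cast
      have e : 2 * √((j : ℝ) + 1) / (j + 1) = 2 * √((j : ℝ) + 1) /
          (√((j : ℝ) + 1) * √((j : ℝ) + 1)) := by rw [h]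
      rw [add_zero, e]
      field_simp
      ring
    | succ M ih =>
      rw [← add_assoc, Finset.sum_range_succ]
      set A : ℝ := (j : ℝ) + 1 + M with hA
      have hApos : 0 < A := by positivity
      have e1 : (((j + 1 + M : ℕ) : ℝ)) = A := by push_cast; rfl
      have e2 : (j : ℝ) + 1 + ((M + 1 : ℕ) : ℝ) = A + 1 := by push_cast; ring
      rw [e1, e2]
      have hs : √A * √A = A := Real.mul_self_sqrt hApos.le
      have hs2 : √(A + 1) * √(A + 1) = A + 1 := Real.mul_self_sqrt (by positivity)
      have p1 : 0 < √A := Real.sqrt_pos.2 hApos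
      have p2 : 0 < √(A + 1) := Real.sqrt_pos.2 (by positivity)
      have h2 : 1 / (√(A + 1) * (j + A + 1)) ≤ 2 / √A - 2 / √(A + 1) := by
        have le : √A ≤ √(A + 1) := Real.sqrt_le_sqrt (by linarith)
        have h3 : 1 / (√(A + 1) * (j + A + 1)) ≤ 1 / (√(A + 1) * (A + 1)) := by
          gcongr; linarith [(Nat.cast_nonneg j : (0 : ℝ) ≤ j)]
        refine h3.trans ?_
        rw [div_sub_div _ _ p1.ne' p2.ne', div_le_div_iff₀ (by positivity) (by positivity)]
        have h4 : √A ≤ 2 * (√(A + 1) - √A) * (A + 1) := by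
          nlinarith [mul_pos p1 p2]
        nlinarith
      linarith
  have hfin := second N
  refine le_trans (Finset.sum_le_sum_of_subset_of_nonneg (t := Finset.range (j + 1 + N)) ?_ ?_)
    (hfin.trans ?_)
  · exact Finset.range_mono (by omega)
  · intros; positivity
  · have : (0 : ℝ) ≤ 2 / √((j : ℝ) + 1 + N) := by positivity
    linarith

/-- Hilbert's inequality for finite sums. -/
lemma sum_mul_div_add_le (x y : ℕ → ℝ) (N : ℕ) :
    ∑ j ∈ Finset.range N, ∑ k ∈ Finset.range N, x j * y k / (j + k + 1) ≤
      2 * (∑ j ∈ Finset.range N, x j ^ 2 + ∑ k ∈ Finset.range N, y k ^ 2) := by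
  have pos : ∀ n : ℕ, 0 < √((n : ℝ) + 1) := fun n => Real.sqrt_pos.2 (by positivity)
  have weight : ∀ (z : ℕ → ℝ), ∑ j ∈ Finset.range N, ∑ k ∈ Finset.range N,
      z j ^ 2 * √((j : ℝ) + 1) * (1 / (√((k : ℝ) + 1) * (j + k + 1))) ≤
      4 * ∑ j ∈ Finset.range N, z j ^ 2 := by
    intro z
    rw [Finset.mul_sum]
    refine Finset.sum_le_sum fun j _ => ?_
    rw [← Finset.mul_sum]
    calc _ ≤ z j ^ 2 * √((j : ℝ) + 1) * (4 / √((j : ℝ) + 1)) := by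
          gcongr; exact sum_inv_sqrt_mul_le j N
      _ = _ := by have := pos j; field_simp
  have point : ∀ j k : ℕ, x j * y k / (j + k + 1) ≤
      (x j ^ 2 * √((j : ℝ) + 1) * (1 / (√((k : ℝ) + 1) * (j + k + 1))) +
        y k ^ 2 * √((k : ℝ) + 1) * (1 / (√((j : ℝ) + 1) * (k + j + 1)))) / 2 := by
    intro j k
    have pj := pos j
    have pk := pos k
    have e : (x j ^ 2 * √((j : ℝ) + 1) * (1 / (√((k : ℝ) + 1) * (j + k + 1))) +
        y k ^ 2 * √((k : ℝ) + 1) * (1 / (√((j : ℝ) + 1) * (k + j + 1)))) / 2 -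
        x j * y k / (j + k + 1) =
        (x j * √((j : ℝ) + 1) - y k * √((k : ℝ) + 1)) ^ 2 /
          (2 * √((j : ℝ) + 1) * √((k : ℝ) + 1) * (j + k + 1)) := by
      rw [add_comm (k : ℝ) j]
      field_simp
      ring
    have : 0 ≤ (x j * √((j : ℝ) + 1) - y k * √((k : ℝ) + 1)) ^ 2 /
          (2 * √((j : ℝ) + 1) * √((k : ℝ) + 1) * (j + k + 1)) := by positivity
    linarith
  calc _ ≤ ∑ j ∈ Finset.range N, ∑ k ∈ Finset.range N,
      (x j ^ 2 * √((j : ℝ) + 1) * (1 / (√((k : ℝ) + 1) * (j + k + 1))) +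
        y k ^ 2 * √((k : ℝ) + 1) * (1 / (√((j : ℝ) + 1) * (k + j + 1)))) / 2 :=
        Finset.sum_le_sum fun j _ => Finset.sum_le_sum fun k _ => point j k
    _ = (∑ j ∈ Finset.range N, ∑ k ∈ Finset.range N,
          x j ^ 2 * √((j : ℝ) + 1) * (1 / (√((k : ℝ) + 1) * (j + k + 1))) +
        ∑ k ∈ Finset.range N, ∑ j ∈ Finset.range N,
          y k ^ 2 * √((k : ℝ) + 1) * (1 / (√((j : ℝ) + 1) * (k + j + 1)))) / 2 := by
        rw [Finset.sum_comm (s := Finset.range N) (t := Finset.range N)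
          (f := fun k j => y k ^ 2 * √((k : ℝ) + 1) * (1 / (√((j : ℝ) + 1) * (k + j + 1))))]
        simp_rw [← Finset.sum_add_distrib, Finset.sum_div]
    _ ≤ _ := by linarith [weight x, weight y]

lemma sum_antidiagonal_le_sum_sum (f : ℕ × ℕ → ℝ) (hf : ∀ p, 0 ≤ f p) (N : ℕ) :
    ∑ n ∈ Finset.range N, ∑ p ∈ Finset.HasAntidiagonal.antidiagonal n, f p ≤
      ∑ j ∈ Finset.range N, ∑ k ∈ Finset.range N, f (j, k) := by
  rw [← Finset.sum_product', ← Finset.sum_biUnion]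
  · refine Finset.sum_le_sum_of_subset_of_nonneg ?_ fun p _ _ => hf p
    intro p hp
    simp only [Finset.mem_biUnion, Finset.mem_range, Finset.HasAntidiagonal.mem_antidiagonal] at hp
    obtain ⟨n, hn, hp⟩ := hp
    simp only [Finset.mem_product, Finset.mem_range]
    omega
  · intro m _ n _ hmn
    refine Finset.disjoint_left.2 fun p hp hq => hmn ?_
    rw [← Finset.HasAntidiagonal.mem_antidiagonal.1 hp,
      Finset.HasAntidiagonal.mem_antidiagonal.1 hq]

open Polynomial in
lemma iteratedDeriv_eval_zero (P : ℂ[X]) (n : ℕ) :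
    iteratedDeriv n (fun w => P.eval w) 0 = n.factorial * P.coeff n := by
  have : ∀ n : ℕ, iteratedDeriv n (fun w => P.eval w) = fun w => (derivative^[n] P).eval w := by
    intro n
    induction n with
    | zero => simp
    | succ n ih =>
      rw [iteratedDeriv_succ, ih]
      ext w
      rw [Polynomial.deriv, Function.iterate_succ_apply']
  rw [this]
  simp only
  rw [← coeff_zero_eq_eval_zero, coeff_iterate_derivative]
  simp [Nat.descFactorial_self]

open Polynomial in
/-- **Hardy's inequality** for polynomials. -/
lemma polynomial_hardy (P : ℂ[X]) (N : ℕ) :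
    2 * π * ∑ n ∈ Finset.range N, ‖P.coeff n‖ / (n + 1) ≤
      4 * ∫ θ in (0 : ℝ)..2 * π, ‖P.eval (Complex.exp (θ * Complex.I))‖ := by
  obtain ⟨Q, G, H, dG, dH, hb, hs⟩ := hasDiscFactorization P
  set c : ℕ → ℂ := fun n => ((n.factorial : ℂ))⁻¹ * iteratedDeriv n G 0
  set d : ℕ → ℂ := fun n => ((n.factorial : ℂ))⁻¹ * iteratedDeriv n H 0
  have hball : Metric.ball (0 : ℂ) 1 ∈ nhds (0 : ℂ) := Metric.ball_mem_nhds _ one_pos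
  have hG : AnalyticAt ℂ G 0 := dG.analyticAt hball
  have hH : AnalyticAt ℂ H 0 := dH.analyticAt hball
  have hcoeff : ∀ n, P.coeff n = ∑ p ∈ Finset.HasAntidiagonal.antidiagonal n, c p.1 * d p.2 := by
    intro n
    have h1 := iteratedDeriv_eval_zero P n
    have h2 : (fun w => P.eval w) =ᶠ[nhds 0] G * H := by
      filter_upwards [hball] with w hw using (hb w hw).1
    rw [h2.iteratedDeriv_eq, iteratedDeriv_mul hG.contDiffAt hH.contDiffAt] at h1
    have hf : (n.factorial : ℂ) ≠ 0 := by exact_mod_cast n.factorial_ne_zero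
    have h3 : P.coeff n = ((n.factorial : ℂ))⁻¹ * ((n.factorial : ℂ) * P.coeff n) := by
      rw [inv_mul_cancel_left₀ hf]
    rw [h3, ← h1, Finset.Nat.sum_antidiagonal_eq_sum_range_succ_mk, Finset.mul_sum]
    refine Finset.sum_congr rfl fun i hi => ?_
    rw [Nat.cast_choose _ (by grind)]
    simp only [c, d]
    field_simp
  have hρ : ∀ ρ ∈ Ioo (0 : ℝ) 1, 2 * π * ∑ n ∈ Finset.range N, ‖P.coeff n‖ * ρ ^ n / (n + 1) ≤
      4 * ∫ θ in (0 : ℝ)..2 * π, ‖Q.eval (ρ * Complex.exp (θ * Complex.I))‖ := by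
    intro ρ hρ
    have hmem : ∀ θ : ℝ, (ρ * Complex.exp (θ * Complex.I) : ℂ) ∈ Metric.ball (0 : ℂ) 1 := by
      intro θ
      simp [Complex.norm_exp_ofReal_mul_I, abs_of_pos hρ.1, hρ.2]
    have hcircle : Continuous fun θ : ℝ => (ρ * Complex.exp (θ * Complex.I) : ℂ) := by fun_prop
    have bound : ∀ K : ℂ → ℂ, DifferentiableOn ℂ K (Metric.ball 0 1) →
        (∀ w ∈ Metric.ball (0 : ℂ) 1, ‖K w‖ ^ 2 ≤ ‖Q.eval w‖) →
        2 * π * ∑ n ∈ Finset.range N, ‖((n.factorial : ℂ))⁻¹ * iteratedDeriv n K 0 * ρ ^ n‖ ^ 2 ≤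
        ∫ θ in (0 : ℝ)..2 * π, ‖Q.eval (ρ * Complex.exp (θ * Complex.I))‖ := by
      intro K hK hKQ
      refine (sum_norm_sq_taylorCoeff_le hK hρ.1 hρ.2 N).trans ?_
      refine intervalIntegral.integral_mono_on (by positivity) ?_ ?_ ?_
      · refine Continuous.intervalIntegrable ?_ _ _
        refine ((hK.continuousOn.comp_continuous hcircle hmem).norm).pow 2
      · exact Continuous.intervalIntegrable ((Q.continuous.comp hcircle).norm) _ _
      · intro θ _; exact hKQ _ (hmem θ)
    have b1 := bound G dG fun w hw => (hb w hw).2.1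
    have b2 := bound H dH fun w hw => (hb w hw).2.2
    have main : ∑ n ∈ Finset.range N, ‖P.coeff n‖ * ρ ^ n / (n + 1) ≤
        ∑ j ∈ Finset.range N, ∑ k ∈ Finset.range N,
          ‖c j * ρ ^ j‖ * ‖d k * ρ ^ k‖ / (j + k + 1) := by
      have e1 : ∀ n ∈ Finset.range N, ‖P.coeff n‖ * ρ ^ n / (n + 1) ≤
          ∑ p ∈ Finset.HasAntidiagonal.antidiagonal n, ‖c p.1 * ρ ^ p.1‖ * ‖d p.2 * ρ ^ p.2‖ /
            (p.1 + p.2 + 1) := by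
        intro n _
        rw [hcoeff n]
        calc _ ≤ (∑ p ∈ Finset.HasAntidiagonal.antidiagonal n, ‖c p.1 * d p.2‖) *
                ρ ^ n / (n + 1) := by
              have := hρ.1
              gcongr; exact norm_sum_le _ _
          _ = _ := by
              rw [Finset.sum_mul, Finset.sum_div]
              refine Finset.sum_congr rfl fun p hp => ?_
              have hp' : p.1 + p.2 = n := Finset.HasAntidiagonal.mem_antidiagonal.1 hp
              have hp2 : (p.1 : ℝ) + p.2 = n := by exact_mod_cast hp'
              rw [hp2, ← hp', pow_add]
              simp only [norm_mul, norm_pow, Complex.norm_real, Real.norm_eq_abs, abs_of_pos hρ.1]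
              ring
      refine (Finset.sum_le_sum e1).trans ?_
      exact sum_antidiagonal_le_sum_sum
        (fun p => ‖c p.1 * ρ ^ p.1‖ * ‖d p.2 * ρ ^ p.2‖ / (p.1 + p.2 + 1))
        (fun p => by positivity) N
    have hil := sum_mul_div_add_le (fun j => ‖c j * ρ ^ j‖) (fun k => ‖d k * ρ ^ k‖) N
    have hpi := Real.pi_pos
    have := mul_le_mul_of_nonneg_left (main.trans hil) (by positivity : (0 : ℝ) ≤ 2 * π)
    linarith
  have hlim1 : Tendsto (fun ρ : ℝ => 2 * π * ∑ n ∈ Finset.range N, ‖P.coeff n‖ * ρ ^ n / (n + 1))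
      (nhdsWithin 1 (Iio 1)) (nhds (2 * π * ∑ n ∈ Finset.range N, ‖P.coeff n‖ / (n + 1))) := by
    have : Continuous (fun ρ : ℝ =>
      2 * π * ∑ n ∈ Finset.range N, ‖P.coeff n‖ * ρ ^ n / (n + 1)) := by fun_prop
    have h := (this.tendsto 1).mono_left (nhdsWithin_le_nhds (s := Iio (1 : ℝ)))
    simpa using h
  have hlim2 : Tendsto (fun ρ : ℝ =>
      4 * ∫ θ in (0 : ℝ)..2 * π, ‖Q.eval (ρ * Complex.exp (θ * Complex.I))‖)
      (nhdsWithin 1 (Iio 1))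
      (nhds (4 * ∫ θ in (0 : ℝ)..2 * π, ‖P.eval (Complex.exp (θ * Complex.I))‖)) := by
    have hc : Continuous (fun ρ : ℝ =>
        4 * ∫ θ in (0 : ℝ)..2 * π, ‖Q.eval (ρ * Complex.exp (θ * Complex.I))‖) := by
      refine continuous_const.mul ?_
      refine intervalIntegral.continuous_parametric_intervalIntegral_of_continuous'
        (f := fun (ρ θ : ℝ) => ‖Q.eval (ρ * Complex.exp (θ * Complex.I))‖) ?_ _ _
      exact (Q.continuous.comp (by fun_prop : Continuous fun p : ℝ × ℝ =>
        ((p.1 : ℂ) * Complex.exp (p.2 * Complex.I)))).norm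
    have h := (hc.tendsto 1).mono_left (nhdsWithin_le_nhds (s := Iio (1 : ℝ)))
    simp only [Complex.ofReal_one, one_mul] at h
    simp_rw [fun θ : ℝ => hs _ (Complex.norm_exp_ofReal_mul_I θ)] at h
    exact h
  refine le_of_tendsto_of_tendsto hlim1 hlim2 ?_
  filter_upwards [Ioo_mem_nhdsLT (zero_lt_one' ℝ)] with ρ h using hρ ρ h

end PolynomialHardy

/-! ### Hardy's inequality on the line -/

section LineHardy

lemma sum_sum_sub_eq {F : ℤ → ℂ} (hF : ∀ m < 0, F m = 0) (N : ℕ) :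
    ∑ j ∈ Finset.range N, ∑ k ∈ Finset.range N, F (j - k) =
      ∑ n ∈ Finset.range N, ((N : ℂ) - n) * F n := by
  induction N with
  | zero => simp
  | succ N ih =>
    have row : ∑ k ∈ Finset.range (N + 1), F ((N : ℤ) - k) = ∑ n ∈ Finset.range (N + 1), F n := by
      rw [← Finset.sum_range_reflect]
      refine Finset.sum_congr rfl fun k hk => ?_
      have := Finset.mem_range.1 hk
      congr 1
      omega
    have col : ∑ j ∈ Finset.range N, ∑ k ∈ Finset.range (N + 1), F (j - k) =
        ∑ j ∈ Finset.range N, ∑ k ∈ Finset.range N, F (j - k) := by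
      refine Finset.sum_congr rfl fun j hj => ?_
      have := Finset.mem_range.1 hj
      rw [Finset.sum_range_succ, hF _ (by omega), add_zero]
    rw [Finset.sum_range_succ, col, ih, row, Finset.sum_range_succ, Finset.sum_range_succ,
      ← add_assoc, ← Finset.sum_add_distrib]
    push_cast
    congr 1
    · refine Finset.sum_congr rfl fun n _ => by ring
    · ring

lemma norm_exp_mul_I_eq_one {z : ℂ} (x : ℝ) (h : z = x * Complex.I) : ‖Complex.exp z‖ = 1 := by
  rw [h, Complex.norm_exp_ofReal_mul_I]

lemma integrable_mul_exp {Φ : ℝ → ℂ} {μ : Measure ℝ} (hΦ : Integrable Φ μ) (ξ : ℝ) :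
    Integrable (fun t => Φ t * Complex.exp (ξ * t * Complex.I)) μ := by
  refine hΦ.mul_bdd (c := 1) (Continuous.aestronglyMeasurable (by fun_prop)) ?_
  refine Eventually.of_forall fun t => ?_
  rw [norm_exp_mul_I_eq_one (ξ * t) (by push_cast; ring)]

lemma continuous_integral_mul_exp {Φ : ℝ → ℂ} {μ : Measure ℝ} (hΦ : Integrable Φ μ) :
    Continuous (fun ξ : ℝ => ∫ t, Φ t * Complex.exp (ξ * t * Complex.I) ∂μ) := by
  refine continuous_of_dominated (bound := fun t => ‖Φ t‖) ?_ ?_ hΦ.norm ?_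
  · exact fun ξ => (integrable_mul_exp hΦ ξ).aestronglyMeasurable
  · refine fun ξ => Eventually.of_forall fun t => ?_
    rw [norm_mul, norm_exp_mul_I_eq_one (ξ * t) (by push_cast; ring), mul_one]
  · exact Eventually.of_forall fun t => by fun_prop

/-- The Fejér mean of the periodization of `Φ` has `L¹` norm at most that of `Φ`. -/
lemma integral_norm_fejer_le {Φ : ℝ → ℂ} (hΦ : Integrable Φ) (δ : ℝ) (N : ℕ) :
    ∫ θ in (0 : ℝ)..2 * π, ‖∑ j ∈ Finset.range N, ∑ k ∈ Finset.range N,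
      (∫ t, Φ t * Complex.exp ((-(((j - k : ℤ) : ℝ) * δ) : ℝ) * t * Complex.I)) *
        Complex.exp (((j - k : ℤ) : ℂ) * θ * Complex.I)‖ ≤ 2 * π * N * ∫ t, ‖Φ t‖ := by
  set D : ℝ → ℝ → ℝ := fun θ t => ‖∑ j ∈ Finset.range N,
    Complex.exp (-(j * δ * t * Complex.I)) * Complex.exp (j * θ * Complex.I)‖ ^ 2 with hD
  have hDc : Continuous fun p : ℝ × ℝ => D p.1 p.2 := by
    simp only [hD]; fun_prop
  have hDb : ∀ θ t, ‖D θ t‖ ≤ (N : ℝ) ^ 2 := by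
    intro θ t
    simp only [hD, norm_pow, norm_norm]
    gcongr
    refine (norm_sum_le _ _).trans ?_
    refine (Finset.sum_le_card_nsmul _ _ 1 fun j _ => ?_).trans (by simp)
    rw [norm_mul, norm_exp_mul_I_eq_one (-(j * δ * t)) (by push_cast; ring),
      norm_exp_mul_I_eq_one (j * θ) (by push_cast; ring), mul_one]
  have hexp : ∀ θ t, ((D θ t : ℝ) : ℂ) = ∑ j ∈ Finset.range N, ∑ k ∈ Finset.range N,
      Complex.exp ((-(((j - k : ℤ) : ℝ) * δ) : ℝ) * t * Complex.I) *
        Complex.exp (((j - k : ℤ) : ℂ) * θ * Complex.I) := by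
    intro θ t
    simp only [hD]
    rw [Complex.ofReal_pow, ← Complex.mul_conj', map_sum, Finset.sum_mul_sum]
    refine Finset.sum_congr rfl fun n _ => Finset.sum_congr rfl fun m _ => ?_
    rw [map_mul, ← Complex.exp_conj, ← Complex.exp_conj, ← Complex.exp_add, ← Complex.exp_add,
      ← Complex.exp_add, ← Complex.exp_add]
    congr 1
    simp
    ring
  have hrepr : ∀ θ : ℝ, ∑ j ∈ Finset.range N, ∑ k ∈ Finset.range N,
      (∫ t, Φ t * Complex.exp ((-(((j - k : ℤ) : ℝ) * δ) : ℝ) * t * Complex.I)) *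
        Complex.exp (((j - k : ℤ) : ℂ) * θ * Complex.I) = ∫ t, Φ t * D θ t := by
    intro θ
    simp_rw [hexp, Finset.mul_sum, ← mul_assoc (Φ _)]
    have hi : ∀ j k : ℕ, Integrable (fun t : ℝ => Φ t *
        Complex.exp ((-(((j - k : ℤ) : ℝ) * δ) : ℝ) * t * Complex.I) *
        Complex.exp (((j - k : ℤ) : ℂ) * θ * Complex.I)) :=
      fun j k => (integrable_mul_exp hΦ _).mul_const _
    rw [integral_finsetSum _ fun j _ => integrable_finsetSum _ fun k _ => hi j k]
    refine Finset.sum_congr rfl fun j _ => ?_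
    rw [integral_finsetSum _ fun k _ => hi j k]
    exact Finset.sum_congr rfl fun k _ => (integral_mul_const _ _).symm
  have hinteg : Integrable (fun p : ℝ × ℝ => ‖Φ p.2‖ * D p.1 p.2)
      ((volume.restrict (Ioc 0 (2 * π))).prod volume) := by
    have h1 : Integrable (fun p : ℝ × ℝ => (1 : ℝ) * ‖Φ p.2‖)
        ((volume.restrict (Ioc 0 (2 * π))).prod volume) :=
      Integrable.mul_prod (f := fun _ : ℝ => (1 : ℝ)) (integrable_const _) hΦ.norm
    simp_rw [one_mul] at h1
    exact h1.mul_bdd (c := (N : ℝ) ^ 2) hDc.aestronglyMeasurable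
      (Eventually.of_forall fun p => hDb _ _)
  simp_rw [hrepr]
  rw [intervalIntegral.integral_of_le (by positivity)]
  calc ∫ θ in Ioc 0 (2 * π), ‖∫ t, Φ t * D θ t‖
      ≤ ∫ θ in Ioc 0 (2 * π), ∫ t, ‖Φ t‖ * D θ t := by
        refine integral_mono_of_nonneg (Eventually.of_forall fun _ => norm_nonneg _)
          hinteg.integral_prod_left (Eventually.of_forall fun θ => ?_)
        refine (norm_integral_le_integral_norm _).trans (le_of_eq ?_)
        congr 1
        ext t
        rw [norm_mul, Complex.norm_real, Real.norm_of_nonneg (by positivity)]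
    _ = ∫ t, ∫ θ in Ioc 0 (2 * π), ‖Φ t‖ * D θ t := integral_integral_swap hinteg
    _ = ∫ t, ‖Φ t‖ * (2 * π * N) := by
        congr 1
        ext t
        rw [integral_const_mul, ← intervalIntegral.integral_of_le (by positivity)]
        have := integral_norm_sq_trigPolynomial (fun j => Complex.exp (-(j * δ * t * Complex.I))) N
        simp only [hD]
        rw [this]
        congr 2
        have : ∀ j ∈ Finset.range N, ‖Complex.exp (-(j * δ * t * Complex.I))‖ ^ 2 = 1 := by
          intro j _
          rw [norm_exp_mul_I_eq_one (-(j * δ * t)) (by push_cast; ring), one_pow]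
        rw [Finset.sum_congr rfl this]
        simp
    _ = _ := by rw [integral_mul_const]; ring

open Polynomial in
lemma sum_norm_fourier_div_le {Φ : ℝ → ℂ} (hΦ : Integrable Φ)
    (hz : ∀ ξ : ℝ, 0 < ξ → ∫ t, Φ t * Complex.exp (ξ * t * Complex.I) = 0) {δ : ℝ} (hδ : 0 < δ)
    (K : ℕ) :
    ∑ n ∈ Finset.range K, ‖∫ t, Φ t * Complex.exp ((-((n + 1) * δ) : ℝ) * t * Complex.I)‖ /
      (n + 1) ≤ 16 * ∫ t, ‖Φ t‖ := by
  rcases Nat.eq_zero_or_pos K with rfl | hK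
  · simp; positivity
  set c : ℝ → ℂ := fun ξ => ∫ t, Φ t * Complex.exp ((-ξ : ℝ) * t * Complex.I) with hc
  set N : ℕ := 2 * (K + 1) with hN
  have hN0 : (0 : ℝ) < N := by positivity
  have hNC : (N : ℂ) ≠ 0 := by exact_mod_cast hN0.ne'
  set P : ℂ[X] := ∑ n ∈ Finset.range N, C ((((N : ℂ) - n) / N) * c (n * δ)) * X ^ n with hP
  have hcoeff : ∀ n < N, P.coeff n = (((N : ℂ) - n) / N) * c (n * δ) := by
    intro n hn
    simp only [hP, finsetSum_coeff, coeff_C_mul_X_pow]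
    rw [Finset.sum_ite_eq]
    simp [hn]
  have heval : ∀ θ : ℝ, P.eval (Complex.exp (θ * Complex.I)) = (N : ℂ)⁻¹ *
      ∑ j ∈ Finset.range N, ∑ k ∈ Finset.range N,
      (∫ t, Φ t * Complex.exp ((-(((j - k : ℤ) : ℝ) * δ) : ℝ) * t * Complex.I)) *
        Complex.exp (((j - k : ℤ) : ℂ) * θ * Complex.I) := by
    intro θ
    have := sum_sum_sub_eq (F := fun m : ℤ => c (m * δ) * Complex.exp ((m : ℂ) * θ * Complex.I))
      (fun m hm => ?_) N
    · simp only [hc] at this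
      rw [this, Finset.mul_sum, hP, eval_finsetSum]
      refine Finset.sum_congr rfl fun n _ => ?_
      simp only [eval_mul, eval_C, eval_pow, eval_X, ← Complex.exp_nat_mul, hc]
      have e : Complex.exp (n * (θ * Complex.I)) = Complex.exp (n * θ * Complex.I) := by
        rw [mul_assoc]
      rw [e]
      simp only [Int.cast_natCast]
      ring
    · have : 0 < -((m : ℝ) * δ) := by
        have : (m : ℝ) < 0 := by exact_mod_cast hm
        nlinarith
      simp only [hc]
      rw [hz _ this, zero_mul]
  have h1 := polynomial_hardy P N
  have h2 := integral_norm_fejer_le hΦ δ N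
  simp_rw [heval, norm_mul] at h1
  rw [intervalIntegral.integral_const_mul] at h1
  have hpi := Real.pi_pos
  have h3 : ∑ n ∈ Finset.range N, ‖P.coeff n‖ / (n + 1) ≤ 4 * ∫ t, ‖Φ t‖ := by
    have : ‖(N : ℂ)⁻¹‖ = (N : ℝ)⁻¹ := by simp
    rw [this] at h1
    have h4 := mul_le_mul_of_nonneg_left h2 (inv_nonneg.2 hN0.le)
    have h5 : (N : ℝ)⁻¹ * (2 * π * N * ∫ t, ‖Φ t‖) = 2 * π * ∫ t, ‖Φ t‖ := by
      field_simp
    rw [h5] at h4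
    have h6 : 2 * π * ∑ n ∈ Finset.range N, ‖P.coeff n‖ / (n + 1) ≤
        2 * π * (4 * ∫ t, ‖Φ t‖) := by linarith
    exact le_of_mul_le_mul_left h6 (by positivity)
  have h4 : ∑ n ∈ Finset.range K, ‖c ((n + 1 : ℕ) * δ)‖ / (n + 1) ≤
      4 * ∑ n ∈ Finset.range K, ‖P.coeff (n + 1)‖ / ((n + 1 : ℕ) + 1) := by
    rw [Finset.mul_sum]
    refine Finset.sum_le_sum fun n hn => ?_
    have hn' := Finset.mem_range.1 hn
    rw [hcoeff (n + 1) (by omega), norm_mul]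
    have : (1 : ℝ) / 2 ≤ ‖((N : ℂ) - (n + 1 : ℕ)) / N‖ := by
      have e : ((N : ℂ) - (n + 1 : ℕ)) / N = (((N : ℝ) - (n + 1 : ℕ)) / N : ℝ) := by push_cast; rfl
      have hle : ((n + 1 : ℕ) : ℝ) ≤ N / 2 := by
        rw [hN]; push_cast
        have : (n : ℝ) + 1 ≤ K := by exact_mod_cast hn'
        linarith
      rw [e, Complex.norm_real]
      refine le_trans ?_ (le_abs_self _)
      rw [le_div_iff₀ hN0]
      linarith
    have hnn : (0 : ℝ) ≤ n := Nat.cast_nonneg n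
    push_cast at this ⊢
    rw [mul_div_assoc']
    rw [div_le_div_iff₀ (by positivity) (by positivity)]
    set A := ‖c ((n + 1) * δ)‖
    have hA : 0 ≤ A := norm_nonneg _
    have h7 : A / 2 ≤ ‖((N : ℂ) - (n + 1)) / N‖ * A := by nlinarith
    calc A * ((n : ℝ) + 1 + 1) ≤ (4 * (A / 2)) * (n + 1) := by nlinarith
      _ ≤ _ := by gcongr
  have h5 : ∑ n ∈ Finset.range K, ‖P.coeff (n + 1)‖ / ((n + 1 : ℕ) + 1) ≤
      ∑ n ∈ Finset.range N, ‖P.coeff n‖ / (n + 1) := by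
    have : ∑ n ∈ Finset.range (K + 1), ‖P.coeff n‖ / ((n : ℝ) + 1) ≤
        ∑ n ∈ Finset.range N, ‖P.coeff n‖ / ((n : ℝ) + 1) := by
      refine Finset.sum_le_sum_of_subset_of_nonneg (Finset.range_mono (by omega)) ?_
      intros; positivity
    rw [Finset.sum_range_succ'] at this
    refine le_trans ?_ this
    have : 0 ≤ ‖P.coeff 0‖ / (((0 : ℕ) : ℝ) + 1) := by positivity
    linarith
  push_cast at h4 h5
  simp only [hc] at h4
  linarith

/-- **Hardy's inequality** on the line: if the Fourier transform of an integrable function vanishes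
on one half-line, then it is integrable against `dξ/ξ` on the other one. -/
lemma lintegral_fourier_div_le {Φ : ℝ → ℂ} (hΦ : Integrable Φ)
    (hz : ∀ ξ : ℝ, 0 < ξ → ∫ t, Φ t * Complex.exp (ξ * t * Complex.I) = 0) :
    ∫⁻ ξ in Ioi (0 : ℝ), ‖(∫ t, Φ t * Complex.exp ((-ξ : ℝ) * t * Complex.I)) / ξ‖ₑ ≤
      ENNReal.ofReal (16 * ∫ t, ‖Φ t‖) := by
  set F : ℝ → ℂ := fun ξ => (∫ t, Φ t * Complex.exp ((-ξ : ℝ) * t * Complex.I)) / ξ with hF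
  have hcont : ContinuousOn F (Ioi 0) := by
    refine ContinuousOn.div ?_ (by fun_prop) fun ξ hξ => ?_
    · exact ((continuous_integral_mul_exp hΦ).comp continuous_neg).continuousOn
    · exact_mod_cast (ne_of_gt hξ)
  set q : ℕ → ℝ → ℝ := fun m ξ => (⌈ξ * (m + 1)⌉₊ : ℝ) / (m + 1) with hq
  have hqlim : ∀ ξ ∈ Ioi (0 : ℝ), Tendsto (fun m => q m ξ) atTop (nhds ξ) := by
    intro ξ hξ
    have h1 : Tendsto (fun m : ℕ => ξ + 1 / ((m : ℝ) + 1)) atTop (nhds ξ) := by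
      simpa using (tendsto_const_nhds (x := ξ)).add tendsto_one_div_add_atTop_nhds_zero_nat
    refine tendsto_of_tendsto_of_tendsto_of_le_of_le tendsto_const_nhds h1 ?_ ?_
    · intro m
      simp only [hq]
      rw [le_div_iff₀ (by positivity)]
      exact Nat.le_ceil _
    · intro m
      simp only [hq]
      rw [div_le_iff₀ (by positivity), add_mul, one_div, inv_mul_cancel₀ (by positivity)]
      exact (Nat.ceil_lt_add_one (mul_nonneg (le_of_lt hξ) (by positivity))).le
  have hmeas : ∀ m, Measurable fun ξ => ‖F (q m ξ)‖ₑ := by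
    intro m
    have : Measurable fun n : ℕ => ‖F ((n : ℝ) / (m + 1))‖ₑ := measurable_of_countable _
    exact this.comp (Nat.measurable_ceil.comp (measurable_id.mul_const _))
  have hbound : ∀ m : ℕ, ∫⁻ ξ in Ioi (0 : ℝ), ‖F (q m ξ)‖ₑ ≤
      ENNReal.ofReal (16 * ∫ t, ‖Φ t‖) := by
    intro m
    have hcover : Ioi (0 : ℝ) ⊆ ⋃ k : ℕ, Ioc ((k : ℝ) / (m + 1)) ((k + 1) / (m + 1)) := by
      intro ξ hξ
      have hpos : 0 < ξ * (m + 1) := mul_pos hξ (by positivity)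
      obtain ⟨k, hk⟩ := Nat.exists_eq_succ_of_ne_zero (Nat.ceil_pos.2 hpos).ne'
      refine mem_iUnion.2 ⟨k, ?_, ?_⟩
      · rw [div_lt_iff₀ (by positivity)]
        exact Nat.lt_ceil.1 (by omega)
      · rw [le_div_iff₀ (by positivity)]
        have := Nat.le_ceil (ξ * (m + 1))
        rw [hk] at this
        exact_mod_cast this
    refine (lintegral_mono_set hcover).trans ((lintegral_iUnion_le _ _).trans ?_)
    refine ENNReal.tsum_le_of_sum_range_le fun K => ?_
    have hterm : ∀ k : ℕ, ∫⁻ ξ in Ioc ((k : ℝ) / (m + 1)) ((k + 1) / (m + 1)), ‖F (q m ξ)‖ₑ =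
        ENNReal.ofReal (‖∫ t, Φ t * Complex.exp ((-((k + 1) * (1 / ((m : ℝ) + 1))) : ℝ) * t *
          Complex.I)‖ / (k + 1)) := by
      intro k
      have hconst : ∀ ξ ∈ Ioc ((k : ℝ) / (m + 1)) ((k + 1) / (m + 1)),
          ‖F (q m ξ)‖ₑ = ‖F ((k + 1) * (1 / ((m : ℝ) + 1)))‖ₑ := by
        intro ξ hξ
        have : ⌈ξ * (m + 1)⌉₊ = k + 1 := by
          rw [Nat.ceil_eq_iff (by omega)]
          refine ⟨?_, ?_⟩
          · have := (div_lt_iff₀ (by positivity)).1 hξ.1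
            simpa using this
          · have := (le_div_iff₀ (by positivity)).1 hξ.2
            exact_mod_cast this
        simp only [hq]
        rw [this]
        congr 2
        push_cast
        ring
      rw [setLIntegral_congr_fun measurableSet_Ioc hconst, setLIntegral_const, Real.volume_Ioc,
        ← ofReal_norm, ← ENNReal.ofReal_mul (norm_nonneg _)]
      congr 1
      simp only [hF]
      rw [norm_div, Complex.norm_real, Real.norm_of_nonneg (by positivity)]
      generalize ‖∫ t, Φ t * Complex.exp ((-((k + 1) * (1 / ((m : ℝ) + 1))) : ℝ) * t *
          Complex.I)‖ = A
      field_simp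
      ring
    simp_rw [hterm]
    rw [← ENNReal.ofReal_sum_of_nonneg fun _ _ => by positivity]
    exact ENNReal.ofReal_le_ofReal (sum_norm_fourier_div_le hΦ hz (by positivity) K)
  calc ∫⁻ ξ in Ioi (0 : ℝ), ‖F ξ‖ₑ
      = ∫⁻ ξ in Ioi (0 : ℝ), liminf (fun m => ‖F (q m ξ)‖ₑ) atTop := by
        refine setLIntegral_congr_fun measurableSet_Ioi fun ξ hξ => ?_
        have h1 := (hcont.continuousAt (Ioi_mem_nhds hξ)).tendsto.comp (hqlim ξ hξ)
        exact ((continuous_enorm.tendsto _).comp h1).liminf_eq.symm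
    _ ≤ liminf (fun m => ∫⁻ ξ in Ioi (0 : ℝ), ‖F (q m ξ)‖ₑ) atTop := lintegral_liminf_le hmeas
    _ ≤ _ := by
        refine liminf_le_of_le (by isBoundedDefault) fun b hb => ?_
        obtain ⟨m, hm⟩ := hb.exists
        exact hm.trans (hbound m)

end LineHardy

/-! ### Boundary values of Cauchy integrals -/

section Plemelj

/-- If the truncated integrals `∫ f(t) κ(t, δ) dt` converge as `δ → 0`, then so do their
averages in `δ` at scale `ε`. -/
lemma tendsto_integral_average_kernel {f : ℝ → ℂ} (hf : Integrable f) {κ : ℝ → ℝ → ℝ}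
    (hκm : Measurable (Function.uncurry κ)) (hκ : ∀ t δ, 0 < δ → |κ t δ| ≤ 1 / δ) {v : ℝ → ℝ}
    (hv : IntegrableOn v (Ioi 0)) (hv' : IntegrableOn (fun η => v η / η) (Ioi 0)) {L : ℂ}
    (hL : Tendsto (fun δ => ∫ t, f t * κ t δ) (nhdsWithin 0 (Ioi 0)) (nhds L)) :
    Tendsto (fun ε : ℝ => ∫ t, f t * ((∫ η in Ioi (0 : ℝ), v η * κ t (ε * η) : ℝ) : ℂ))
      (nhdsWithin 0 (Ioi 0)) (nhds (((∫ η in Ioi (0 : ℝ), v η : ℝ) : ℂ) * L)) := by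
  set M : ℝ → ℂ := fun δ => ∫ t, f t * κ t δ with hM
  have hfub : ∀ ε : ℝ, 0 < ε →
      ∫ t, f t * ((∫ η in Ioi (0 : ℝ), v η * κ t (ε * η) : ℝ) : ℂ) =
        ∫ η in Ioi (0 : ℝ), (v η : ℂ) * M (ε * η) := by
    intro ε hε
    have hinteg : Integrable (fun p : ℝ × ℝ => f p.1 * ((v p.2 * κ p.1 (ε * p.2) : ℝ) : ℂ))
        (volume.prod (volume.restrict (Ioi (0 : ℝ)))) := by
      have hdom : Integrable (fun p : ℝ × ℝ => f p.1 * ((v p.2 / p.2 : ℝ) : ℂ) * (ε⁻¹ : ℝ))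
          (volume.prod (volume.restrict (Ioi (0 : ℝ)))) :=
        (Integrable.mul_prod hf hv'.ofReal).mul_const _
      refine hdom.mono ?_ ?_
      · refine (hf.aestronglyMeasurable.comp_fst).mul ?_
        refine Complex.continuous_ofReal.comp_aestronglyMeasurable ?_
        refine (hv.aestronglyMeasurable.comp_snd).mul ?_
        refine Measurable.aestronglyMeasurable ?_
        exact hκm.comp (measurable_fst.prodMk (measurable_snd.const_mul ε))
      · have : ∀ᵐ p : ℝ × ℝ ∂(volume.prod (volume.restrict (Ioi (0 : ℝ)))), 0 < p.2 := by
          refine Measure.quasiMeasurePreserving_snd.ae ?_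
          exact ae_restrict_mem measurableSet_Ioi
        filter_upwards [this] with p hp
        rw [norm_mul, norm_mul, norm_mul, mul_assoc]
        gcongr
        rw [Complex.norm_real, Complex.norm_real, Complex.norm_real, norm_mul, norm_div,
          Real.norm_of_nonneg hp.le, Real.norm_of_nonneg (inv_nonneg.2 hε.le)]
        have := hκ p.1 (ε * p.2) (by positivity)
        calc ‖v p.2‖ * ‖κ p.1 (ε * p.2)‖ ≤ ‖v p.2‖ * (1 / (ε * p.2)) := by
              gcongr; exact this
          _ = _ := by field_simp
    calc _ = ∫ t, ∫ η in Ioi (0 : ℝ), f t * ((v η * κ t (ε * η) : ℝ) : ℂ) := by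
          congr 1
          ext t
          rw [integral_const_mul, integral_complex_ofReal]
      _ = ∫ η in Ioi (0 : ℝ), ∫ t, f t * ((v η * κ t (ε * η) : ℝ) : ℂ) :=
        integral_integral_swap hinteg
      _ = _ := by
          congr 1
          ext η
          simp only [hM]
          rw [← integral_const_mul]
          congr 1
          ext t
          push_cast
          ring
  obtain ⟨B, hB⟩ : ∃ B : ℝ, ∀ δ, 0 < δ → ‖M δ‖ ≤ B := by
    have h1 : ∀ᶠ δ in nhdsWithin (0 : ℝ) (Ioi 0), ‖M δ‖ < ‖L‖ + 1 :=
      hL.norm.eventually_lt_const (by linarith)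
    obtain ⟨δ₀, hδ₀, h2⟩ := mem_nhdsGT_iff_exists_Ioo_subset.1 h1
    have hδ₀' : 0 < δ₀ := hδ₀
    refine ⟨max (‖L‖ + 1) ((∫ t, ‖f t‖) / δ₀), fun δ hδ => ?_⟩
    rcases lt_or_ge δ δ₀ with h | h
    · exact (h2 ⟨hδ, h⟩).le.trans (le_max_left _ _)
    · refine le_trans ?_ (le_max_right _ _)
      refine (norm_integral_le_integral_norm _).trans ?_
      rw [div_eq_mul_inv, ← integral_mul_const]
      refine integral_mono_of_nonneg (Eventually.of_forall fun _ => norm_nonneg _)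
        (hf.norm.mul_const _) (Eventually.of_forall fun t => ?_)
      simp only [norm_mul, Complex.norm_real]
      gcongr
      refine (hκ t δ hδ).trans ?_
      rw [one_div]
      gcongr
  have hmul : ((∫ η in Ioi (0 : ℝ), v η : ℝ) : ℂ) * L = ∫ η in Ioi (0 : ℝ), (v η : ℂ) * L := by
    rw [integral_mul_const, integral_complex_ofReal]
  rw [hmul]
  have hev : (fun ε : ℝ => ∫ η in Ioi (0 : ℝ), (v η : ℂ) * M (ε * η)) =ᶠ[nhdsWithin 0 (Ioi 0)]
      fun ε : ℝ => ∫ t, f t * ((∫ η in Ioi (0 : ℝ), v η * κ t (ε * η) : ℝ) : ℂ) := by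
    filter_upwards [self_mem_nhdsWithin] with ε hε using (hfub ε hε).symm
  refine Tendsto.congr' hev ?_
  refine tendsto_integral_filter_of_dominated_convergence (fun η => ‖v η‖ * B) ?_ ?_
    (hv.norm.mul_const _) ?_
  · filter_upwards [self_mem_nhdsWithin] with ε hε
    refine (Complex.continuous_ofReal.comp_aestronglyMeasurable hv.aestronglyMeasurable).mul ?_
    refine AEStronglyMeasurable.integral_prod_right'
      (f := fun p : ℝ × ℝ => f p.2 * κ p.2 (ε * p.1)) ?_
    refine (hf.aestronglyMeasurable.comp_snd).mul ?_
    refine Measurable.aestronglyMeasurable ?_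
    exact Complex.measurable_ofReal.comp
      (hκm.comp (measurable_snd.prodMk (measurable_fst.const_mul ε)))
  · filter_upwards [self_mem_nhdsWithin] with ε hε
    filter_upwards [ae_restrict_mem measurableSet_Ioi] with η hη
    rw [norm_mul, Complex.norm_real]
    gcongr
    exact hB _ (mul_pos hε hη)
  · filter_upwards [ae_restrict_mem measurableSet_Ioi] with η hη
    refine Tendsto.const_mul _ (hL.comp ?_)
    refine tendsto_nhdsWithin_iff.2 ⟨?_, ?_⟩
    · have : Tendsto (fun ε : ℝ => ε * η) (nhds 0) (nhds 0) := by
        have : Continuous fun ε : ℝ => ε * η := by fun_prop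
        simpa using this.tendsto 0
      exact this.mono_left nhdsWithin_le_nhds
    · filter_upwards [self_mem_nhdsWithin] with ε hε using
        mem_Ioi.2 (mul_pos (mem_Ioi.1 hε) (mem_Ioi.1 hη))

lemma hasDerivAt_neg_inv_one_add_sq (η : ℝ) :
    HasDerivAt (fun η : ℝ => -(1 + η ^ 2)⁻¹) (2 * η / (1 + η ^ 2) ^ 2) η := by
  have h : HasDerivAt (fun η : ℝ => 1 + η ^ 2) (2 * η) η := by
    simpa using (hasDerivAt_pow 2 η).const_add 1
  refine ((h.inv (by positivity)).neg).congr_deriv ?_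
  ring

lemma tendsto_inv_one_add_sq_atTop :
    Tendsto (fun η : ℝ => -(1 + η ^ 2)⁻¹) atTop (nhds 0) := by
  have : Tendsto (fun η : ℝ => 1 + η ^ 2) atTop atTop :=
    tendsto_atTop_add_const_left _ _ (tendsto_pow_atTop (by norm_num))
  simpa using this.inv_tendsto_atTop.neg

lemma integrableOn_cauchyWeight {c : ℝ} (hc : 0 ≤ c) :
    IntegrableOn (fun η : ℝ => 2 * η / (1 + η ^ 2) ^ 2) (Ioi c) := by
  refine integrableOn_Ioi_deriv_of_nonneg' (fun η _ => hasDerivAt_neg_inv_one_add_sq η) ?_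
    tendsto_inv_one_add_sq_atTop
  intro η hη
  have : 0 < η := hc.trans_lt hη
  positivity

lemma integral_cauchyWeight_Ioi {c : ℝ} (hc : 0 ≤ c) :
    ∫ η in Ioi c, 2 * η / (1 + η ^ 2) ^ 2 = (1 + c ^ 2)⁻¹ := by
  rw [integral_Ioi_of_hasDerivAt_of_tendsto' (fun η _ => hasDerivAt_neg_inv_one_add_sq η)
    (integrableOn_cauchyWeight hc) tendsto_inv_one_add_sq_atTop]
  ring

lemma integral_cauchyWeight_Ioc {c : ℝ} (hc : 0 ≤ c) :
    ∫ η in Ioc 0 c, 2 * η / (1 + η ^ 2) ^ 2 = 1 - (1 + c ^ 2)⁻¹ := by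
  have h := integral_cauchyWeight_Ioi hc
  have h0 := integral_cauchyWeight_Ioi le_rfl
  rw [← Ioc_union_Ioi_eq_Ioi hc, setIntegral_union (Ioc_disjoint_Ioi le_rfl) measurableSet_Ioi
    ((integrableOn_cauchyWeight le_rfl).mono_set Ioc_subset_Ioi_self)
    (integrableOn_cauchyWeight hc), h] at h0
  norm_num at h0
  linarith

lemma hasDerivAt_poissonWeight (η : ℝ) :
    HasDerivAt (fun η : ℝ => 2 * arctan η - 2 * η * (1 + η ^ 2)⁻¹)
      (2 * η * (2 * η / (1 + η ^ 2) ^ 2)) η := by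
  have h1 := (hasDerivAt_arctan η).const_mul 2
  have h2 := ((hasDerivAt_id η).const_mul 2).mul (hasDerivAt_neg_inv_one_add_sq η)
  have e : (fun η : ℝ => 2 * arctan η - 2 * η * (1 + η ^ 2)⁻¹) =
      (fun y => 2 * arctan y) + (fun y => 2 * id y) * fun η => -(1 + η ^ 2)⁻¹ := by
    ext y
    simp only [Pi.add_apply, Pi.mul_apply, id]
    ring
  rw [e]
  refine (h1.add h2).congr_deriv ?_
  simp only [id]
  field_simp
  ring

lemma tendsto_poissonWeight :
    Tendsto (fun η : ℝ => 2 * arctan η - 2 * η * (1 + η ^ 2)⁻¹) atTop (nhds π) := by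
  have h1 : Tendsto (fun η : ℝ => 2 * arctan η) atTop (nhds π) := by
    have := (tendsto_nhds_of_tendsto_nhdsWithin tendsto_arctan_atTop).const_mul 2
    convert this using 2
    ring
  have h2 : Tendsto (fun η : ℝ => 2 * η * (1 + η ^ 2)⁻¹) atTop (nhds 0) := by
    have h3 : Tendsto (fun η : ℝ => 2 * η⁻¹) atTop (nhds 0) := by
      simpa using (tendsto_inv_atTop_zero (𝕜 := ℝ)).const_mul 2
    refine squeeze_zero' ?_ ?_ h3
    · filter_upwards [eventually_gt_atTop 0] with η hη
      positivity
    · filter_upwards [eventually_gt_atTop 0] with η hη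
      rw [← div_eq_mul_inv, ← div_eq_mul_inv, div_le_div_iff₀ (by positivity) hη]
      nlinarith
  simpa using h1.sub h2

lemma integrableOn_poissonWeight :
    IntegrableOn (fun η : ℝ => 2 * η * (2 * η / (1 + η ^ 2) ^ 2)) (Ioi 0) := by
  refine integrableOn_Ioi_deriv_of_nonneg' (fun η _ => hasDerivAt_poissonWeight η) ?_
    tendsto_poissonWeight
  intro η hη
  have : 0 < η := hη
  positivity

lemma integral_poissonWeight :
    ∫ η in Ioi (0 : ℝ), 2 * η * (2 * η / (1 + η ^ 2) ^ 2) = π := by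
  rw [integral_Ioi_of_hasDerivAt_of_tendsto' (fun η _ => hasDerivAt_poissonWeight η)
    integrableOn_poissonWeight tendsto_poissonWeight]
  simp

lemma integral_truncated_inv (s : ℝ) {ε : ℝ} (hε : 0 < ε) :
    ∫ η in Ioi (0 : ℝ), 2 * η / (1 + η ^ 2) ^ 2 * (if ε * η < |s| then s⁻¹ else 0) =
      s / (s ^ 2 + ε ^ 2) := by
  have hc : 0 ≤ |s| / ε := by positivity
  have e : ∀ η ∈ Ioi (0 : ℝ), 2 * η / (1 + η ^ 2) ^ 2 * (if ε * η < |s| then s⁻¹ else 0) =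
      (Iio (|s| / ε)).indicator (fun η => 2 * η / (1 + η ^ 2) ^ 2 * s⁻¹) η := by
    intro η _
    by_cases h : ε * η < |s|
    · rw [if_pos h, indicator_of_mem]
      rw [mem_Iio, lt_div_iff₀ hε]
      linarith
    · rw [if_neg h, indicator_of_notMem, mul_zero]
      rw [mem_Iio, lt_div_iff₀ hε]
      linarith
  rw [setIntegral_congr_fun measurableSet_Ioi e, setIntegral_indicator measurableSet_Iio,
    integral_mul_const, Ioi_inter_Iio, ← integral_Ioc_eq_integral_Ioo,
    integral_cauchyWeight_Ioc hc, div_pow, sq_abs]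
  rcases eq_or_ne s 0 with rfl | hs
  · simp
  · have : s ^ 2 + ε ^ 2 ≠ 0 := by positivity
    field_simp
    ring

lemma integral_truncated_const (s : ℝ) {ε : ℝ} (hε : 0 < ε) :
    ∫ η in Ioi (0 : ℝ), 2 * η * (2 * η / (1 + η ^ 2) ^ 2) *
      (if |s| < ε * η then (2 * (ε * η))⁻¹ else 0) = ε / (s ^ 2 + ε ^ 2) := by
  have hc : 0 ≤ |s| / ε := by positivity
  have e : ∀ η ∈ Ioi (0 : ℝ), 2 * η * (2 * η / (1 + η ^ 2) ^ 2) *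
      (if |s| < ε * η then (2 * (ε * η))⁻¹ else 0) =
      (Ioi (|s| / ε)).indicator (fun η => 2 * η / (1 + η ^ 2) ^ 2 * ε⁻¹) η := by
    intro η hη
    have hη' : η ≠ 0 := ne_of_gt hη
    by_cases h : |s| < ε * η
    · rw [if_pos h, indicator_of_mem]
      · field_simp
      · rw [mem_Ioi, div_lt_iff₀ hε]
        linarith
    · rw [if_neg h, indicator_of_notMem, mul_zero]
      rw [mem_Ioi, div_lt_iff₀ hε]
      linarith
  rw [setIntegral_congr_fun measurableSet_Ioi e, setIntegral_indicator measurableSet_Ioi,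
    integral_mul_const, Ioi_inter_Ioi, sup_of_le_right hc, integral_cauchyWeight_Ioi hc, div_pow,
    sq_abs]
  field_simp
  ring

lemma tendsto_integral_conj_poisson {f : ℝ → ℂ} (hf : Integrable f) {x : ℝ} {L : ℂ}
    (hL : Tendsto (fun δ : ℝ => ∫ t in {t : ℝ | δ < |t - x|}, f t / ((t : ℂ) - x))
      (nhdsWithin 0 (Ioi 0)) (nhds L)) :
    Tendsto (fun ε : ℝ => ∫ t, f t * (((t - x) / ((t - x) ^ 2 + ε ^ 2) : ℝ) : ℂ))
      (nhdsWithin 0 (Ioi 0)) (nhds L) := by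
  have key := tendsto_integral_average_kernel hf
    (κ := fun t δ => if δ < |t - x| then (t - x)⁻¹ else 0) (L := L) ?_ ?_
    (integrableOn_cauchyWeight le_rfl) ?_ ?_
  · rw [integral_cauchyWeight_Ioi le_rfl] at key
    norm_num at key
    refine Tendsto.congr' ?_ key
    filter_upwards [self_mem_nhdsWithin] with ε hε
    congr 1
    ext t
    rw [← integral_truncated_inv (t - x) hε]
    simp
  · refine Measurable.ite ?_ (by fun_prop) (by fun_prop)
    exact measurableSet_lt (by fun_prop) (by fun_prop)
  · intro t δ hδ
    split_ifs with h
    · rw [abs_inv, one_div]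
      gcongr
    · simp; positivity
  · refine Integrable.mono' (g := fun η : ℝ => 2 * (1 + η ^ 2)⁻¹)
      (integrable_inv_one_add_sq.const_mul 2).integrableOn ?_ ?_
    · exact Measurable.aestronglyMeasurable (by fun_prop)
    · filter_upwards [ae_restrict_mem measurableSet_Ioi] with η hη
      have hη' : 0 < η := hη
      rw [Real.norm_of_nonneg (by positivity)]
      rw [div_div, ← div_eq_mul_inv, div_le_div_iff₀ (by positivity) (by positivity)]
      have : 0 ≤ η ^ 3 := by positivity
      nlinarith [sq_nonneg (η ^ 2), mul_nonneg hη'.le (sq_nonneg (η ^ 2))]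
  · refine hL.congr fun δ => ?_
    rw [← integral_indicator (measurableSet_lt (by fun_prop) (by fun_prop))]
    congr 1
    ext t
    by_cases h : δ < |t - x|
    · rw [indicator_of_mem (by exact h), if_pos h]
      push_cast
      rfl
    · rw [indicator_of_notMem (by exact h), if_neg h]
      simp

lemma tendsto_integral_poisson {f : ℝ → ℂ} (hf : Integrable f) {x : ℝ} {L : ℂ}
    (hL : Tendsto (fun δ : ℝ => ∫ t, f t * ((if |t - x| < δ then (2 * δ)⁻¹ else 0 : ℝ) : ℂ))
      (nhdsWithin 0 (Ioi 0)) (nhds L)) :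
    Tendsto (fun ε : ℝ => ∫ t, f t * ((ε / ((t - x) ^ 2 + ε ^ 2) : ℝ) : ℂ))
      (nhdsWithin 0 (Ioi 0)) (nhds (π * L)) := by
  have key := tendsto_integral_average_kernel hf
    (κ := fun t δ => if |t - x| < δ then (2 * δ)⁻¹ else 0) (L := L) ?_ ?_
    integrableOn_poissonWeight ?_ hL
  · rw [integral_poissonWeight] at key
    refine Tendsto.congr' ?_ key
    filter_upwards [self_mem_nhdsWithin] with ε hε
    congr 1
    ext t
    rw [← integral_truncated_const (t - x) hε]
  · refine Measurable.ite ?_ (by fun_prop) (by fun_prop)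
    exact measurableSet_lt (by fun_prop) (by fun_prop)
  · intro t δ hδ
    split_ifs with h
    · rw [abs_inv, one_div, abs_of_pos (by positivity)]
      gcongr
      linarith
    · simp; positivity
  · have h : IntegrableOn (fun η : ℝ => 2 * (2 * η / (1 + η ^ 2) ^ 2)) (Ioi 0) :=
      (integrableOn_cauchyWeight le_rfl).const_mul 2
    refine h.congr_fun (fun η hη => ?_) measurableSet_Ioi
    have hη' : η ≠ 0 := ne_of_gt hη
    field_simp

lemma ae_tendsto_symm_average {f : ℝ → ℂ} (hf : Integrable f) :
    ∀ᵐ x : ℝ, Tendsto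
      (fun δ : ℝ => ∫ t, f t * ((if |t - x| < δ then (2 * δ)⁻¹ else 0 : ℝ) : ℂ))
      (nhdsWithin 0 (Ioi 0)) (nhds (f x)) := by
  filter_upwards [IsUnifLocDoublingMeasure.ae_tendsto_average volume hf.locallyIntegrable 1]
    with x hx
  have h := hx (l := nhdsWithin 0 (Ioi 0)) (fun _ => x) (fun δ => δ) tendsto_id ?_
  · refine Tendsto.congr' ?_ h
    filter_upwards [self_mem_nhdsWithin] with δ hδ
    have hδ' : (0 : ℝ) < δ := hδ
    have e : ∀ t, f t * ((if |t - x| < δ then (2 * δ)⁻¹ else 0 : ℝ) : ℂ) =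
        (Ioo (x - δ) (x + δ)).indicator (fun t => f t * (((2 * δ)⁻¹ : ℝ) : ℂ)) t := by
      intro t
      by_cases h : |t - x| < δ
      · rw [if_pos h, indicator_of_mem]
        rw [abs_lt] at h
        exact ⟨by linarith, by linarith⟩
      · rw [if_neg h, indicator_of_notMem]
        · simp
        · rintro ⟨h1, h2⟩
          exact h (abs_lt.2 ⟨by linarith, by linarith⟩)
    simp_rw [e]
    rw [integral_indicator measurableSet_Ioo, integral_mul_const, ← integral_Icc_eq_integral_Ioo,
      setAverage_eq, Real.closedBall_eq_Icc, Measure.real, Real.volume_Icc,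
      ENNReal.toReal_ofReal (by linarith)]
    rw [Complex.real_smul, mul_comm]
    congr 3
    ring
  · filter_upwards [self_mem_nhdsWithin] with δ hδ
    have hpos : (0 : ℝ) < δ := hδ
    simp [hpos.le]

/-- Boundary values of `∫ t f(t) / (t² - z²) dt` at `x > 0` from the upper half-plane (`σ = 1`) or
from the lower one (`σ = -1`). -/
lemma tendsto_integral_div_sq_sub_sq {f : ℝ → ℂ} (hf : IntegrableOn f (Ioi 0)) {x : ℝ}
    (hx : 0 < x) {H L : ℂ}
    (hH : Tendsto (fun δ : ℝ => ((2 / π : ℝ) : ℂ) *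
      ∫ t in {t : ℝ | 0 < t ∧ δ < |t - x|}, (t : ℂ) * f t / ((t : ℂ) ^ 2 - (x : ℂ) ^ 2))
      (nhdsWithin 0 (Ioi 0)) (nhds H))
    (hL : Tendsto (fun δ : ℝ => ∫ t, (Ioi (0 : ℝ)).indicator f t *
        ((if |t - x| < δ then (2 * δ)⁻¹ else 0 : ℝ) : ℂ))
      (nhdsWithin 0 (Ioi 0)) (nhds L)) {σ : ℝ} (hσ : σ ^ 2 = 1) :
    Tendsto (fun ε : ℝ => ∫ t in Ioi (0 : ℝ),
        (t : ℂ) * f t / ((t : ℂ) ^ 2 - ((x : ℂ) + σ * ε * Complex.I) ^ 2))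
      (nhdsWithin 0 (Ioi 0)) (nhds (π / 2 * (H + σ * Complex.I * L))) := by
  have hpi : (π : ℂ) ≠ 0 := by exact_mod_cast Real.pi_ne_zero
  set F : ℝ → ℂ := (Ioi (0 : ℝ)).indicator f with hF
  have hFi : Integrable F := (integrable_indicator_iff measurableSet_Ioi).2 hf
  have hsum : ∀ a : ℂ, 0 ≤ a.re → Integrable (fun t : ℝ => f t / ((t : ℂ) + (x + a)))
      (volume.restrict (Ioi 0)) := by
    intro a ha
    refine Integrable.mono' (g := fun t => ‖f t‖ * x⁻¹) (hf.norm.mul_const _) ?_ ?_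
    · refine hf.aestronglyMeasurable.div₀ ?_
      exact Measurable.aestronglyMeasurable (by fun_prop)
    · filter_upwards [ae_restrict_mem measurableSet_Ioi] with t ht
      have ht' : 0 < t := ht
      rw [norm_div, div_eq_mul_inv]
      gcongr
      refine le_trans ?_ (Complex.abs_re_le_norm _)
      rw [le_abs]
      left
      simp
      linarith
  have hJ : Tendsto (fun δ : ℝ => ∫ t in {t : ℝ | 0 < t ∧ δ < |t - x|}, f t / ((t : ℂ) + x))
      (nhdsWithin 0 (Ioi 0)) (nhds (∫ t in Ioi (0 : ℝ), f t / ((t : ℂ) + x))) := by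
    have hI := hsum 0 le_rfl
    simp only [add_zero] at hI
    have hset : ∀ δ : ℝ, {t : ℝ | 0 < t ∧ δ < |t - x|} = Ioi 0 ∩ {t : ℝ | δ < |t - x|} :=
      fun δ => rfl
    have hm : ∀ δ : ℝ, MeasurableSet {t : ℝ | δ < |t - x|} :=
      fun δ => measurableSet_lt (by fun_prop) (by fun_prop)
    simp_rw [hset, ← setIntegral_indicator (hm _)]
    refine tendsto_integral_filter_of_dominated_convergence _ ?_ ?_ hI.norm ?_
    · exact Eventually.of_forall fun δ => hI.aestronglyMeasurable.indicator (hm δ)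
    · exact Eventually.of_forall fun δ => Eventually.of_forall fun t =>
        norm_indicator_le_norm_self _ _
    · have hne : ∀ᵐ t ∂(volume.restrict (Ioi (0 : ℝ))), t ≠ x :=
        ae_restrict_of_ae (Measure.ae_ne volume x)
      filter_upwards [hne] with t ht
      refine tendsto_const_nhds.congr' ?_
      have : ∀ᶠ δ in nhdsWithin (0 : ℝ) (Ioi 0), δ < |t - x| :=
        nhdsWithin_le_nhds (eventually_lt_nhds (abs_pos.2 (sub_ne_zero.2 ht)))
      filter_upwards [this] with δ hδ
      rw [indicator_of_mem (by exact hδ)]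
  have hPV : Tendsto (fun δ : ℝ => ∫ t in {t : ℝ | δ < |t - x|}, F t / ((t : ℂ) - x))
      (nhdsWithin 0 (Ioi 0)) (nhds (π * H - ∫ t in Ioi (0 : ℝ), f t / ((t : ℂ) + x))) := by
    refine ((hH.const_mul (π : ℂ)).sub hJ).congr' ?_
    filter_upwards [self_mem_nhdsWithin] with δ hδ
    have hδ' : 0 < δ := hδ
    have hm' : MeasurableSet {t : ℝ | δ < |t - x|} :=
      measurableSet_lt (by fun_prop) (by fun_prop)
    have hm : MeasurableSet {t : ℝ | 0 < t ∧ δ < |t - x|} := measurableSet_Ioi.inter hm'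
    have hR : ∫ t in {t : ℝ | δ < |t - x|}, F t / ((t : ℂ) - x) =
        ∫ t in {t : ℝ | 0 < t ∧ δ < |t - x|}, f t / ((t : ℂ) - x) := by
      have : ∀ t : ℝ, F t / ((t : ℂ) - x) =
          (Ioi (0 : ℝ)).indicator (fun t : ℝ => f t / ((t : ℂ) - x)) t := by
        intro t
        by_cases h : t ∈ Ioi (0 : ℝ)
        · rw [indicator_of_mem h, hF, indicator_of_mem h]
        · rw [indicator_of_notMem h, hF, indicator_of_notMem h, zero_div]
      simp_rw [this]
      rw [setIntegral_indicator measurableSet_Ioi, inter_comm]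
      rfl
    have hI1 : IntegrableOn (fun t : ℝ => f t / ((t : ℂ) - x)) {t : ℝ | 0 < t ∧ δ < |t - x|} := by
      have hfs : IntegrableOn f {t : ℝ | 0 < t ∧ δ < |t - x|} := hf.mono_set fun t ht => ht.1
      refine Integrable.mono' (g := fun t => ‖f t‖ * δ⁻¹) (hfs.norm.mul_const _) ?_ ?_
      · refine hfs.aestronglyMeasurable.div₀ ?_
        exact Measurable.aestronglyMeasurable (by fun_prop)
      · filter_upwards [ae_restrict_mem hm] with t ht
        have ht' : δ ≤ |t - x| := ht.2.le
        rw [norm_div, div_eq_mul_inv, ← Complex.ofReal_sub, Complex.norm_real, Real.norm_eq_abs]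
        gcongr
    have hI2 : IntegrableOn (fun t : ℝ => f t / ((t : ℂ) + x)) {t : ℝ | 0 < t ∧ δ < |t - x|} := by
      have hI := hsum 0 le_rfl
      simp only [add_zero] at hI
      exact IntegrableOn.mono_set hI fun t ht => ht.1
    rw [hR]
    have : ∫ t in {t : ℝ | 0 < t ∧ δ < |t - x|}, (t : ℂ) * f t / ((t : ℂ) ^ 2 - (x : ℂ) ^ 2) =
        ((∫ t in {t : ℝ | 0 < t ∧ δ < |t - x|}, f t / ((t : ℂ) - x)) +
          ∫ t in {t : ℝ | 0 < t ∧ δ < |t - x|}, f t / ((t : ℂ) + x)) / 2 := by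
      rw [← integral_add hI1 hI2, ← integral_div]
      refine setIntegral_congr_fun hm fun t ht => ?_
      have h1 : (t : ℂ) - x ≠ 0 := by
        rw [← Complex.ofReal_sub]
        exact_mod_cast abs_pos.1 (hδ'.trans ht.2)
      have h2 : (t : ℂ) + x ≠ 0 := by
        rw [← Complex.ofReal_add]
        exact_mod_cast (add_pos ht.1 hx).ne'
      have h3 : (t : ℂ) ^ 2 - (x : ℂ) ^ 2 ≠ 0 := by
        rw [sq_sub_sq]; exact mul_ne_zero h2 h1
      rw [div_add_div _ _ h1 h2, div_div, div_eq_div_iff h3 (by simp [h1, h2])]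
      ring
    rw [this]
    push_cast
    field_simp
    ring
  have hJ2 : Tendsto (fun ε : ℝ => ∫ t in Ioi (0 : ℝ), f t / ((t : ℂ) + (x + σ * ε * Complex.I)))
      (nhdsWithin 0 (Ioi 0)) (nhds (∫ t in Ioi (0 : ℝ), f t / ((t : ℂ) + x))) := by
    refine tendsto_integral_filter_of_dominated_convergence (fun t => ‖f t‖ * x⁻¹) ?_ ?_
      (hf.norm.mul_const _) ?_
    · exact Eventually.of_forall fun ε => (hsum (σ * ε * Complex.I) (by simp)).aestronglyMeasurable
    · refine Eventually.of_forall fun ε => ?_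
      filter_upwards [ae_restrict_mem measurableSet_Ioi] with t ht
      have ht' : 0 < t := ht
      rw [norm_div, div_eq_mul_inv]
      gcongr
      refine le_trans ?_ (Complex.abs_re_le_norm _)
      rw [le_abs]
      left
      simp
      linarith
    · filter_upwards [ae_restrict_mem measurableSet_Ioi] with t ht
      have h2 : (t : ℂ) + x ≠ 0 := by
        rw [← Complex.ofReal_add]
        exact_mod_cast (add_pos ht hx).ne'
      have hc : ContinuousAt (fun ε : ℝ => f t / ((t : ℂ) + (x + σ * ε * Complex.I))) 0 := by
        refine ContinuousAt.div (by fun_prop) (by fun_prop) ?_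
        simpa using h2
      have := hc.tendsto.mono_left (nhdsWithin_le_nhds (s := Ioi 0))
      simpa using this
  have h1 := tendsto_integral_conj_poisson hFi hPV
  have h2 := tendsto_integral_poisson hFi hL
  have h3 := ((h1.add (h2.const_mul (σ * Complex.I))).add hJ2).div_const 2
  have elim : (π * H - (∫ t in Ioi (0 : ℝ), f t / ((t : ℂ) + x)) + σ * Complex.I * (π * L) +
      ∫ t in Ioi (0 : ℝ), f t / ((t : ℂ) + x)) / 2 = π / 2 * (H + σ * Complex.I * L) := by ring
  rw [elim] at h3
  refine h3.congr' ?_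
  filter_upwards [self_mem_nhdsWithin] with ε hε
  have hε' : 0 < ε := hε
  have hbd : ∀ k : ℝ → ℝ, Measurable k → ∀ B : ℝ, (∀ t, |k t| ≤ B) →
      Integrable (fun t => F t * (k t : ℂ)) := by
    intro k hk B hB
    refine hFi.mul_bdd (c := B) ?_ (Eventually.of_forall fun t => ?_)
    · exact (Complex.measurable_ofReal.comp hk).aestronglyMeasurable
    · rw [Complex.norm_real]; exact hB t
  have i1 : Integrable (fun t => F t * (((t - x) / ((t - x) ^ 2 + ε ^ 2) : ℝ) : ℂ)) := by
    refine hbd _ (by fun_prop) ε⁻¹ fun t => ?_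
    rw [abs_div, abs_of_pos (by positivity : 0 < (t - x) ^ 2 + ε ^ 2), ← one_div,
      div_le_div_iff₀ (by positivity) hε', ← sq_abs (t - x)]
    nlinarith [sq_nonneg (|t - x| - ε), sq_nonneg (|t - x| + ε), abs_nonneg (t - x)]
  have i2 : Integrable (fun t => F t * ((ε / ((t - x) ^ 2 + ε ^ 2) : ℝ) : ℂ)) := by
    refine hbd _ (by fun_prop) ε⁻¹ fun t => ?_
    rw [abs_of_pos (by positivity), ← one_div, div_le_div_iff₀ (by positivity) hε']
    nlinarith [sq_nonneg (t - x)]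
  have eset : ∀ k : ℝ → ℂ, ∫ t, F t * k t = ∫ t in Ioi (0 : ℝ), f t * k t := by
    intro k
    rw [← integral_indicator measurableSet_Ioi]
    congr 1
    ext t
    rw [hF, ← Set.indicator_mul_left]
  rw [← integral_const_mul, ← integral_add i1 (i2.const_mul _)]
  have e4 : ∫ t, (F t * (((t - x) / ((t - x) ^ 2 + ε ^ 2) : ℝ) : ℂ) +
      σ * Complex.I * (F t * ((ε / ((t - x) ^ 2 + ε ^ 2) : ℝ) : ℂ))) =
      ∫ t, F t * (((t : ℂ) - (x + σ * ε * Complex.I))⁻¹) := by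
    congr 1
    ext t
    have h5 : (t : ℂ) - (x + σ * ε * Complex.I) ≠ 0 := by
      intro h
      have := congrArg Complex.im h
      simp at this
      rcases this with h | h
      · rw [h] at hσ; norm_num at hσ
      · exact hε'.ne' h
    have h6 : ((t : ℂ) - x) ^ 2 + ε ^ 2 ≠ 0 := by
      have : (0 : ℝ) < (t - x) ^ 2 + ε ^ 2 := by positivity
      exact_mod_cast this.ne'
    have hσC : (σ : ℂ) ^ 2 = 1 := by exact_mod_cast hσ
    have h7 : ((t : ℂ) - (x + σ * ε * Complex.I))⁻¹ =
        ((t - x) + σ * Complex.I * ε) / (((t : ℂ) - x) ^ 2 + ε ^ 2) := by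
      rw [inv_eq_one_div, div_eq_div_iff h5 h6]
      linear_combination ((ε : ℂ) ^ 2 * Complex.I ^ 2) * hσC + (ε : ℂ) ^ 2 * Complex.I_sq
    rw [h7]
    push_cast
    ring
  have i3 : IntegrableOn (fun t : ℝ => f t * (((t : ℂ) - (x + σ * ε * Complex.I))⁻¹)) (Ioi 0) := by
    refine hf.mul_bdd (c := ε⁻¹) (Measurable.aestronglyMeasurable (by fun_prop)) ?_
    refine Eventually.of_forall fun t => ?_
    rw [norm_inv]
    gcongr
    refine le_trans ?_ (Complex.abs_im_le_norm _)
    have : |σ| = 1 := by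
      rw [← sq_eq_sq₀ (abs_nonneg _) zero_le_one, sq_abs, hσ, one_pow]
    simp [abs_mul, this, abs_of_pos hε']
  rw [e4, eset, ← integral_add i3 (hsum (σ * ε * Complex.I) (by simp)), ← integral_div]
  refine setIntegral_congr_fun measurableSet_Ioi fun t ht => ?_
  have h5 : (t : ℂ) - (x + σ * ε * Complex.I) ≠ 0 := by
    intro h
    have := congrArg Complex.im h
    simp at this
    rcases this with h | h
    · rw [h] at hσ; norm_num at hσ
    · exact hε'.ne' h
  have h6 : (t : ℂ) + (x + σ * ε * Complex.I) ≠ 0 := by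
    intro h
    have := congrArg Complex.re h
    simp at this
    have ht' : 0 < t := ht
    linarith
  have h7 : (t : ℂ) ^ 2 - (x + σ * ε * Complex.I) ^ 2 ≠ 0 := by
    rw [sq_sub_sq]; exact mul_ne_zero h6 h5
  rw [← div_eq_mul_inv, div_add_div _ _ h5 h6, div_div, div_eq_div_iff (by simp [h5, h6]) h7]
  ring

end Plemelj

/-! ### Boundary values of functions on the upper half-plane -/

section UpperHalfPlane

lemma integrable_of_le_div_one_add_sq {B : ℝ → ℂ} {K : ℝ} (hc : Continuous B)
    (hB : ∀ t, ‖B t‖ ≤ K / (1 + t ^ 2)) : Integrable B := by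
  refine Integrable.mono' (g := fun t : ℝ => K * (1 + t ^ 2)⁻¹)
    (integrable_inv_one_add_sq.const_mul K) hc.aestronglyMeasurable ?_
  exact Eventually.of_forall fun t => by rw [← div_eq_mul_inv]; exact hB t

/-- Cauchy's theorem for the closed upper half-plane. -/
lemma integral_eq_zero_of_differentiable_upper {B : ℂ → ℂ} {K : ℝ}
    (hd : ∀ z : ℂ, 0 ≤ z.im → DifferentiableAt ℂ B z)
    (hB : ∀ z : ℂ, 0 ≤ z.im → ‖B z‖ ≤ K / (1 + ‖z‖ ^ 2)) : ∫ t : ℝ, B t = 0 := by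
  have hK : 0 ≤ K := by
    have := (norm_nonneg _).trans (hB 0 (by simp))
    simpa using this
  have hcont : Continuous fun t : ℝ => B t :=
    continuous_iff_continuousAt.2 fun t =>
      (hd t (by simp)).continuousAt.comp (f := fun t : ℝ => (t : ℂ)) (by fun_prop)
  have hinteg : Integrable fun t : ℝ => B t := by
    refine integrable_of_le_div_one_add_sq (K := K) hcont fun t => ?_
    simpa using hB t (by simp)
  have hlim := intervalIntegral_tendsto_integral hinteg tendsto_neg_atTop_atBot tendsto_id
  have hzero : Tendsto (fun R : ℝ => ∫ t in (-R)..R, B t) atTop (nhds 0) := by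
    have hbd : Tendsto (fun R : ℝ => 4 * K * R⁻¹) atTop (nhds 0) := by
      simpa using (tendsto_inv_atTop_zero (𝕜 := ℝ)).const_mul (4 * K)
    refine squeeze_zero_norm' ?_ hbd
    filter_upwards [eventually_gt_atTop 0] with R hR
    have hrect := Complex.integral_boundary_rect_eq_zero_of_differentiableOn B
      (-R : ℂ) (R + R * Complex.I) ?_
    · simp only [Complex.neg_re, Complex.ofReal_re, Complex.neg_im, Complex.ofReal_im, neg_zero,
        Complex.ofReal_zero, zero_mul, add_zero, Complex.add_re, Complex.mul_re, Complex.I_re,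
        mul_zero, Complex.I_im, sub_self, Complex.add_im, Complex.mul_im, mul_one,
        zero_add] at hrect
      have side : ∀ z : ℂ, 0 ≤ z.im → R ≤ ‖z‖ → ‖B z‖ ≤ K / R ^ 2 := by
        intro z hz hRz
        refine (hB z hz).trans ?_
        gcongr
        nlinarith
      have b1 : ‖∫ t in (-R)..R, B (t + R * Complex.I)‖ ≤ K / R ^ 2 * |R - -R| := by
        refine intervalIntegral.norm_integral_le_of_norm_le_const fun t _ => side _ ?_ ?_
        · simpa using hR.le
        · refine le_trans ?_ (Complex.abs_im_le_norm _)
          simpa using le_abs_self R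
      have b2 : ∀ s : ℝ, |s| = R → ‖∫ t in (0 : ℝ)..R, B (s + t * Complex.I)‖ ≤
          K / R ^ 2 * |R - 0| := by
        intro s hs
        refine intervalIntegral.norm_integral_le_of_norm_le_const fun t ht => side _ ?_ ?_
        · rw [uIoc_of_le hR.le] at ht
          simpa using ht.1.le
        · refine le_trans ?_ (Complex.abs_re_le_norm _)
          simp [hs]
      have b3 := b2 R (abs_of_pos hR)
      have b4 := b2 (-R) (by rw [abs_neg, abs_of_pos hR])
      rw [sub_zero, abs_of_pos hR] at b3 b4
      have h5 : |R - -R| = 2 * R := by rw [abs_of_pos (by linarith)]; ring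
      rw [h5] at b1
      have e : ∫ t in (-R)..R, B t = (∫ t in (-R)..R, B (t + R * Complex.I)) -
          Complex.I * (∫ t in (0 : ℝ)..R, B (R + t * Complex.I)) +
          Complex.I * ∫ t in (0 : ℝ)..R, B ((-R : ℝ) + t * Complex.I) := by
        simp only [smul_eq_mul] at hrect
        linear_combination hrect
      rw [e]
      refine (norm_add_le _ _).trans ((add_le_add_left (norm_sub_le _ _) _).trans ?_)
      rw [norm_mul, norm_mul, Complex.norm_I, one_mul, one_mul]
      have h6 : 4 * K * R⁻¹ = K / R ^ 2 * (2 * R) + K / R ^ 2 * R + K / R ^ 2 * R := by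
        field_simp; ring
      rw [h6]
      gcongr
    · intro z hz
      refine (hd z ?_).differentiableWithinAt
      have := (Complex.mem_reProdIm.1 hz).2
      simp only [Complex.neg_im, Complex.ofReal_im, neg_zero, Complex.add_im, Complex.mul_im,
        Complex.ofReal_re, Complex.I_im, mul_one, Complex.I_re, mul_zero, add_zero,
        zero_add] at this
      rw [uIcc_of_le hR.le] at this
      exact this.1
  exact tendsto_nhds_unique hlim hzero

/-- The Poisson formula at the point `i`. -/
lemma integral_div_one_add_sq {M : ℂ → ℂ} (hd : ∀ z : ℂ, 0 ≤ z.im → DifferentiableAt ℂ M z)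
    (hM : ∀ z : ℂ, 0 ≤ z.im → ‖M z‖ ≤ 1) :
    ∫ t : ℝ, M t * (((1 + t ^ 2)⁻¹ : ℝ) : ℂ) = π * M Complex.I := by
  set B : ℂ → ℂ := fun z => dslope M Complex.I z / (z + Complex.I) with hB
  have hden : ∀ z : ℂ, 0 ≤ z.im → z + Complex.I ≠ 0 := by
    intro z hz h
    have := congrArg Complex.im h
    simp at this
    linarith
  have hslope : ∀ z : ℂ, 0 ≤ z.im → DifferentiableAt ℂ (dslope M Complex.I) z := by
    intro z hz
    rcases eq_or_ne z Complex.I with rfl | hne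
    · have hU : {z : ℂ | 0 < z.im} ∈ nhds Complex.I :=
        (isOpen_lt continuous_const Complex.continuous_im).mem_nhds (by simp)
      refine DifferentiableOn.differentiableAt ?_ hU
      rw [Complex.differentiableOn_dslope hU]
      exact fun z hz => (hd z (le_of_lt hz)).differentiableWithinAt
    · exact (differentiableAt_dslope_of_ne hne).2 (hd z hz)
  have hBd : ∀ z : ℂ, 0 ≤ z.im → DifferentiableAt ℂ B z := fun z hz =>
    (hslope z hz).div (by fun_prop) (hden z hz)
  have hval : ∀ z : ℂ, z ≠ Complex.I → B z = (M z - M Complex.I) / (z ^ 2 + 1) := by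
    intro z hz
    have h1 : z - Complex.I ≠ 0 := sub_ne_zero.2 hz
    have h2 : z ^ 2 + 1 = (z - Complex.I) * (z + Complex.I) := by
      linear_combination Complex.I_sq
    simp only [hB]
    rw [dslope_of_ne _ hz, slope_def_field, h2, div_div]
  obtain ⟨K, hK⟩ : ∃ K : ℝ, ∀ z : ℂ, 0 ≤ z.im → ‖B z‖ ≤ K / (1 + ‖z‖ ^ 2) := by
    have hcomp : IsCompact (Metric.closedBall (0 : ℂ) 2 ∩ {z : ℂ | 0 ≤ z.im}) :=
      (isCompact_closedBall _ _).inter_right (isClosed_le continuous_const Complex.continuous_im)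
    obtain ⟨K, hK⟩ := hcomp.exists_bound_of_continuousOn (f := B)
      fun z hz => (hBd z hz.2).continuousAt.continuousWithinAt
    refine ⟨max (5 * K) 4, fun z hz => ?_⟩
    rw [le_div_iff₀ (by positivity)]
    rcases le_or_gt ‖z‖ 2 with h | h
    · refine le_trans ?_ (le_max_left _ _)
      have h1 := hK z ⟨by simpa using h, hz⟩
      have h2 : 1 + ‖z‖ ^ 2 ≤ 5 := by nlinarith [norm_nonneg z]
      nlinarith [norm_nonneg (B z), norm_nonneg z, sq_nonneg ‖z‖]
    · refine le_trans ?_ (le_max_right _ _)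
      have hne : z ≠ Complex.I := by
        rintro rfl
        simp at h
      rw [hval z hne, norm_div]
      have h1 : ‖M z - M Complex.I‖ ≤ 2 := by
        refine (norm_sub_le _ _).trans ?_
        linarith [hM z hz, hM Complex.I (by simp)]
      have h2 : ‖z‖ ^ 2 - 1 ≤ ‖z ^ 2 + 1‖ := by
        have := norm_sub_norm_le (z ^ 2) (-1)
        simpa using this
      have h3 : 0 < ‖z ^ 2 + 1‖ := by nlinarith
      rw [div_mul_eq_mul_div, div_le_iff₀ h3]
      nlinarith [norm_nonneg (M z - M Complex.I)]
  have h0 := integral_eq_zero_of_differentiable_upper hBd hK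
  have hMc : Continuous fun t : ℝ => M t :=
    continuous_iff_continuousAt.2 fun t =>
      (hd t (by simp)).continuousAt.comp (f := fun t : ℝ => (t : ℂ)) (by fun_prop)
  have hw : Integrable fun t : ℝ => (((1 + t ^ 2)⁻¹ : ℝ) : ℂ) := integrable_inv_one_add_sq.ofReal
  have hi : Integrable fun t : ℝ => M t * (((1 + t ^ 2)⁻¹ : ℝ) : ℂ) :=
    hw.bdd_mul (c := 1) hMc.aestronglyMeasurable
      (Eventually.of_forall fun t => hM t (by simp))
  have e : ∀ t : ℝ, B t = M t * (((1 + t ^ 2)⁻¹ : ℝ) : ℂ) -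
      M Complex.I * (((1 + t ^ 2)⁻¹ : ℝ) : ℂ) := by
    intro t
    have hne : (t : ℂ) ≠ Complex.I := by
      intro h
      have := congrArg Complex.im h
      simp at this
    rw [hval _ hne, ← sub_mul, div_eq_mul_inv]
    push_cast
    rw [add_comm (1 : ℂ)]
  simp_rw [e] at h0
  rw [integral_sub hi (hw.const_mul _), integral_const_mul, integral_complex_ofReal,
    integral_univ_inv_one_add_sq] at h0
  linear_combination h0

end UpperHalfPlane

section BoundaryValues

/-- An analytic approximation of `exp (iξz)` with quadratic decay in the upper half-plane. -/
noncomputable def dampedExp (ξ κ : ℝ) (z : ℂ) : ℂ :=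
  Complex.exp (ξ * z * Complex.I) * ((1 - κ * z * Complex.I) ^ 2)⁻¹

lemma norm_one_sub_mul_I_sq {κ : ℝ} (hκ : 0 < κ) {z : ℂ} (hz : 0 ≤ z.im) :
    1 + κ ^ 2 * ‖z‖ ^ 2 ≤ ‖(1 - κ * z * Complex.I) ^ 2‖ := by
  rw [norm_pow, ← Complex.normSq_eq_norm_sq, ← Complex.normSq_eq_norm_sq, Complex.normSq_apply,
    Complex.normSq_apply]
  simp
  nlinarith [mul_nonneg hκ.le hz]

lemma one_sub_mul_I_ne_zero {κ : ℝ} (hκ : 0 < κ) {z : ℂ} (hz : 0 ≤ z.im) :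
    (1 - κ * z * Complex.I) ^ 2 ≠ 0 := by
  rw [← norm_pos_iff]
  exact lt_of_lt_of_le (by positivity) (norm_one_sub_mul_I_sq hκ hz)

lemma norm_dampedExp_le {ξ κ : ℝ} (hξ : 0 ≤ ξ) (hκ : 0 < κ) {z : ℂ} (hz : 0 ≤ z.im) :
    ‖dampedExp ξ κ z‖ ≤ (1 + κ ^ 2 * ‖z‖ ^ 2)⁻¹ := by
  rw [dampedExp, norm_mul, norm_inv, Complex.norm_exp]
  have h1 : rexp (ξ * z * Complex.I).re ≤ 1 := by
    rw [Real.exp_le_one_iff]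
    simp
    positivity
  have h2 := inv_anti₀ (by positivity) (norm_one_sub_mul_I_sq hκ hz)
  calc _ ≤ 1 * (1 + κ ^ 2 * ‖z‖ ^ 2)⁻¹ := mul_le_mul h1 h2 (by positivity) zero_le_one
    _ = _ := one_mul _

lemma norm_dampedExp_le_one {ξ κ : ℝ} (hξ : 0 ≤ ξ) (hκ : 0 < κ) (t : ℝ) :
    ‖dampedExp ξ κ t‖ ≤ 1 :=
  (norm_dampedExp_le hξ hκ (by simp)).trans (inv_le_one_of_one_le₀ (by
    have : 0 ≤ κ ^ 2 * ‖(t : ℂ)‖ ^ 2 := by positivity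
    linarith))

lemma norm_dampedExp_le_div {ξ κ : ℝ} (hξ : 0 ≤ ξ) (hκ : 0 < κ) (hκ1 : κ ≤ 1) {z : ℂ}
    (hz : 0 ≤ z.im) : ‖dampedExp ξ κ z‖ ≤ (κ ^ 2)⁻¹ / (1 + ‖z‖ ^ 2) := by
  refine (norm_dampedExp_le hξ hκ hz).trans ?_
  rw [div_eq_mul_inv, ← mul_inv]
  refine inv_anti₀ (by positivity) ?_
  have : κ ^ 2 ≤ 1 := by nlinarith
  linarith

lemma differentiableAt_dampedExp {ξ κ : ℝ} (hκ : 0 < κ) {z : ℂ} (hz : 0 ≤ z.im) :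
    DifferentiableAt ℂ (dampedExp ξ κ) z := by
  unfold dampedExp
  refine DifferentiableAt.mul (by fun_prop) (DifferentiableAt.inv (by fun_prop) ?_)
  exact one_sub_mul_I_ne_zero hκ hz

lemma continuous_ofReal_of_differentiableAt {B : ℂ → ℂ} {ε : ℝ}
    (hd : ∀ z : ℂ, ε ≤ z.im → DifferentiableAt ℂ B z) :
    Continuous fun t : ℝ => B (t + ε * Complex.I) :=
  continuous_iff_continuousAt.2 fun t =>
    (hd _ (by simp)).continuousAt.comp (f := fun t : ℝ => (t + ε * Complex.I : ℂ)) (by fun_prop)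

lemma continuous_dampedExp {ξ κ : ℝ} (hκ : 0 < κ) : Continuous fun t : ℝ => dampedExp ξ κ t := by
  have := continuous_ofReal_of_differentiableAt (ε := 0)
    fun z hz => differentiableAt_dampedExp (ξ := ξ) hκ hz
  simpa using this

/-- If `F` is analytic in the upper half-plane and can be multiplied into the bounded functions by
contractive multipliers tending to `1` at `i`, then an integrable boundary function of `F` has no
positive frequencies. -/
theorem integral_mul_exp_eq_zero_of_multiplier {F : ℂ → ℂ} {m : ℕ → ℂ → ℂ} {K b : ℕ → ℝ}
    {Φ : ℝ → ℂ} (hF : ∀ z : ℂ, 0 < z.im → DifferentiableAt ℂ F z)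
    (hm : ∀ n, ∀ z : ℂ, 0 < z.im → DifferentiableAt ℂ (m n) z)
    (hm1 : ∀ n, ∀ z : ℂ, 0 < z.im → ‖m n z‖ ≤ 1)
    (hFm : ∀ n, ∀ z : ℂ, 0 < z.im → ‖F z * m n z‖ ≤ K n)
    (hb : Tendsto b atTop (nhds 0))
    (hmb : ∀ n, ∀ ε : ℝ, 0 < ε → ‖1 - m n (Complex.I + ε * Complex.I)‖ ≤ b n)
    (hΦ : Integrable Φ)
    (hlim : ∀ᵐ t : ℝ, Tendsto (fun ε : ℝ => F (t + ε * Complex.I)) (nhdsWithin 0 (Ioi 0))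
      (nhds (Φ t))) {ξ : ℝ} (hξ : 0 < ξ) :
    ∫ t, Φ t * Complex.exp (ξ * t * Complex.I) = 0 := by
  have him : ∀ {z : ℂ} {ε : ℝ}, 0 < ε → 0 ≤ z.im → 0 < (z + ε * Complex.I).im := by
    intro z ε hε hz
    simp only [Complex.add_im, Complex.mul_im, Complex.ofReal_re, Complex.I_im, mul_one,
      Complex.ofReal_im, Complex.I_re, mul_zero, add_zero]
    linarith
  have hmcont : ∀ n, ∀ ε : ℝ, 0 < ε → Continuous fun t : ℝ => m n (t + ε * Complex.I) :=
    fun n ε hε => continuous_ofReal_of_differentiableAt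
      fun z hz => hm n z (hε.trans_le hz)
  have hFcont : ∀ ε : ℝ, 0 < ε → Continuous fun t : ℝ => F (t + ε * Complex.I) :=
    fun ε hε => continuous_ofReal_of_differentiableAt fun z hz => hF z (hε.trans_le hz)
  have damped : ∀ κ : ℝ, 0 < κ → κ ≤ 1 → ∫ t, Φ t * dampedExp ξ κ t = 0 := by
    intro κ hκ hκ1
    have hψc := continuous_dampedExp (ξ := ξ) hκ
    have hψ1 := norm_dampedExp_le_one hξ.le hκ
    have cauchy : ∀ n, ∀ ε : ℝ, 0 < ε → ∫ t : ℝ, F (t + ε * Complex.I) *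
        m n (t + ε * Complex.I) * dampedExp ξ κ t = 0 := by
      intro n ε hε
      refine integral_eq_zero_of_differentiable_upper (K := K n * (κ ^ 2)⁻¹) (B := fun z : ℂ =>
        F (z + ε * Complex.I) * m n (z + ε * Complex.I) * dampedExp ξ κ z) ?_ ?_
      · intro z hz
        have hz' := him hε hz
        refine DifferentiableAt.mul (DifferentiableAt.mul ?_ ?_) (differentiableAt_dampedExp hκ hz)
        · exact (hF _ hz').comp z (f := fun z : ℂ => z + ε * Complex.I) (by fun_prop)
        · exact (hm n _ hz').comp z (f := fun z : ℂ => z + ε * Complex.I) (by fun_prop)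
      · intro z hz
        have hz' := him hε hz
        rw [norm_mul, mul_div_assoc]
        exact mul_le_mul (hFm n _ hz') (norm_dampedExp_le_div hξ.le hκ hκ1 hz) (norm_nonneg _)
          ((norm_nonneg _).trans (hFm n _ hz'))
    have hmul : ∀ n, ∀ ε : ℝ, 0 < ε → Integrable fun t : ℝ =>
        Φ t * m n (t + ε * Complex.I) * dampedExp ξ κ t := by
      intro n ε hε
      refine Integrable.mul_bdd (c := 1) (Integrable.mul_bdd (c := 1) hΦ
        (hmcont n ε hε).aestronglyMeasurable (Eventually.of_forall fun t => ?_))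
        hψc.aestronglyMeasurable (Eventually.of_forall fun t => hψ1 t)
      exact hm1 n _ (him hε (by simp))
    have limit : ∀ n, Tendsto (fun ε : ℝ => ∫ t : ℝ, Φ t * m n (t + ε * Complex.I) *
        dampedExp ξ κ t) (nhdsWithin 0 (Ioi 0)) (nhds 0) := by
      intro n
      have key : Tendsto (fun ε : ℝ => ∫ t : ℝ, (Φ t - F (t + ε * Complex.I)) *
          m n (t + ε * Complex.I) * dampedExp ξ κ t) (nhdsWithin 0 (Ioi 0))
          (nhds (∫ _ : ℝ, (0 : ℂ))) := by
        refine tendsto_integral_filter_of_dominated_convergence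
          (fun t => ‖Φ t‖ + K n * (κ ^ 2)⁻¹ * (1 + t ^ 2)⁻¹) ?_ ?_ ?_ ?_
        · filter_upwards [self_mem_nhdsWithin] with ε hε
          exact ((hΦ.aestronglyMeasurable.sub (hFcont ε hε).aestronglyMeasurable).mul
            (hmcont n ε hε).aestronglyMeasurable).mul hψc.aestronglyMeasurable
        · filter_upwards [self_mem_nhdsWithin] with ε hε
          refine Eventually.of_forall fun t => ?_
          have hz : 0 < ((t : ℂ) + ε * Complex.I).im := him hε (by simp)
          rw [sub_mul, sub_mul]
          refine (norm_sub_le _ _).trans (add_le_add ?_ ?_)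
          · rw [norm_mul, norm_mul]
            have h1 := hm1 n _ hz
            have h2 := hψ1 t
            calc _ ≤ ‖Φ t‖ * 1 * 1 := by gcongr
              _ = _ := by ring
          · have h1 := norm_dampedExp_le_div hξ.le hκ hκ1 (z := t) (by simp)
            rw [norm_mul, mul_assoc]
            refine mul_le_mul (hFm n _ hz) ?_ (norm_nonneg _)
              ((norm_nonneg _).trans (hFm n _ hz))
            simpa [div_eq_mul_inv] using h1
        · exact hΦ.norm.add (integrable_inv_one_add_sq.const_mul _)
        · filter_upwards [hlim] with t ht
          have h1 : Tendsto (fun ε : ℝ => ‖Φ t - F (t + ε * Complex.I)‖) (nhdsWithin 0 (Ioi 0))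
              (nhds 0) := by
            simpa using ((tendsto_const_nhds (x := Φ t)).sub ht).norm
          refine squeeze_zero_norm' ?_ h1
          filter_upwards [self_mem_nhdsWithin] with ε hε
          have h2 := hm1 n (t + ε * Complex.I) (him hε (by simp))
          have h3 := hψ1 t
          rw [norm_mul, norm_mul]
          calc _ ≤ ‖Φ t - F (t + ε * Complex.I)‖ * 1 * 1 := by gcongr
            _ = _ := by ring
      rw [integral_zero] at key
      refine key.congr' ?_
      filter_upwards [self_mem_nhdsWithin] with ε hε
      have hFi : Integrable fun t : ℝ => F (t + ε * Complex.I) * m n (t + ε * Complex.I) *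
          dampedExp ξ κ t := by
        refine integrable_of_le_div_one_add_sq (K := K n * (κ ^ 2)⁻¹)
          (((hFcont ε hε).mul (hmcont n ε hε)).mul hψc) fun t => ?_
        have hz : 0 < ((t : ℂ) + ε * Complex.I).im := him hε (by simp)
        have h1 := norm_dampedExp_le_div hξ.le hκ hκ1 (z := t) (by simp)
        rw [norm_mul, mul_div_assoc]
        refine mul_le_mul (hFm n _ hz) ?_ (norm_nonneg _) ((norm_nonneg _).trans (hFm n _ hz))
        simpa using h1
      simp_rw [sub_mul]
      rw [integral_sub (hmul n ε hε) hFi, cauchy n ε hε, sub_zero]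
    have choice : ∀ n : ℕ, ∃ ε : ℝ, 0 < ε ∧ ‖∫ t : ℝ, Φ t * m n (t + ε * Complex.I) *
        dampedExp ξ κ t‖ ≤ 1 / ((n : ℝ) + 1) := by
      intro n
      have h1 := (limit n).norm
      rw [norm_zero] at h1
      have h2 := (h1.eventually_le_const (u := 1 / ((n : ℝ) + 1)) (by positivity)).and
        self_mem_nhdsWithin
      obtain ⟨ε, h3, h4⟩ := h2.exists
      exact ⟨ε, h4, h3⟩
    choose ε hε hεn using choice
    set D : ℕ → ℝ → ℝ := fun n t => ‖1 - m n (t + ε n * Complex.I)‖ ^ 2 * (1 + t ^ 2)⁻¹ with hD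
    have hwc : Continuous fun t : ℝ => (1 + t ^ 2)⁻¹ :=
      Continuous.inv₀ (by fun_prop) fun t => by positivity
    have hDc : ∀ n, Continuous (D n) := fun n =>
      ((continuous_const.sub (hmcont n _ (hε n))).norm.pow 2).mul hwc
    have hDnn : ∀ n t, 0 ≤ D n t := fun n t => by simp only [hD]; positivity
    have hDle : ∀ n t, D n t ≤ 2 * ((1 - (m n (t + ε n * Complex.I)).re) * (1 + t ^ 2)⁻¹) := by
      intro n t
      have h1 := hm1 n (t + ε n * Complex.I) (him (hε n) (by simp))
      have h2 : ‖m n (t + ε n * Complex.I)‖ ^ 2 ≤ 1 := by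
        nlinarith [norm_nonneg (m n (t + ε n * Complex.I))]
      simp only [hD]
      rw [← mul_assoc]
      refine mul_le_mul_of_nonneg_right ?_ (by positivity)
      rw [← Complex.normSq_eq_norm_sq, Complex.normSq_apply] at h2 ⊢
      simp
      nlinarith
    have hDint : ∀ n, ∫ t, D n t ≤ 2 * π * b n ∧ Integrable (D n) := by
      intro n
      have hMi : Integrable fun t : ℝ => m n (t + ε n * Complex.I) *
          (((1 + t ^ 2)⁻¹ : ℝ) : ℂ) :=
        (integrable_inv_one_add_sq.ofReal).bdd_mul (c := 1)
          (hmcont n _ (hε n)).aestronglyMeasurable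
          (Eventually.of_forall fun t => hm1 n _ (him (hε n) (by simp)))
      have hpo := integral_div_one_add_sq (M := fun z => m n (z + ε n * Complex.I))
        (fun z hz => (hm n _ (him (hε n) hz)).comp z
          (f := fun z : ℂ => z + ε n * Complex.I) (by fun_prop))
        (fun z hz => hm1 n _ (him (hε n) hz))
      have hre : ∫ t : ℝ, (m n (t + ε n * Complex.I)).re * (1 + t ^ 2)⁻¹ =
          π * (m n (Complex.I + ε n * Complex.I)).re := by
        have h1 := congrArg Complex.re hpo
        rw [Complex.re_ofReal_mul, ← RCLike.re_eq_complex_re, ← integral_re hMi] at h1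
        rw [← RCLike.re_eq_complex_re, ← h1]
        refine integral_congr_ae (Eventually.of_forall fun t => ?_)
        simp only [RCLike.re_eq_complex_re, Complex.re_mul_ofReal]
      have hrei : Integrable fun t : ℝ => (m n (t + ε n * Complex.I)).re * (1 + t ^ 2)⁻¹ := by
        refine hMi.re.congr (Eventually.of_forall fun t => ?_)
        simp only [RCLike.re_eq_complex_re, Complex.re_mul_ofReal]
      have hbi : Integrable fun t : ℝ =>
          2 * ((1 - (m n (t + ε n * Complex.I)).re) * (1 + t ^ 2)⁻¹) := by
        simp_rw [sub_mul, one_mul]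
        exact (integrable_inv_one_add_sq.sub hrei).const_mul 2
      have hDi : Integrable (D n) := hbi.mono' (hDc n).aestronglyMeasurable
        (Eventually.of_forall fun t => by
          rw [Real.norm_of_nonneg (hDnn n t)]; exact hDle n t)
      refine ⟨(integral_mono hDi hbi (hDle n)).trans ?_, hDi⟩
      simp_rw [sub_mul, one_mul]
      rw [integral_const_mul, integral_sub integrable_inv_one_add_sq hrei, hre,
        integral_univ_inv_one_add_sq]
      have h3 := (Complex.re_le_norm _).trans (hmb n (ε n) (hε n))
      simp only [Complex.sub_re, Complex.one_re] at h3
      nlinarith [pi_pos]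
    have hDlim : Tendsto (fun n => ∫ t, D n t) atTop (nhds 0) := by
      refine squeeze_zero (fun n => integral_nonneg (hDnn n)) (fun n => (hDint n).1) ?_
      simpa using hb.const_mul (2 * π)
    have hmeas : TendstoInMeasure volume D atTop (fun _ => (0 : ℝ)) := by
      refine tendstoInMeasure_of_tendsto_eLpNorm (p := 1) one_ne_zero
        (fun n => (hDc n).aestronglyMeasurable) aestronglyMeasurable_const ?_
      have h1 : ∀ n, eLpNorm (D n - fun _ => (0 : ℝ)) 1 volume =
          ENNReal.ofReal (∫ t, D n t) := by
        intro n
        have h2 : (D n - fun _ => (0 : ℝ)) = D n := by ext; simp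
        rw [h2, eLpNorm_one_eq_lintegral_enorm, ofReal_integral_eq_lintegral_ofReal (hDint n).2
          (Eventually.of_forall (hDnn n))]
        exact lintegral_congr fun t => by rw [Real.enorm_of_nonneg (hDnn n t)]
      simp_rw [h1]
      simpa using ENNReal.tendsto_ofReal hDlim
    obtain ⟨ns, hns, hae⟩ := hmeas.exists_seq_tendsto_ae
    have conv : Tendsto (fun k => ∫ t : ℝ, Φ t * m (ns k) (t + ε (ns k) * Complex.I) *
        dampedExp ξ κ t) atTop (nhds (∫ t : ℝ, Φ t * dampedExp ξ κ t)) := by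
      refine tendsto_integral_of_dominated_convergence (fun t => ‖Φ t‖) ?_ hΦ.norm ?_ ?_
      · exact fun k => (hmul (ns k) _ (hε _)).aestronglyMeasurable
      · refine fun k => Eventually.of_forall fun t => ?_
        have h1 := hm1 (ns k) (t + ε (ns k) * Complex.I) (him (hε _) (by simp))
        have h2 := hψ1 t
        rw [norm_mul, norm_mul]
        calc _ ≤ ‖Φ t‖ * 1 * 1 := by gcongr
          _ = _ := by ring
      · filter_upwards [hae] with t ht
        have h1 : Tendsto (fun k => ‖1 - m (ns k) (t + ε (ns k) * Complex.I)‖) atTop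
            (nhds 0) := by
          have h2 := (ht.mul_const (1 + t ^ 2)).sqrt
          rw [zero_mul, Real.sqrt_zero] at h2
          refine h2.congr fun k => ?_
          have h3 : (1 + t ^ 2 : ℝ) ≠ 0 := by positivity
          simp only [hD]
          rw [inv_mul_cancel_right₀ h3, Real.sqrt_sq (norm_nonneg _)]
        have h4 := tendsto_zero_iff_norm_tendsto_zero.2 h1
        have h5 : Tendsto (fun k => m (ns k) (t + ε (ns k) * Complex.I)) atTop (nhds 1) := by
          simpa using (tendsto_const_nhds (x := (1 : ℂ))).sub h4
        simpa using (h5.const_mul (Φ t)).mul_const (dampedExp ξ κ t)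
    have conv0 : Tendsto (fun k => ∫ t : ℝ, Φ t * m (ns k) (t + ε (ns k) * Complex.I) *
        dampedExp ξ κ t) atTop (nhds 0) := by
      refine squeeze_zero_norm (fun k => hεn (ns k)) ?_
      exact tendsto_one_div_add_atTop_nhds_zero_nat.comp hns.tendsto_atTop
    exact tendsto_nhds_unique conv conv0
  have conv : Tendsto (fun k : ℕ => ∫ t : ℝ, Φ t * dampedExp ξ (1 / ((k : ℝ) + 1)) t) atTop
      (nhds (∫ t : ℝ, Φ t * Complex.exp (ξ * t * Complex.I))) := by
    have hpos : ∀ k : ℕ, 0 < 1 / ((k : ℝ) + 1) := fun k => by positivity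
    refine tendsto_integral_of_dominated_convergence (fun t => ‖Φ t‖) ?_ hΦ.norm ?_ ?_
    · exact fun k => hΦ.aestronglyMeasurable.mul
        (continuous_dampedExp (hpos k)).aestronglyMeasurable
    · refine fun k => Eventually.of_forall fun t => ?_
      rw [norm_mul]
      exact mul_le_of_le_one_right (norm_nonneg _) (norm_dampedExp_le_one hξ.le (hpos k) t)
    · refine Eventually.of_forall fun t => Tendsto.const_mul _ ?_
      have h0 : Tendsto (fun k : ℕ => ((1 / ((k : ℝ) + 1) : ℝ) : ℂ)) atTop (nhds ((0 : ℝ) : ℂ)) :=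
        (Complex.continuous_ofReal.tendsto 0).comp tendsto_one_div_add_atTop_nhds_zero_nat
      have h1 : Tendsto (fun k : ℕ => ((1 - ((1 / ((k : ℝ) + 1) : ℝ) : ℂ) * t * Complex.I) ^ 2)⁻¹)
          atTop (nhds (((1 - ((0 : ℝ) : ℂ) * t * Complex.I) ^ 2)⁻¹)) := by
        refine Tendsto.inv₀ (Tendsto.pow (tendsto_const_nhds.sub
          ((h0.mul_const _).mul_const _)) 2) (by simp)
      have h2 := h1.const_mul (Complex.exp (ξ * t * Complex.I))
      simpa [dampedExp] using h2
  refine tendsto_nhds_unique conv ?_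
  refine tendsto_const_nhds.congr fun k => (damped _ (by positivity) ?_).symm
  rw [div_le_one (by positivity)]
  have : (0 : ℝ) ≤ k := by positivity
  linarith

end BoundaryValues

section CauchyIntegral

lemma norm_one_sub_prod_le {ι : Type*} (s : Finset ι) {u : ι → ℂ} (hu : ∀ j, ‖u j‖ ≤ 1) :
    ‖1 - ∏ j ∈ s, u j‖ ≤ ∑ j ∈ s, ‖1 - u j‖ := by
  classical
  induction s using Finset.induction_on with
  | empty => simp
  | insert j s hj ih =>
    rw [Finset.prod_insert hj, Finset.sum_insert hj]
    have h : 1 - u j * ∏ i ∈ s, u i = (1 - u j) + u j * (1 - ∏ i ∈ s, u i) := by ring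
    rw [h]
    refine (norm_add_le _ _).trans (add_le_add_right ?_ _)
    rw [norm_mul]
    exact (mul_le_of_le_one_left (norm_nonneg _) (hu j)).trans ih

/-- An integrable boundary function of a combination of analytic functions with nonnegative real
part has no positive frequencies. -/
theorem integral_mul_exp_eq_zero_of_re_nonneg {ι : Type*} [Fintype ι] {a : ι → ℂ}
    {C : ι → ℂ → ℂ} {Φ : ℝ → ℂ} {K : ℝ}
    (hC : ∀ j, ∀ z : ℂ, 0 < z.im → DifferentiableAt ℂ (C j) z)
    (hre : ∀ j, ∀ z : ℂ, 0 < z.im → 0 ≤ (C j z).re)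
    (hK : ∀ j, ∀ ε : ℝ, 0 < ε → ‖C j (Complex.I + ε * Complex.I)‖ ≤ K)
    (ha : ∀ j, ‖a j‖ ≤ 1) (hΦ : Integrable Φ)
    (hlim : ∀ᵐ t : ℝ, Tendsto (fun ε : ℝ => ∑ j, a j * C j (t + ε * Complex.I))
      (nhdsWithin 0 (Ioi 0)) (nhds (Φ t))) {ξ : ℝ} (hξ : 0 < ξ) :
    ∫ t, Φ t * Complex.exp (ξ * t * Complex.I) = 0 := by
  classical
  set N : ℕ → ℝ := fun n => (n : ℝ) + 1 with hN
  have hNpos : ∀ n, 0 < N n := fun n => by simp only [hN]; positivity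
  have hden : ∀ n j (z : ℂ), 0 < z.im → N n ≤ ‖(N n : ℂ) + C j z‖ ∧
      ‖C j z‖ ≤ ‖(N n : ℂ) + C j z‖ := by
    intro n j z hz
    have h1 := hre j z hz
    have h2 := hNpos n
    constructor
    · refine le_trans ?_ (Complex.re_le_norm _)
      simpa using h1
    · rw [← abs_of_nonneg (norm_nonneg (C j z)), ← abs_of_nonneg (norm_nonneg (_ + C j z)),
        ← sq_le_sq, ← Complex.normSq_eq_norm_sq, ← Complex.normSq_eq_norm_sq,
        Complex.normSq_apply, Complex.normSq_apply]
      simp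
      nlinarith [mul_nonneg h2.le h1]
  have hne : ∀ n j (z : ℂ), 0 < z.im → (N n : ℂ) + C j z ≠ 0 := fun n j z hz =>
    norm_pos_iff.1 ((hNpos n).trans_le (hden n j z hz).1)
  have hu1 : ∀ n j (z : ℂ), 0 < z.im → ‖(N n : ℂ) / (N n + C j z)‖ ≤ 1 := by
    intro n j z hz
    rw [norm_div, Complex.norm_real, Real.norm_of_nonneg (hNpos n).le]
    exact div_le_one_of_le₀ (hden n j z hz).1 (norm_nonneg _)
  have hCu : ∀ n j (z : ℂ), 0 < z.im → ‖C j z * ((N n : ℂ) / (N n + C j z))‖ ≤ N n := by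
    intro n j z hz
    have h3 := norm_pos_iff.2 (hne n j z hz)
    rw [norm_mul, norm_div, Complex.norm_real, Real.norm_of_nonneg (hNpos n).le, ← mul_div_assoc,
      div_le_iff₀ h3, mul_comm]
    exact mul_le_mul_of_nonneg_left (hden n j z hz).2 (hNpos n).le
  refine integral_mul_exp_eq_zero_of_multiplier (F := fun z => ∑ j, a j * C j z)
    (m := fun n z => ∏ j, (N n : ℂ) / (N n + C j z)) (K := fun n => Fintype.card ι * N n)
    (b := fun n => Fintype.card ι * K * (1 / ((n : ℝ) + 1))) ?_ ?_ ?_ ?_ ?_ ?_ hΦ hlim hξ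
  · exact fun z hz => DifferentiableAt.fun_sum fun j _ => (hC j z hz).const_mul _
  · intro n z hz
    exact DifferentiableAt.fun_finsetProd fun j _ => (differentiableAt_const _).div
      ((hC j z hz).const_add _) (hne n j z hz)
  · intro n z hz
    rw [norm_prod]
    exact Finset.prod_le_one (fun j _ => norm_nonneg _) fun j _ => hu1 n j z hz
  · intro n z hz
    rw [Finset.sum_mul]
    refine (norm_sum_le _ _).trans ((Finset.sum_le_card_nsmul _ _ (N n) fun j _ => ?_).trans ?_)
    · rw [← Finset.mul_prod_erase _ _ (Finset.mem_univ j), mul_assoc, ← mul_assoc (C j z),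
        norm_mul, norm_mul, norm_prod]
      have h1 : ∏ i ∈ Finset.univ.erase j, ‖(N n : ℂ) / (N n + C i z)‖ ≤ 1 :=
        Finset.prod_le_one (fun j _ => norm_nonneg _) fun j _ => hu1 n j z hz
      calc _ ≤ 1 * (N n * 1) := by
            refine mul_le_mul (ha j) (mul_le_mul (hCu n j z hz) h1 ?_ (hNpos n).le) ?_ zero_le_one
            · exact Finset.prod_nonneg fun _ _ => norm_nonneg _
            · exact mul_nonneg (norm_nonneg _) (Finset.prod_nonneg fun _ _ => norm_nonneg _)
        _ = N n := by ring
    · rw [nsmul_eq_mul, Finset.card_univ]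
  · simpa using (tendsto_one_div_add_atTop_nhds_zero_nat (𝕜 := ℝ)).const_mul
      ((Fintype.card ι : ℝ) * K)
  · intro n ε hε
    have hz : 0 < (Complex.I + ε * Complex.I).im := by simp; linarith
    refine (norm_one_sub_prod_le _ fun j => hu1 n j _ hz).trans
      ((Finset.sum_le_card_nsmul _ _ (K * (1 / ((n : ℝ) + 1))) fun j _ => ?_).trans ?_)
    · have h3 := hne n j _ hz
      rw [one_sub_div h3, add_sub_cancel_left, norm_div, mul_one_div]
      exact div_le_div₀ ((norm_nonneg _).trans (hK j ε hε)) (hK j ε hε) (hNpos n)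
        (hden n j _ hz).1
    · rw [nsmul_eq_mul, Finset.card_univ, mul_assoc]

lemma im_le_norm_ofReal_sub {z : ℂ} (hz : 0 < z.im) (t : ℝ) : z.im ≤ ‖(t : ℂ) - z‖ := by
  have := Complex.abs_im_le_norm ((t : ℂ) - z)
  simpa [abs_of_pos hz] using this

lemma ofReal_sub_ne_zero {z : ℂ} (hz : 0 < z.im) (t : ℝ) : (t : ℂ) - z ≠ 0 :=
  norm_pos_iff.1 (hz.trans_le (im_le_norm_ofReal_sub hz t))

lemma continuous_inv_ofReal_sub {z : ℂ} (hz : 0 < z.im) :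
    Continuous fun t : ℝ => ((t : ℂ) - z)⁻¹ :=
  Continuous.inv₀ (by fun_prop) (ofReal_sub_ne_zero hz)

lemma integrable_div_ofReal_sub {f : ℝ → ℂ} (hf : Integrable f) {z : ℂ} (hz : 0 < z.im) :
    Integrable fun t : ℝ => f t / ((t : ℂ) - z) := by
  simp_rw [div_eq_mul_inv]
  refine hf.mul_bdd (c := z.im⁻¹) (continuous_inv_ofReal_sub hz).aestronglyMeasurable
    (Eventually.of_forall fun t => ?_)
  rw [norm_inv]
  exact inv_anti₀ hz (im_le_norm_ofReal_sub hz t)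

lemma differentiableAt_integral_div_sub {f : ℝ → ℂ} (hf : Integrable f) {z : ℂ}
    (hz : 0 < z.im) : DifferentiableAt ℂ (fun w : ℂ => ∫ t : ℝ, f t / ((t : ℂ) - w)) z := by
  have hball : ∀ w ∈ Metric.ball z (z.im / 2), z.im / 2 < w.im := by
    intro w hw
    have h1 := Complex.abs_im_le_norm (w - z)
    rw [mem_ball_iff_norm] at hw
    have h2 := abs_lt.1 (h1.trans_lt hw)
    simp only [Complex.sub_im] at h2
    linarith
  refine (hasDerivAt_integral_of_dominated_loc_of_deriv_le
    (F := fun (w : ℂ) (t : ℝ) => f t / ((t : ℂ) - w))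
    (F' := fun (w : ℂ) (t : ℝ) => f t / ((t : ℂ) - w) ^ 2)
    (bound := fun t => ‖f t‖ * ((z.im / 2) ^ 2)⁻¹)
    (Metric.ball_mem_nhds z (half_pos hz)) ?_ ?_ ?_ ?_ ?_ ?_).2.differentiableAt
  · filter_upwards [Metric.ball_mem_nhds z (half_pos hz)] with w hw
    exact (integrable_div_ofReal_sub hf ((half_pos hz).trans (hball w hw))).aestronglyMeasurable
  · exact integrable_div_ofReal_sub hf hz
  · simp_rw [div_eq_mul_inv, ← inv_pow]
    exact hf.aestronglyMeasurable.mul ((continuous_inv_ofReal_sub hz).pow 2).aestronglyMeasurable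
  · refine Eventually.of_forall fun t w hw => ?_
    have h1 := hball w hw
    have h2 := im_le_norm_ofReal_sub ((half_pos hz).trans h1) t
    rw [norm_div, div_eq_mul_inv, norm_pow]
    have h3 := half_pos hz
    gcongr
    linarith
  · exact hf.norm.mul_const _
  · refine Eventually.of_forall fun t w hw => ?_
    have h1 := ofReal_sub_ne_zero ((half_pos hz).trans (hball w hw)) t
    refine ((hasDerivAt_const w (f t)).div ((hasDerivAt_id w).const_sub (t : ℂ)) h1).congr_deriv ?_
    simp

/-- The integrable boundary function of a Cauchy integral has no positive frequencies. -/
theorem integral_mul_exp_eq_zero_of_tendsto_cauchy {f Φ : ℝ → ℂ} (hf : Integrable f)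
    (hΦ : Integrable Φ) (hlim : ∀ᵐ x : ℝ, Tendsto (fun ε : ℝ =>
      ∫ t : ℝ, f t / ((t : ℂ) - (x + ε * Complex.I))) (nhdsWithin 0 (Ioi 0)) (nhds (Φ x)))
    {ξ : ℝ} (hξ : 0 < ξ) : ∫ t, Φ t * Complex.exp (ξ * t * Complex.I) = 0 := by
  set p : Fin 4 → ℝ → ℝ := ![fun t => max (f t).re 0, fun t => max (-(f t).re) 0,
    fun t => max (f t).im 0, fun t => max (-(f t).im) 0] with hp
  set c : Fin 4 → ℂ := ![1, -1, Complex.I, -Complex.I] with hc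
  have hpi : ∀ j, Integrable (p j) := by
    intro j
    fin_cases j
    · exact hf.re.pos_part
    · exact hf.re.neg_part
    · exact hf.im.pos_part
    · exact hf.im.neg_part
  have hpn : ∀ j t, 0 ≤ p j t := by
    intro j t
    fin_cases j <;> simp [hp]
  have hpf : ∀ j t, p j t ≤ ‖f t‖ := by
    intro j t
    have h1 := abs_le.1 (Complex.abs_re_le_norm (f t))
    have h2 := abs_le.1 (Complex.abs_im_le_norm (f t))
    fin_cases j <;> simp [hp] <;> linarith
  have hsum : ∀ t, f t = ∑ j, c j * p j t := by
    intro t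
    rw [Fin.sum_univ_four]
    have hmax : ∀ r : ℝ, max r 0 - max (-r) 0 = r := max_zero_sub_eq_self
    have h1 := congrArg (fun r : ℝ => (r : ℂ)) (hmax (f t).re)
    have h2 := congrArg (fun r : ℝ => (r : ℂ)) (hmax (f t).im)
    simp only [Complex.ofReal_sub] at h1 h2
    simp only [hp, hc, Matrix.cons_val_zero, Matrix.cons_val_one, Matrix.cons_val]
    linear_combination -(Complex.re_add_im (f t)) - h1 - Complex.I * h2
  have hpC : ∀ j, Integrable fun t => (p j t : ℂ) := fun j => (hpi j).ofReal
  refine integral_mul_exp_eq_zero_of_re_nonneg (K := ∫ t, ‖f t‖)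
    (C := fun j z => -Complex.I * ∫ t : ℝ, (p j t : ℂ) / ((t : ℂ) - z))
    (a := fun j => Complex.I * c j) ?_ ?_ ?_ ?_ hΦ ?_ hξ
  · exact fun j z hz => (differentiableAt_integral_div_sub (hpC j) hz).const_mul _
  · intro j z hz
    have hi := (integrable_div_ofReal_sub (hpC j) hz).const_mul (-Complex.I)
    rw [← integral_const_mul, ← RCLike.re_eq_complex_re, ← integral_re hi]
    refine integral_nonneg fun t => ?_
    rw [RCLike.re_eq_complex_re, Pi.zero_apply, div_eq_mul_inv, mul_left_comm,
      Complex.re_ofReal_mul, Complex.inv_def]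
    refine mul_nonneg (hpn j t) ?_
    simp
    exact mul_nonneg hz.le (inv_nonneg.2 (Complex.normSq_nonneg _))
  · intro j ε hε
    have hz : 0 < (Complex.I + ε * Complex.I).im := by simp; linarith
    rw [norm_mul, norm_neg, Complex.norm_I, one_mul]
    refine norm_integral_le_of_norm_le hf.norm (Eventually.of_forall fun t => ?_)
    have h1 := im_le_norm_ofReal_sub hz t
    have h2 : (1 : ℝ) ≤ (Complex.I + ε * Complex.I).im := by simp; linarith
    rw [norm_div, Complex.norm_real, Real.norm_of_nonneg (hpn j t)]
    exact (div_le_self (hpn j t) (h2.trans h1)).trans (hpf j t)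
  · intro j
    fin_cases j <;> simp [hc]
  · filter_upwards [hlim] with x hx
    refine hx.congr' ?_
    filter_upwards [self_mem_nhdsWithin] with ε hε
    have hz : 0 < ((x : ℂ) + ε * Complex.I).im := by simpa using hε
    simp_rw [hsum, Finset.sum_div, mul_div_assoc]
    rw [integral_finsetSum _ fun j _ => (integrable_div_ofReal_sub (hpC j) hz).const_mul _]
    refine Finset.sum_congr rfl fun j _ => ?_
    rw [integral_const_mul]
    linear_combination (c j * ∫ t : ℝ, (p j t : ℂ) / ((t : ℂ) - (x + ε * Complex.I))) *
      Complex.I_sq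

end CauchyIntegral

section HalfLine

/-- The cosine transform on the half-line. -/
noncomputable def cosTransform (f : ℝ → ℂ) (x : ℝ) : ℂ :=
  ∫ t in Ioi (0 : ℝ), f t * (Real.cos (x * t) : ℂ)

/-- The sine transform on the half-line. -/
noncomputable def sinTransform (f : ℝ → ℂ) (x : ℝ) : ℂ :=
  ∫ t in Ioi (0 : ℝ), f t * (Real.sin (x * t) : ℂ)

/-- The function equal to `a` on the positive half-line and to the reflection of `b` on the
negative one. -/
noncomputable def glue (a b : ℝ → ℂ) (t : ℝ) : ℂ := if 0 < t then a t else b (-t)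

variable {a b f : ℝ → ℂ}

lemma integrableOn_mul_cos (hf : IntegrableOn f (Ioi 0)) (x : ℝ) :
    IntegrableOn (fun t => f t * (Real.cos (x * t) : ℂ)) (Ioi 0) :=
  Integrable.mul_bdd (c := 1) hf (by fun_prop) (Eventually.of_forall fun t => by
    rw [Complex.norm_real]; exact Real.abs_cos_le_one _)

lemma integrableOn_mul_sin (hf : IntegrableOn f (Ioi 0)) (x : ℝ) :
    IntegrableOn (fun t => f t * (Real.sin (x * t) : ℂ)) (Ioi 0) :=
  Integrable.mul_bdd (c := 1) hf (by fun_prop) (Eventually.of_forall fun t => by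
    rw [Complex.norm_real]; exact Real.abs_sin_le_one _)

lemma continuous_cosTransform (hf : IntegrableOn f (Ioi 0)) : Continuous (cosTransform f) := by
  refine continuous_of_dominated (bound := fun t => ‖f t‖)
    (fun x => (integrableOn_mul_cos hf x).aestronglyMeasurable) (fun x => ?_) hf.norm ?_
  · refine Eventually.of_forall fun t => ?_
    rw [norm_mul, Complex.norm_real]
    exact mul_le_of_le_one_right (norm_nonneg _) (Real.abs_cos_le_one _)
  · exact Eventually.of_forall fun t => by fun_prop

lemma continuous_sinTransform (hf : IntegrableOn f (Ioi 0)) : Continuous (sinTransform f) := by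
  refine continuous_of_dominated (bound := fun t => ‖f t‖)
    (fun x => (integrableOn_mul_sin hf x).aestronglyMeasurable) (fun x => ?_) hf.norm ?_
  · refine Eventually.of_forall fun t => ?_
    rw [norm_mul, Complex.norm_real]
    exact mul_le_of_le_one_right (norm_nonneg _) (Real.abs_sin_le_one _)
  · exact Eventually.of_forall fun t => by fun_prop

lemma glue_eqOn_Ioi (a b : ℝ → ℂ) : EqOn (glue a b) a (Ioi 0) := fun _ ht => if_pos ht

lemma glue_eqOn_Iic (a b : ℝ → ℂ) : EqOn (glue a b) (fun t => b (-t)) (Iic 0) :=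
  fun _ ht => if_neg (not_lt.2 ht)

lemma integrableOn_Iic_comp_neg {E : Type*} [NormedAddCommGroup E] {b : ℝ → E}
    (hb : IntegrableOn b (Ioi 0)) :
    IntegrableOn (fun t => b (-t)) (Iic 0) := by
  rw [integrableOn_Iic_iff_integrableOn_Iio]
  have h := hb.comp_neg
  rwa [neg_Ioi, neg_zero] at h

lemma integrable_glue (ha : IntegrableOn a (Ioi 0)) (hb : IntegrableOn b (Ioi 0)) :
    Integrable (glue a b) := by
  rw [← integrableOn_univ, ← Iic_union_Ioi (a := (0 : ℝ))]
  exact ((integrableOn_Iic_comp_neg hb).congr_fun (glue_eqOn_Iic a b).symm measurableSet_Iic).union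
    (ha.congr_fun (glue_eqOn_Ioi a b).symm measurableSet_Ioi)

lemma integral_glue (ha : IntegrableOn a (Ioi 0)) (hb : IntegrableOn b (Ioi 0)) :
    ∫ t, glue a b t = (∫ t in Ioi 0, a t) + ∫ t in Ioi 0, b t := by
  have hi := integrable_glue ha hb
  rw [← intervalIntegral.integral_Iic_add_Ioi hi.integrableOn hi.integrableOn (b := 0),
    setIntegral_congr_fun measurableSet_Iic (glue_eqOn_Iic a b),
    setIntegral_congr_fun measurableSet_Ioi (glue_eqOn_Ioi a b), integral_comp_neg_Iic,
    neg_zero, add_comm]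

lemma glue_mul (a b k : ℝ → ℂ) :
    (fun t => glue a b t * k t) = glue (fun t => a t * k t) (fun t => b t * k (-t)) := by
  ext t
  unfold glue
  split_ifs <;> simp

lemma integral_norm_glue (ha : IntegrableOn a (Ioi 0)) (hb : IntegrableOn b (Ioi 0)) :
    ∫ t, ‖glue a b t‖ = (∫ t in Ioi 0, ‖a t‖) + ∫ t in Ioi 0, ‖b t‖ := by
  have hi := (integrable_glue ha hb).norm
  have h1 : EqOn (fun t => ‖glue a b t‖) (fun t => ‖b (-t)‖) (Iic 0) := fun t ht => by
    simp only [glue_eqOn_Iic a b ht]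
  have h2 : EqOn (fun t => ‖glue a b t‖) (fun t => ‖a t‖) (Ioi 0) := fun t ht => by
    simp only [glue_eqOn_Ioi a b ht]
  rw [← intervalIntegral.integral_Iic_add_Ioi hi.integrableOn hi.integrableOn (b := 0),
    setIntegral_congr_fun measurableSet_Iic h1,
    setIntegral_congr_fun measurableSet_Ioi h2, integral_comp_neg_Iic 0 fun t => ‖b t‖,
    neg_zero, add_comm]

lemma integral_glue_mul_exp (ha : IntegrableOn a (Ioi 0)) (hb : IntegrableOn b (Ioi 0)) (ξ : ℝ) :
    ∫ t, glue (fun t => a t + Complex.I * b t) (fun t => a t - Complex.I * b t) t *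
      Complex.exp (ξ * t * Complex.I) = 2 * (cosTransform a ξ - sinTransform b ξ) := by
  have hI := Integrable.const_mul hb Complex.I
  have h1 : IntegrableOn (fun t => (a t + Complex.I * b t) * Complex.exp (ξ * t * Complex.I))
      (Ioi 0) := integrable_mul_exp (ha.add hI) ξ
  have h2 : IntegrableOn (fun t : ℝ => (a t - Complex.I * b t) *
      Complex.exp (ξ * (-t : ℝ) * Complex.I)) (Ioi 0) :=
    Integrable.congr (integrable_mul_exp (ha.sub hI) (-ξ))
      (Eventually.of_forall fun t => by simp)
  rw [glue_mul, integral_glue h1 h2, cosTransform, sinTransform,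
    ← integral_sub (integrableOn_mul_cos ha ξ) (integrableOn_mul_sin hb ξ),
    ← integral_const_mul, ← integral_add h1 h2]
  refine integral_congr_ae (Eventually.of_forall fun t => ?_)
  have e1 : ((ξ : ℂ) * (-t : ℝ) * Complex.I) = ((-(ξ * t) : ℝ) : ℂ) * Complex.I := by
    push_cast; ring
  have e2 : ((ξ : ℂ) * t * Complex.I) = ((ξ * t : ℝ) : ℂ) * Complex.I := by push_cast; ring
  beta_reduce
  rw [e1, e2, Complex.exp_mul_I, Complex.exp_mul_I, ← Complex.ofReal_cos, ← Complex.ofReal_sin,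
    ← Complex.ofReal_cos, ← Complex.ofReal_sin, Real.cos_neg, Real.sin_neg]
  push_cast
  linear_combination (2 * b t * Complex.sin (ξ * t)) * Complex.I_sq

/-- Hardy's inequality for the half-line transforms. -/
theorem lintegral_sinTransform_div_le (ha : IntegrableOn a (Ioi 0)) (hb : IntegrableOn b (Ioi 0))
    (h : ∀ ξ : ℝ, 0 < ξ → cosTransform a ξ = sinTransform b ξ) :
    ∫⁻ ξ in Ioi (0 : ℝ), ‖sinTransform b ξ / ξ‖ₑ ≤
      ENNReal.ofReal (32 * ((∫ t in Ioi 0, ‖a t‖) + ∫ t in Ioi 0, ‖b t‖)) := by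
  have hI := Integrable.const_mul hb Complex.I
  have hp : IntegrableOn (fun t => a t + Complex.I * b t) (Ioi 0) := ha.add hI
  have hm : IntegrableOn (fun t => a t - Complex.I * b t) (Ioi 0) := ha.sub hI
  have hB := lintegral_fourier_div_le (integrable_glue hp hm) fun ξ hξ => by
    rw [integral_glue_mul_exp ha hb, h ξ hξ, sub_self, mul_zero]
  refine le_trans ?_ (hB.trans (ENNReal.ofReal_le_ofReal ?_))
  · refine setLIntegral_mono' measurableSet_Ioi fun ξ hξ => ?_
    rw [integral_glue_mul_exp ha hb]
    have h1 : cosTransform a (-ξ) = cosTransform a ξ := by simp [cosTransform]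
    have h2 : sinTransform b (-ξ) = -sinTransform b ξ := by simp [sinTransform, integral_neg]
    rw [h1, h2, h ξ hξ, ← ofReal_norm, ← ofReal_norm]
    refine ENNReal.ofReal_le_ofReal ?_
    have e : 2 * (sinTransform b ξ - -sinTransform b ξ) / (ξ : ℂ) =
        4 * (sinTransform b ξ / ξ) := by ring
    rw [e, norm_mul]
    norm_num
    linarith [norm_nonneg (sinTransform b ξ / ξ), norm_div (sinTransform b ξ) (ξ : ℂ),
      Complex.norm_real ξ, div_nonneg (norm_nonneg (sinTransform b ξ)) (abs_nonneg ξ)]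
  · rw [integral_norm_glue hp hm]
    have b1 : ∫ t in Ioi 0, ‖a t + Complex.I * b t‖ ≤
        (∫ t in Ioi 0, ‖a t‖) + ∫ t in Ioi 0, ‖b t‖ := by
      rw [← integral_add ha.norm hb.norm]
      refine integral_mono hp.norm (ha.norm.add hb.norm) fun t => (norm_add_le _ _).trans ?_
      simp
    have b2 : ∫ t in Ioi 0, ‖a t - Complex.I * b t‖ ≤
        (∫ t in Ioi 0, ‖a t‖) + ∫ t in Ioi 0, ‖b t‖ := by
      rw [← integral_add ha.norm hb.norm]
      refine integral_mono hm.norm (ha.norm.add hb.norm) fun t => (norm_sub_le _ _).trans ?_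
      simp
    linarith

/-- The cosine transform of the Hilbert transform is the sine transform. -/
theorem cosTransform_hilbert {g H : ℝ → ℂ} (hg : IntegrableOn g (Ioi 0))
    (hH : ∀ x : ℝ, 0 < x → Tendsto (fun δ : ℝ => ((2 / π : ℝ) : ℂ) *
      ∫ t in {t : ℝ | 0 < t ∧ δ < |t - x|}, (t : ℂ) * g t / ((t : ℂ) ^ 2 - (x : ℂ) ^ 2))
      (nhdsWithin 0 (Ioi 0)) (nhds (H x))) (hHi : IntegrableOn H (Ioi 0)) {ξ : ℝ} (hξ : 0 < ξ) :
    cosTransform H ξ = sinTransform g ξ := by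
  have hI := Integrable.const_mul hg Complex.I
  have hp : IntegrableOn (fun t => H t + Complex.I * g t) (Ioi 0) := hHi.add hI
  have hm : IntegrableOn (fun t => H t - Complex.I * g t) (Ioi 0) := hHi.sub hI
  set Φ := glue (fun t => H t + Complex.I * g t) (fun t => H t - Complex.I * g t) with hΦ
  have hg2 : IntegrableOn (fun t => g t / 2) (Ioi 0) := Integrable.div_const hg 2
  have hg3 : IntegrableOn (fun t => -(g t / 2)) (Ioi 0) := hg2.neg
  have hcauchy : ∀ z : ℂ, 0 < z.im →
      ∫ t : ℝ, glue (fun t => g t / 2) (fun t => -(g t / 2)) t / ((t : ℂ) - z) =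
        ∫ t in Ioi (0 : ℝ), (t : ℂ) * g t / ((t : ℂ) ^ 2 - z ^ 2) := by
    intro z hz
    have hb : ∀ (f : ℝ → ℂ), IntegrableOn f (Ioi 0) → ∀ w : ℂ, z.im ≤ |w.im| →
        IntegrableOn (fun t : ℝ => f t * ((t : ℂ) - w)⁻¹) (Ioi 0) := by
      intro f hf w hw
      have hlow : ∀ t : ℝ, z.im ≤ ‖(t : ℂ) - w‖ := fun t => by
        refine hw.trans ?_
        have := Complex.abs_im_le_norm ((t : ℂ) - w)
        simpa using this
      refine Integrable.mul_bdd (c := z.im⁻¹) hf (Continuous.aestronglyMeasurable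
        (Continuous.inv₀ (by fun_prop) fun t => norm_pos_iff.1 (hz.trans_le (hlow t))))
        (Eventually.of_forall fun t => ?_)
      rw [norm_inv]
      exact inv_anti₀ hz (hlow t)
    have i1 := hb _ hg2 z (le_abs_self _)
    have i2 := hb _ hg2 (-z) (by simpa using le_abs_self _)
    have i3 : IntegrableOn (fun t : ℝ => -(g t / 2) * (((-t : ℝ) : ℂ) - z)⁻¹) (Ioi 0) := by
      refine Integrable.congr i2 (Eventually.of_forall fun t => ?_)
      have e : (((-t : ℝ) : ℂ) - z) = -((t : ℂ) - -z) := by push_cast; ring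
      simp only
      rw [e, inv_neg, neg_mul_neg]
    simp_rw [div_eq_mul_inv _ ((_ : ℂ) - z)]
    rw [glue_mul, integral_glue i1 i3, ← integral_add i1 i3]
    refine integral_congr_ae (Eventually.of_forall fun t => ?_)
    have hz0 : ∀ s : ℝ, (s : ℂ) - z ≠ 0 := ofReal_sub_ne_zero hz
    have h1 := hz0 t
    have h2 := hz0 (-t)
    have h3 : (t : ℂ) ^ 2 - z ^ 2 ≠ 0 := by
      have : (t : ℂ) ^ 2 - z ^ 2 = -(((t : ℂ) - z) * (((-t : ℝ) : ℂ) - z)) := by push_cast; ring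
      rw [this]
      exact neg_ne_zero.2 (mul_ne_zero h1 h2)
    push_cast at h2 ⊢
    field_simp
    ring
  have havg := ae_tendsto_symm_average ((integrable_indicator_iff measurableSet_Ioi).2 hg)
  have hneg := (Measure.measurePreserving_neg (volume : Measure ℝ)).quasiMeasurePreserving.ae havg
  have hzero := integral_mul_exp_eq_zero_of_tendsto_cauchy
    (Φ := fun x => (π / 2 : ℂ) * Φ x) (integrable_glue hg2 hg3)
    ((integrable_glue hp hm).const_mul _) ?_ hξ
  · simp_rw [mul_assoc] at hzero
    rw [integral_const_mul] at hzero
    have h1 := (mul_eq_zero.1 hzero).resolve_left (by simp [pi_ne_zero])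
    simp_rw [← mul_assoc] at h1
    rw [hΦ, integral_glue_mul_exp hHi hg] at h1
    exact sub_eq_zero.1 ((mul_eq_zero.1 h1).resolve_left two_ne_zero)
  · filter_upwards [havg, hneg, Measure.ae_ne volume 0] with x h1 h2 h0
    rcases lt_or_gt_of_ne h0 with hx | hx
    · have hx' : 0 < -x := neg_pos.2 hx
      have h3 := tendsto_integral_div_sq_sub_sq hg hx' (hH _ hx') h2 (σ := -1) (by norm_num)
      have e : Φ x = H (-x) + ((-1 : ℝ) : ℂ) * Complex.I * (Ioi 0).indicator g (-x) := by
        rw [hΦ, glue_eqOn_Iic _ _ hx.le, indicator_of_mem (by exact hx')]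
        push_cast
        ring
      rw [e]
      refine h3.congr' ?_
      filter_upwards [self_mem_nhdsWithin] with ε hε
      rw [hcauchy _ (by simpa using hε)]
      refine integral_congr_ae (Eventually.of_forall fun t => ?_)
      simp only
      congr 2
      push_cast
      ring
    · have h3 := tendsto_integral_div_sq_sub_sq hg hx (hH _ hx) h1 (σ := 1) (by norm_num)
      have e : Φ x = H x + ((1 : ℝ) : ℂ) * Complex.I * (Ioi 0).indicator g x := by
        rw [hΦ, glue_eqOn_Ioi _ _ hx, indicator_of_mem (by exact hx)]
        push_cast
        ring
      rw [e]
      refine h3.congr' ?_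
      filter_upwards [self_mem_nhdsWithin] with ε hε
      rw [hcauchy _ (by simpa using hε)]
      simp

end HalfLine

section Kernels

lemma min_mul_one_add_norm_le {w ζ : ℂ} {m : ℝ} (hm : 0 < m) (h : m ≤ ‖w - ζ‖) :
    min (1 / 2) (m / (2 * (1 + ‖ζ‖))) * (1 + ‖w‖) ≤ ‖w - ζ‖ := by
  have h0 := norm_nonneg ζ
  have h1 := norm_nonneg w
  rcases le_total (1 + ‖w‖) (2 * (1 + ‖ζ‖)) with h2 | h2
  · calc _ ≤ m / (2 * (1 + ‖ζ‖)) * (2 * (1 + ‖ζ‖)) := by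
          gcongr
          exact min_le_right _ _
      _ = m := by field_simp
      _ ≤ _ := h
  · calc _ ≤ 1 / 2 * (1 + ‖w‖) := by
          gcongr
          exact min_le_left _ _
      _ ≤ ‖w‖ - ‖ζ‖ := by linarith
      _ ≤ _ := norm_sub_norm_le _ _

/-- A product of two linear factors bounded below grows quadratically. -/
lemma exists_norm_inv_mul_le {s : Set ℂ} {ζ η : ℂ} {m : ℝ} (hm : 0 < m)
    (h : ∀ w ∈ s, m ≤ ‖w - ζ‖ ∧ m ≤ ‖w - η‖) :
    ∃ K : ℝ, ∀ w ∈ s, ‖((w - ζ) * (w - η))⁻¹‖ ≤ K / (1 + ‖w‖ ^ 2) := by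
  set c := min (1 / 2) (m / (2 * (1 + ‖ζ‖)))
  set d := min (1 / 2) (m / (2 * (1 + ‖η‖)))
  have hc : 0 < c := lt_min (by norm_num) (by positivity)
  have hd : 0 < d := lt_min (by norm_num) (by positivity)
  refine ⟨(c * d)⁻¹, fun w hw => ?_⟩
  have h1 := min_mul_one_add_norm_le hm (h w hw).1
  have h2 := min_mul_one_add_norm_le hm (h w hw).2
  rw [norm_inv, norm_mul, div_eq_mul_inv, ← mul_inv]
  refine inv_anti₀ (by positivity) ?_
  calc c * d * (1 + ‖w‖ ^ 2) ≤ c * d * (1 + ‖w‖) ^ 2 := by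
        gcongr
        nlinarith [norm_nonneg w]
    _ = (c * (1 + ‖w‖)) * (d * (1 + ‖w‖)) := by ring
    _ ≤ _ := mul_le_mul h1 h2 (by positivity) (norm_nonneg _)

/-- Rotation of the line of integration in the first quadrant. -/
lemma integral_Ioi_eq_I_mul {B : ℂ → ℂ} {K : ℝ}
    (hd : ∀ z : ℂ, 0 ≤ z.re → 0 ≤ z.im → DifferentiableAt ℂ B z)
    (hB : ∀ z : ℂ, 0 ≤ z.re → 0 ≤ z.im → ‖B z‖ ≤ K / (1 + ‖z‖ ^ 2)) :
    ∫ t : ℝ in Ioi 0, B t = Complex.I * ∫ s : ℝ in Ioi 0, B (s * Complex.I) := by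
  have hK : 0 ≤ K := by
    have := (norm_nonneg _).trans (hB 0 (by simp) (by simp))
    simpa using this
  have hinv : IntegrableOn (fun t : ℝ => K * (1 + t ^ 2)⁻¹) (Ioi 0) :=
    (integrable_inv_one_add_sq.const_mul K).integrableOn
  have hint1 : IntegrableOn (fun t : ℝ => B t) (Ioi 0) := by
    refine Integrable.mono' hinv (ContinuousOn.aestronglyMeasurable (fun t ht => ?_)
      measurableSet_Ioi) (ae_restrict_of_forall_mem measurableSet_Ioi fun t ht => ?_)
    · exact ((hd t (by simpa using ht.out.le) (by simp)).continuousAt.comp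
        (f := fun t : ℝ => (t : ℂ)) (by fun_prop)).continuousWithinAt
    · simpa [div_eq_mul_inv] using hB t (by simpa using ht.out.le) (by simp)
  have hint2 : IntegrableOn (fun t : ℝ => B (t * Complex.I)) (Ioi 0) := by
    refine Integrable.mono' hinv (ContinuousOn.aestronglyMeasurable (fun t ht => ?_)
      measurableSet_Ioi) (ae_restrict_of_forall_mem measurableSet_Ioi fun t ht => ?_)
    · exact ((hd (t * Complex.I) (by simp) (by simpa using ht.out.le)).continuousAt.comp
        (f := fun t : ℝ => (t * Complex.I : ℂ)) (by fun_prop)).continuousWithinAt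
    · simpa [div_eq_mul_inv] using hB (t * Complex.I) (by simp) (by simpa using ht.out.le)
  have hlim := (intervalIntegral_tendsto_integral_Ioi 0 hint1 tendsto_id).sub
    ((intervalIntegral_tendsto_integral_Ioi 0 hint2 tendsto_id).const_mul Complex.I)
  refine sub_eq_zero.1 (tendsto_nhds_unique hlim ?_)
  have hbd : Tendsto (fun R : ℝ => 2 * K * R⁻¹) atTop (nhds 0) := by
    simpa using (tendsto_inv_atTop_zero (𝕜 := ℝ)).const_mul (2 * K)
  refine squeeze_zero_norm' ?_ hbd
  filter_upwards [eventually_gt_atTop 0] with R hR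
  have hrect := Complex.integral_boundary_rect_eq_zero_of_differentiableOn B 0
    (R + R * Complex.I) ?_
  · simp only [Complex.zero_re, Complex.zero_im, Complex.ofReal_re, Complex.ofReal_im,
      Complex.ofReal_zero, zero_mul, add_zero, Complex.add_re, Complex.mul_re, Complex.I_re,
      mul_zero, Complex.I_im, sub_self, Complex.add_im, Complex.mul_im, mul_one,
      zero_add, smul_eq_mul] at hrect
    have side : ∀ z : ℂ, 0 ≤ z.re → 0 ≤ z.im → R ≤ ‖z‖ → ‖B z‖ ≤ K / R ^ 2 := by
      intro z hz hz' hRz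
      refine (hB z hz hz').trans ?_
      gcongr
      nlinarith
    have b1 : ‖∫ t in (0 : ℝ)..R, B (t + R * Complex.I)‖ ≤ K / R ^ 2 * |R - 0| := by
      refine intervalIntegral.norm_integral_le_of_norm_le_const fun t ht => side _ ?_ ?_ ?_
      · rw [uIoc_of_le hR.le] at ht
        simpa using ht.1.le
      · simpa using hR.le
      · refine le_trans ?_ (Complex.abs_im_le_norm _)
        simpa using le_abs_self R
    have b2 : ‖∫ t in (0 : ℝ)..R, B (R + t * Complex.I)‖ ≤ K / R ^ 2 * |R - 0| := by
      refine intervalIntegral.norm_integral_le_of_norm_le_const fun t ht => side _ ?_ ?_ ?_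
      · simpa using hR.le
      · rw [uIoc_of_le hR.le] at ht
        simpa using ht.1.le
      · refine le_trans ?_ (Complex.abs_re_le_norm _)
        simpa using le_abs_self R
    rw [sub_zero, abs_of_pos hR] at b1 b2
    have e : (∫ t in (0 : ℝ)..R, B t) - Complex.I * ∫ t in (0 : ℝ)..R, B (t * Complex.I) =
        (∫ t in (0 : ℝ)..R, B (t + R * Complex.I)) -
          Complex.I * ∫ t in (0 : ℝ)..R, B (R + t * Complex.I) := by
      linear_combination hrect
    simp only [id]
    rw [e]
    refine (norm_sub_le _ _).trans ?_
    rw [norm_mul, Complex.norm_I, one_mul]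
    have h6 : 2 * K * R⁻¹ = K / R ^ 2 * R + K / R ^ 2 * R := by
      field_simp; ring
    rw [h6]
    exact add_le_add b1 b2
  · intro z hz
    have h1 := (Complex.mem_reProdIm.1 hz).1
    have h2 := (Complex.mem_reProdIm.1 hz).2
    simp only [Complex.zero_re, Complex.zero_im, Complex.add_im, Complex.mul_im, Complex.add_re,
      Complex.mul_re, Complex.ofReal_im, sub_self,
      Complex.ofReal_re, Complex.I_im, mul_one, Complex.I_re, mul_zero, add_zero, zero_add] at h1 h2
    rw [uIcc_of_le hR.le] at h1 h2
    exact (hd z h1.1 h2.1).differentiableWithinAt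

/-- The Poisson formula in the upper half-plane. -/
lemma integral_poisson {M : ℂ → ℂ} (hd : ∀ z : ℂ, 0 ≤ z.im → DifferentiableAt ℂ M z)
    (hM : ∀ z : ℂ, 0 ≤ z.im → ‖M z‖ ≤ 1) {x y : ℝ} (hy : 0 < y) :
    ∫ t : ℝ, M t * ((y / ((t - x) ^ 2 + y ^ 2) : ℝ) : ℂ) = π * M (x + y * Complex.I) := by
  have him : ∀ z : ℂ, 0 ≤ z.im → 0 ≤ (x + y * z : ℂ).im := fun z hz => by
    simpa using mul_nonneg hy.le hz
  have h := integral_div_one_add_sq (M := fun z : ℂ => M (x + y * z))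
    (fun z hz => (hd _ (him z hz)).comp z (f := fun z : ℂ => x + y * z) (by fun_prop))
    (fun z hz => hM _ (him z hz))
  rw [← h, ← integral_sub_right_eq_self (fun t : ℝ => M (x + y * t) * (((1 + t ^ 2)⁻¹ : ℝ) : ℂ))
    (x / y)]
  have h2 := Measure.integral_comp_mul_left (fun t : ℝ =>
    M t * ((y / ((t - x) ^ 2 + y ^ 2) : ℝ) : ℂ)) y
  have h3 : (∫ t : ℝ, M t * ((y / ((t - x) ^ 2 + y ^ 2) : ℝ) : ℂ)) =
      y * ∫ t : ℝ, M (y * t : ℝ) * ((y / ((y * t - x) ^ 2 + y ^ 2) : ℝ) : ℂ) := by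
    rw [h2, abs_of_pos (inv_pos.2 hy), Complex.real_smul, ← mul_assoc, ← Complex.ofReal_mul,
      mul_inv_cancel₀ hy.ne', Complex.ofReal_one, one_mul]
  rw [h3, ← integral_const_mul]
  refine integral_congr_ae (Eventually.of_forall fun t => ?_)
  beta_reduce
  have e1 : (x : ℂ) + y * ((t - x / y : ℝ) : ℂ) = ((y * t : ℝ) : ℂ) := by
    have : (y : ℂ) ≠ 0 := by exact_mod_cast hy.ne'
    push_cast
    field_simp
    ring
  have e2 : (1 + (t - x / y) ^ 2)⁻¹ = y * (y / ((y * t - x) ^ 2 + y ^ 2)) := by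
    have : (y * t - x) ^ 2 + y ^ 2 ≠ 0 := by positivity
    have : 1 + (t - x / y) ^ 2 ≠ 0 := by positivity
    field_simp
    ring
  rw [e1, e2]
  push_cast
  ring

end Kernels

section TrigKernels

lemma abs_im_le_norm_ofReal_sub (ζ : ℂ) (t : ℝ) : |ζ.im| ≤ ‖(t : ℂ) - ζ‖ := by
  simpa using Complex.abs_im_le_norm ((t : ℂ) - ζ)

lemma integrable_mul_inv_mul {M : ℝ → ℂ} (hMc : Continuous M) (hM : ∀ t, ‖M t‖ ≤ 1) {ζ η : ℂ}
    (hζ : ζ.im ≠ 0) (hη : η.im ≠ 0) :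
    Integrable fun t : ℝ => M t * (((t : ℂ) - ζ) * (t - η))⁻¹ := by
  have hm : 0 < min |ζ.im| |η.im| := lt_min (abs_pos.2 hζ) (abs_pos.2 hη)
  have hbd : ∀ w ∈ range (fun t : ℝ => (t : ℂ)), min |ζ.im| |η.im| ≤ ‖w - ζ‖ ∧
      min |ζ.im| |η.im| ≤ ‖w - η‖ := by
    rintro _ ⟨t, rfl⟩
    exact ⟨(min_le_left _ _).trans (abs_im_le_norm_ofReal_sub ζ t),
      (min_le_right _ _).trans (abs_im_le_norm_ofReal_sub η t)⟩
  obtain ⟨K, hK⟩ := exists_norm_inv_mul_le hm hbd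
  refine integrable_of_le_div_one_add_sq (K := K) (hMc.mul (Continuous.inv₀ (by fun_prop)
    fun t => ?_)) fun t => ?_
  · have h := hbd t ⟨t, rfl⟩
    exact mul_ne_zero (norm_pos_iff.1 (hm.trans_le h.1)) (norm_pos_iff.1 (hm.trans_le h.2))
  · rw [norm_mul]
    refine (mul_le_of_le_one_left (norm_nonneg _) (hM t)).trans ?_
    simpa using hK t ⟨t, rfl⟩

lemma sq_sub_sq_eq_mul (t : ℝ) (z : ℂ) : (t : ℂ) ^ 2 - z ^ 2 = ((t : ℂ) - z) * (t - -z) := by ring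

lemma integrable_mul_inv_sq_sub_sq {M : ℝ → ℂ} (hMc : Continuous M) (hM : ∀ t, ‖M t‖ ≤ 1) {z : ℂ}
    (hz : 0 < z.im) : Integrable fun t : ℝ => M t * ((t : ℂ) ^ 2 - z ^ 2)⁻¹ := by
  simp_rw [sq_sub_sq_eq_mul]
  exact integrable_mul_inv_mul hMc hM hz.ne' (by simpa using ne_of_gt hz)

/-- A Cauchy formula for bounded analytic functions in the upper half-plane. -/
lemma integral_mul_inv_sq_sub_sq {M : ℂ → ℂ} (hd : ∀ z : ℂ, 0 ≤ z.im → DifferentiableAt ℂ M z)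
    (hM : ∀ z : ℂ, 0 ≤ z.im → ‖M z‖ ≤ 1) {z : ℂ} (hz : 0 < z.im) :
    ∫ t : ℝ, M t * ((t : ℂ) ^ 2 - z ^ 2)⁻¹ = π * Complex.I / z * M z := by
  obtain ⟨x, y⟩ := z
  change 0 < y at hz
  rw [Complex.mk_eq_add_mul_I]
  set z : ℂ := x + y * Complex.I with hzdef
  set c : ℂ := x - y * Complex.I with hcdef
  have hzi : z.im = y := by simp [hzdef]
  have hci : c.im = -y := by simp [hcdef]
  have hMc : Continuous fun t : ℝ => M t := by
    simpa using continuous_ofReal_of_differentiableAt (ε := 0) hd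
  have hM1 : ∀ t : ℝ, ‖M t‖ ≤ 1 := fun t => hM t (by simp)
  have hz0 : z ≠ 0 := fun h => by rw [h] at hzi; simp at hzi; linarith
  have hP := integral_poisson hd hM (x := x) hz
  have hPi : Integrable fun t : ℝ => M t * ((y / ((t - x) ^ 2 + y ^ 2) : ℝ) : ℂ) := by
    have := (integrable_mul_inv_mul hMc hM1 (ζ := z) (η := c) (by rw [hzi]; exact hz.ne')
      (by rw [hci]; simpa using hz.ne')).const_mul (y : ℂ)
    refine this.congr (Eventually.of_forall fun t => ?_)
    have e : ((t : ℂ) - z) * (t - c) = (((t - x) ^ 2 + y ^ 2 : ℝ) : ℂ) := by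
      rw [hzdef, hcdef]
      push_cast
      linear_combination (-(y : ℂ) ^ 2) * Complex.I_sq
    beta_reduce
    rw [e]
    push_cast
    ring
  have hQi := integrable_mul_inv_mul hMc hM1 (ζ := c) (η := -z)
    (by rw [hci]; simpa using hz.ne') (by simp [hzi, hz.ne'])
  have hlow : ∀ w ∈ {w : ℂ | 0 ≤ w.im}, y ≤ ‖w - c‖ ∧ y ≤ ‖w - -z‖ := by
    intro w hw
    have hw' : 0 ≤ w.im := hw
    constructor
    · refine le_trans ?_ ((le_abs_self _).trans (Complex.abs_im_le_norm (w - c)))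
      rw [Complex.sub_im, hci]
      linarith
    · refine le_trans ?_ ((le_abs_self _).trans (Complex.abs_im_le_norm (w - -z)))
      rw [Complex.sub_im, Complex.neg_im, hzi]
      linarith
  have hQ : ∫ t : ℝ, M t * (((t : ℂ) - c) * (t - -z))⁻¹ = 0 := by
    obtain ⟨K, hK⟩ := exists_norm_inv_mul_le hz hlow
    refine integral_eq_zero_of_differentiable_upper (K := K)
      (B := fun w => M w * ((w - c) * (w - -z))⁻¹) (fun w hw => ?_) fun w hw => ?_
    · refine (hd w hw).mul (DifferentiableAt.inv (by fun_prop) ?_)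
      have h := hlow w hw
      exact mul_ne_zero (norm_pos_iff.1 (hz.trans_le h.1)) (norm_pos_iff.1 (hz.trans_le h.2))
    · rw [norm_mul]
      exact (mul_le_of_le_one_left (norm_nonneg _) (hM w hw)).trans (hK w hw)
  have e : ∀ t : ℝ, M t * ((t : ℂ) ^ 2 - z ^ 2)⁻¹ =
      Complex.I / z * (M t * ((y / ((t - x) ^ 2 + y ^ 2) : ℝ) : ℂ)) +
        x / z * (M t * (((t : ℂ) - c) * (t - -z))⁻¹) := by
    intro t
    have h1 : (t : ℂ) - z ≠ 0 := ofReal_sub_ne_zero (by rw [hzi]; exact hz) t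
    have h2 := hlow t (by simp)
    have h3 := norm_pos_iff.1 (hz.trans_le h2.1)
    have h4 := norm_pos_iff.1 (hz.trans_le h2.2)
    have e1 : (((t - x) ^ 2 + y ^ 2 : ℝ) : ℂ) = ((t : ℂ) - z) * (t - c) := by
      rw [hzdef, hcdef]
      push_cast
      linear_combination ((y : ℂ) ^ 2) * Complex.I_sq
    rw [sq_sub_sq_eq_mul, Complex.ofReal_div, e1]
    have e3 : (t : ℂ) - c = Complex.I / z * y * (t - -z) + x / z * (t - z) := by
      field_simp
      rw [hzdef, hcdef]
      ring
    have e4 : M t * (((t : ℂ) - z) * (t - -z))⁻¹ =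
        M t * ((t : ℂ) - c) * (((t : ℂ) - z) * (t - -z) * (t - c))⁻¹ := by
      field_simp
    rw [e4]
    nth_rewrite 1 [e3]
    field_simp
  simp_rw [e]
  rw [integral_add (hPi.const_mul _) (hQi.const_mul _), integral_const_mul, integral_const_mul, hP,
    hQ]
  ring

lemma integral_eq_Ioi_add_neg {F : ℝ → ℂ} (hF : Integrable F) :
    ∫ t, F t = ∫ t in Ioi 0, (F t + F (-t)) := by
  rw [integral_add hF.integrableOn hF.comp_neg.integrableOn, integral_comp_neg_Ioi, neg_zero,
    add_comm, intervalIntegral.integral_Iic_add_Ioi hF.integrableOn hF.integrableOn]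

lemma norm_exp_mul_mul_I_le_one {u : ℝ} (hu : 0 ≤ u) {z : ℂ} (hz : 0 ≤ z.im) :
    ‖Complex.exp (u * z * Complex.I)‖ ≤ 1 := by
  rw [Complex.norm_exp, Real.exp_le_one_iff]
  simp
  positivity

lemma integral_cos_mul_inv_sq_sub_sq {z : ℂ} (hz : 0 < z.im) {u : ℝ} (hu : 0 ≤ u) :
    ∫ t in Ioi (0 : ℝ), (Real.cos (t * u) : ℂ) * ((t : ℂ) ^ 2 - z ^ 2)⁻¹ =
      π * Complex.I / (2 * z) * Complex.exp (u * z * Complex.I) := by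
  have h := integral_mul_inv_sq_sub_sq (M := fun w => Complex.exp (u * w * Complex.I))
    (fun w _ => by fun_prop) (fun w hw => norm_exp_mul_mul_I_le_one hu hw) hz
  have hi := integrable_mul_inv_sq_sub_sq (M := fun t : ℝ => Complex.exp (u * t * Complex.I))
    (by fun_prop) (fun t => norm_exp_mul_mul_I_le_one hu (by simp)) hz
  rw [integral_eq_Ioi_add_neg hi] at h
  have e : ∀ t : ℝ, Complex.exp (u * t * Complex.I) * ((t : ℂ) ^ 2 - z ^ 2)⁻¹ +
      Complex.exp (u * (-t : ℝ) * Complex.I) * (((-t : ℝ) : ℂ) ^ 2 - z ^ 2)⁻¹ =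
      2 * ((Real.cos (t * u) : ℂ) * ((t : ℂ) ^ 2 - z ^ 2)⁻¹) := by
    intro t
    have e1 : (u * (-t : ℝ) * Complex.I : ℂ) = -(t * u) * Complex.I := by push_cast; ring
    have e2 : (u * t * Complex.I : ℂ) = (t * u) * Complex.I := by ring
    have e3 := Complex.two_cos (t * u)
    rw [e1, e2, Complex.ofReal_cos, Complex.ofReal_neg, neg_sq]
    push_cast
    rw [← mul_assoc, e3]
    ring
  simp_rw [e] at h
  rw [integral_const_mul] at h
  have h2 : (2 : ℂ) ≠ 0 := two_ne_zero
  rw [← mul_right_inj' h2, h]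
  have hz0 : z ≠ 0 := fun h => by rw [h] at hz; simp at hz
  field_simp

lemma integral_sin_mul_inv_sq_sub_sq {z : ℂ} (hz : 0 < z.im) (hzr : z.re < 0) {u : ℝ}
    (hu : 0 ≤ u) :
    ∫ t in Ioi (0 : ℝ), (Real.sin (t * u) : ℂ) * ((t : ℂ) ^ 2 - z ^ 2)⁻¹ =
      -(π / (2 * z) * Complex.exp (u * z * Complex.I)) -
        ∫ s in Ioi (0 : ℝ), (Real.exp (-(s * u)) : ℂ) * ((s : ℂ) ^ 2 + z ^ 2)⁻¹ := by
  have hm : 0 < min z.im (-z.re) := lt_min hz (by linarith)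
  have hlow : ∀ w ∈ {w : ℂ | 0 ≤ w.re ∧ 0 ≤ w.im}, min z.im (-z.re) ≤ ‖w - z‖ ∧
      min z.im (-z.re) ≤ ‖w - -z‖ := by
    rintro w ⟨h1, h2⟩
    constructor
    · refine (min_le_right _ _).trans
        (le_trans ?_ ((le_abs_self _).trans (Complex.abs_re_le_norm (w - z))))
      rw [Complex.sub_re]
      linarith
    · refine (min_le_left _ _).trans
        (le_trans ?_ ((le_abs_self _).trans (Complex.abs_im_le_norm (w - -z))))
      rw [Complex.sub_im, Complex.neg_im]
      linarith
  obtain ⟨K, hK⟩ := exists_norm_inv_mul_le hm hlow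
  have hrot := integral_Ioi_eq_I_mul (K := K)
    (B := fun w => Complex.exp (u * w * Complex.I) * ((w - z) * (w - -z))⁻¹)
    (fun w h1 h2 => by
      have h := hlow w ⟨h1, h2⟩
      exact DifferentiableAt.mul (by fun_prop) (DifferentiableAt.inv (by fun_prop)
        (mul_ne_zero (norm_pos_iff.1 (hm.trans_le h.1)) (norm_pos_iff.1 (hm.trans_le h.2)))))
    (fun w h1 h2 => by
      rw [norm_mul]
      exact (mul_le_of_le_one_left (norm_nonneg _) (norm_exp_mul_mul_I_le_one hu h2)).trans
        (hK w ⟨h1, h2⟩))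
  have hexp := (integrable_mul_inv_sq_sub_sq (M := fun t : ℝ => Complex.exp (u * t * Complex.I))
    (by fun_prop) (fun t => norm_exp_mul_mul_I_le_one hu (by simp)) hz).integrableOn (s := Ioi 0)
  have hcos := (integrable_mul_inv_sq_sub_sq (M := fun t : ℝ => (Real.cos (t * u) : ℂ))
    (by fun_prop) (fun t => by rw [Complex.norm_real]; exact Real.abs_cos_le_one _)
    hz).integrableOn (s := Ioi 0)
  have e : ∀ t : ℝ, (Real.sin (t * u) : ℂ) * ((t : ℂ) ^ 2 - z ^ 2)⁻¹ =
      -Complex.I * (Complex.exp (u * t * Complex.I) * ((t : ℂ) ^ 2 - z ^ 2)⁻¹ -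
        (Real.cos (t * u) : ℂ) * ((t : ℂ) ^ 2 - z ^ 2)⁻¹) := by
    intro t
    have e2 : (u * t * Complex.I : ℂ) = ((t * u : ℝ) : ℂ) * Complex.I := by push_cast; ring
    rw [e2, Complex.exp_mul_I, Complex.ofReal_cos, Complex.ofReal_sin]
    linear_combination (Complex.sin ((t * u : ℝ) : ℂ) * ((t : ℂ) ^ 2 - z ^ 2)⁻¹) * Complex.I_sq
  have e3 : ∀ s : ℝ, Complex.exp (u * (s * Complex.I) * Complex.I) *
      ((s * Complex.I - z) * (s * Complex.I - -z))⁻¹ =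
      -((Real.exp (-(s * u)) : ℂ) * ((s : ℂ) ^ 2 + z ^ 2)⁻¹) := by
    intro s
    have e4 : (u * (s * Complex.I) * Complex.I : ℂ) = ((-(s * u) : ℝ) : ℂ) := by
      push_cast
      linear_combination (u * s : ℂ) * Complex.I_sq
    have e5 : (s * Complex.I - z) * (s * Complex.I - -z) = -((s : ℂ) ^ 2 + z ^ 2) := by
      linear_combination ((s : ℂ) ^ 2) * Complex.I_sq
    rw [e4, e5, Complex.ofReal_exp, inv_neg, mul_neg]
  simp_rw [e]
  rw [integral_const_mul, integral_sub hexp hcos, integral_cos_mul_inv_sq_sub_sq hz hu]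
  simp_rw [sq_sub_sq_eq_mul]
  rw [hrot]
  simp_rw [e3]
  rw [integral_neg]
  generalize (∫ s in Ioi (0 : ℝ), (Real.exp (-(s * u)) : ℂ) * ((s : ℂ) ^ 2 + z ^ 2)⁻¹) = J
  linear_combination (J + π / (2 * z) * Complex.exp (u * z * Complex.I)) * Complex.I_sq

end TrigKernels

section PoissonAverage

/-- The integral of `f` against the Poisson kernels of the half-line. -/
noncomputable def poissonAverage (f : ℝ → ℂ) (v : ℝ) : ℂ :=
  ∫ s in Ioi (0 : ℝ), f s * ((s / (s ^ 2 + v ^ 2) : ℝ) : ℂ)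

lemma integrableOn_poisson_and_integral {s : ℝ} (hs : 0 < s) :
    IntegrableOn (fun v : ℝ => s / (s ^ 2 + v ^ 2)) (Ioi 0) ∧
      ∫ v in Ioi (0 : ℝ), s / (s ^ 2 + v ^ 2) = π / 2 := by
  have e : (fun v : ℝ => s / (s ^ 2 + v ^ 2)) = fun v => s⁻¹ * (1 + (s⁻¹ * v) ^ 2)⁻¹ := by
    ext v
    have h1 : s ^ 2 + v ^ 2 ≠ 0 := by positivity
    have h2 : 1 + (s⁻¹ * v) ^ 2 ≠ 0 := by positivity
    field_simp
  constructor
  · rw [e]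
    exact ((integrable_inv_one_add_sq.comp_mul_left' (inv_ne_zero hs.ne')).const_mul
      _).integrableOn
  · rw [e, integral_const_mul, integral_comp_mul_left_Ioi (fun v => (1 + v ^ 2)⁻¹) 0
      (inv_pos.2 hs), mul_zero, integral_Ioi_inv_one_add_sq, arctan_zero, sub_zero, inv_inv,
      smul_eq_mul, inv_mul_cancel_left₀ hs.ne']

variable {f : ℝ → ℂ}

lemma integrable_poisson_prod (hf : IntegrableOn f (Ioi 0)) :
    Integrable (fun p : ℝ × ℝ => f p.1 * ((p.1 / (p.1 ^ 2 + p.2 ^ 2) : ℝ) : ℂ))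
      ((volume.restrict (Ioi 0)).prod (volume.restrict (Ioi 0))) := by
  have hm : Measurable fun p : ℝ × ℝ => ((p.1 / (p.1 ^ 2 + p.2 ^ 2) : ℝ) : ℂ) := by fun_prop
  have hms : AEStronglyMeasurable (fun p : ℝ × ℝ => f p.1 *
      ((p.1 / (p.1 ^ 2 + p.2 ^ 2) : ℝ) : ℂ))
      ((volume.restrict (Ioi 0)).prod (volume.restrict (Ioi 0))) :=
    hf.aestronglyMeasurable.comp_fst.mul hm.aestronglyMeasurable
  rw [integrable_prod_iff hms]
  constructor
  · refine ae_restrict_of_forall_mem measurableSet_Ioi fun s hs => ?_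
    exact ((integrableOn_poisson_and_integral hs).1.ofReal).const_mul (f s)
  · refine (hf.norm.mul_const (π / 2)).congr ?_
    refine ae_restrict_of_forall_mem measurableSet_Ioi fun s hs => ?_
    have hs' : 0 < s := hs
    have e : ∀ v : ℝ, ‖f s * ((s / (s ^ 2 + v ^ 2) : ℝ) : ℂ)‖ =
        ‖f s‖ * (s / (s ^ 2 + v ^ 2)) := fun v => by
      rw [norm_mul, Complex.norm_real, Real.norm_of_nonneg (by positivity)]
    simp_rw [e]
    rw [integral_const_mul, (integrableOn_poisson_and_integral hs').2]

lemma integrableOn_poissonAverage (hf : IntegrableOn f (Ioi 0)) :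
    IntegrableOn (poissonAverage f) (Ioi 0) :=
  (integrable_poisson_prod hf).integral_prod_right

lemma integral_poissonAverage_mul (hf : IntegrableOn f (Ioi 0)) {β : ℝ → ℂ} (hβ : Continuous β)
    (hβ1 : ∀ v, 0 < v → ‖β v‖ ≤ 1) :
    ∫ v in Ioi (0 : ℝ), poissonAverage f v * β v =
      ∫ s in Ioi (0 : ℝ), f s * ∫ v in Ioi (0 : ℝ), ((s / (s ^ 2 + v ^ 2) : ℝ) : ℂ) * β v := by
  have hi : Integrable (fun p : ℝ × ℝ => f p.1 * ((p.1 / (p.1 ^ 2 + p.2 ^ 2) : ℝ) : ℂ) * β p.2)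
      ((volume.restrict (Ioi 0)).prod (volume.restrict (Ioi 0))) := by
    refine (integrable_poisson_prod hf).mul_bdd (c := 1)
      (hβ.comp continuous_snd).aestronglyMeasurable ?_
    rw [Measure.prod_restrict]
    exact ae_restrict_of_forall_mem (measurableSet_Ioi.prod measurableSet_Ioi)
      fun p hp => hβ1 _ hp.2
  have h := integral_integral_swap (f := fun s v : ℝ =>
    f s * ((s / (s ^ 2 + v ^ 2) : ℝ) : ℂ) * β v) hi
  simp_rw [integral_mul_const, mul_assoc, integral_const_mul] at h
  exact h.symm

lemma integral_norm_poissonAverage_le (hf : IntegrableOn f (Ioi 0)) :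
    ∫ v in Ioi (0 : ℝ), ‖poissonAverage f v‖ ≤ π / 2 * ∫ s in Ioi (0 : ℝ), ‖f s‖ := by
  have hi := (integrable_poisson_prod hf).norm
  have h := integral_integral_swap (f := fun s v : ℝ =>
    ‖f s * ((s / (s ^ 2 + v ^ 2) : ℝ) : ℂ)‖) hi
  have h1 : ∫ v in Ioi (0 : ℝ), ‖poissonAverage f v‖ ≤
      ∫ v in Ioi (0 : ℝ), ∫ s in Ioi (0 : ℝ), ‖f s * ((s / (s ^ 2 + v ^ 2) : ℝ) : ℂ)‖ :=
    integral_mono (integrableOn_poissonAverage hf).norm hi.integral_prod_right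
      fun v => norm_integral_le_integral_norm _
  refine h1.trans (h.symm.trans ?_).le
  rw [← integral_const_mul]
  refine setIntegral_congr_fun measurableSet_Ioi fun s hs => ?_
  have hs' : 0 < s := hs
  have e : ∀ v : ℝ, ‖f s * ((s / (s ^ 2 + v ^ 2) : ℝ) : ℂ)‖ =
      ‖f s‖ * (s / (s ^ 2 + v ^ 2)) := fun v => by
    rw [norm_mul, Complex.norm_real, Real.norm_of_nonneg (by positivity)]
  simp_rw [e]
  rw [integral_const_mul, (integrableOn_poisson_and_integral hs').2, mul_comm]

lemma cosTransform_poissonAverage (hf : IntegrableOn f (Ioi 0)) {x : ℝ} (hx : 0 < x) :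
    cosTransform (poissonAverage f) x =
      π / 2 * ∫ s in Ioi (0 : ℝ), f s * (Real.exp (-(x * s)) : ℂ) := by
  rw [cosTransform, integral_poissonAverage_mul hf (by fun_prop) fun v _ => by
    rw [Complex.norm_real]; exact Real.abs_cos_le_one _, ← integral_const_mul]
  refine setIntegral_congr_fun measurableSet_Ioi fun s hs => ?_
  have hs' : 0 < s := hs
  have h := integral_cos_mul_inv_sq_sub_sq (z := s * Complex.I) (by simpa using hs') hx.le
  have e : ∀ v : ℝ, ((s / (s ^ 2 + v ^ 2) : ℝ) : ℂ) * (Real.cos (x * v) : ℂ) =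
      s * ((Real.cos (v * x) : ℂ) * ((v : ℂ) ^ 2 - (s * Complex.I) ^ 2)⁻¹) := by
    intro v
    have e1 : (v : ℂ) ^ 2 - (s * Complex.I) ^ 2 = (s : ℂ) ^ 2 + (v : ℂ) ^ 2 := by
      linear_combination (-(s : ℂ) ^ 2) * Complex.I_sq
    rw [e1, mul_comm x v]
    push_cast
    ring
  simp_rw [e]
  rw [integral_const_mul, h]
  have e2 : (x * (s * Complex.I) * Complex.I : ℂ) = ((-(x * s) : ℝ) : ℂ) := by
    push_cast
    linear_combination (x * s : ℂ) * Complex.I_sq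
  have hsC : (s : ℂ) ≠ 0 := by exact_mod_cast hs'.ne'
  rw [e2, Complex.ofReal_exp]
  have hI := Complex.I_ne_zero
  field_simp

lemma integral_poissonAverage_mul_exp (hf : IntegrableOn f (Ioi 0)) {x : ℝ} (hx : 0 < x) :
    ∫ v in Ioi (0 : ℝ), poissonAverage f v * (Real.exp (-(x * v)) : ℂ) =
      ∫ u in Ioi (0 : ℝ), f u * ∫ s in Ioi (0 : ℝ),
        (Real.exp (-(s * u)) : ℂ) * (x * ((s : ℂ) ^ 2 + (x : ℂ) ^ 2)⁻¹) := by
  rw [integral_poissonAverage_mul hf (by fun_prop) fun v hv => by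
    rw [Complex.norm_real, Real.norm_of_nonneg (exp_pos _).le, Real.exp_le_one_iff]
    nlinarith [mul_pos hx hv]]
  refine setIntegral_congr_fun measurableSet_Ioi fun u hu => ?_
  have hu' : 0 < u := hu
  congr 1
  have h := integral_comp_mul_left_Ioi (fun v : ℝ => ((u / (u ^ 2 + v ^ 2) : ℝ) : ℂ) *
    (Real.exp (-(x * v)) : ℂ)) 0 (div_pos hu' hx)
  rw [mul_zero, Complex.real_smul] at h
  have hb : ((u / x : ℝ) : ℂ) ≠ 0 := by exact_mod_cast (div_pos hu' hx).ne'
  have h' : ∫ v in Ioi (0 : ℝ), ((u / (u ^ 2 + v ^ 2) : ℝ) : ℂ) * (Real.exp (-(x * v)) : ℂ) =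
      ((u / x : ℝ) : ℂ) * ∫ s in Ioi (0 : ℝ), ((u / (u ^ 2 + (u / x * s) ^ 2) : ℝ) : ℂ) *
        (Real.exp (-(x * (u / x * s))) : ℂ) := by
    rw [h, Complex.ofReal_inv, mul_inv_cancel_left₀ hb]
  rw [h', ← integral_const_mul]
  refine integral_congr_ae (Eventually.of_forall fun s => ?_)
  beta_reduce
  have e1 : x * (u / x * s) = s * u := by field_simp
  have e2 : u / x * (u / (u ^ 2 + (u / x * s) ^ 2)) = x * (s ^ 2 + x ^ 2)⁻¹ := by
    have h1 : u ^ 2 + (u / x * s) ^ 2 ≠ 0 := by positivity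
    have h2 : s ^ 2 + x ^ 2 ≠ 0 := by positivity
    field_simp
    ring
  rw [e1, ← mul_assoc, ← Complex.ofReal_mul, e2]
  push_cast
  ring

end PoissonAverage

section HilbertOfTransform

variable {f g H k : ℝ → ℂ} {x : ℝ}

lemma integrable_mul_comp_mul_prod {β : ℝ → ℂ} (hf : IntegrableOn f (Ioi 0))
    (hk : IntegrableOn k (Ioi 0)) (hβ : Continuous β) (hβ1 : ∀ s, ‖β s‖ ≤ 1) :
    Integrable (Function.uncurry fun t u : ℝ => f u * β (t * u) * k t)
      ((volume.restrict (Ioi 0)).prod (volume.restrict (Ioi 0))) := by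
  have h := (Integrable.mul_prod hk hf).mul_bdd (c := 1)
    (g := fun p : ℝ × ℝ => β (p.1 * p.2))
    (hβ.comp (continuous_fst.mul continuous_snd)).aestronglyMeasurable
    (Eventually.of_forall fun p => hβ1 _)
  refine h.congr (Eventually.of_forall fun p => ?_)
  simp only [Function.uncurry]
  ring

lemma integral_integral_mul_comp_mul {β : ℝ → ℂ} (hf : IntegrableOn f (Ioi 0))
    (hk : IntegrableOn k (Ioi 0)) (hβ : Continuous β) (hβ1 : ∀ s, ‖β s‖ ≤ 1) :
    ∫ t in Ioi (0 : ℝ), (∫ u in Ioi (0 : ℝ), f u * β (t * u)) * k t =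
      ∫ u in Ioi (0 : ℝ), f u * ∫ t in Ioi (0 : ℝ), β (t * u) * k t := by
  have h := integral_integral_swap (f := fun t u : ℝ => f u * β (t * u) * k t)
    (integrable_mul_comp_mul_prod hf hk hβ hβ1)
  simp_rw [integral_mul_const, mul_assoc, integral_const_mul] at h
  exact h

lemma integrableOn_mul_integral_comp_mul {β : ℝ → ℂ} (hf : IntegrableOn f (Ioi 0))
    (hk : IntegrableOn k (Ioi 0)) (hβ : Continuous β) (hβ1 : ∀ s, ‖β s‖ ≤ 1) :
    IntegrableOn (fun u => f u * ∫ t in Ioi (0 : ℝ), β (t * u) * k t) (Ioi 0) := by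
  have h := (integrable_mul_comp_mul_prod hf hk hβ hβ1).integral_prod_right
  simp only [Function.uncurry, mul_assoc, integral_const_mul] at h
  exact h

lemma tendsto_integral_mul_exp (hf : IntegrableOn f (Ioi 0)) (x : ℝ) :
    Tendsto (fun ε : ℝ => ∫ u in Ioi (0 : ℝ),
        f u * Complex.exp (u * (x + ε * Complex.I) * Complex.I))
      (nhdsWithin 0 (Ioi 0)) (nhds (cosTransform f x + Complex.I * sinTransform f x)) := by
  have e : cosTransform f x + Complex.I * sinTransform f x =
      ∫ u in Ioi (0 : ℝ), f u * Complex.exp (u * (x + (0 : ℝ) * Complex.I) * Complex.I) := by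
    rw [cosTransform, sinTransform, ← integral_const_mul, ← integral_add
      (integrableOn_mul_cos hf x) ((integrableOn_mul_sin hf x).const_mul _)]
    refine integral_congr_ae (Eventually.of_forall fun u => ?_)
    have h1 : (u * (x + (0 : ℝ) * Complex.I) * Complex.I : ℂ) = ((x * u : ℝ) : ℂ) * Complex.I := by
      push_cast
      ring
    beta_reduce
    rw [h1, Complex.exp_mul_I, ← Complex.ofReal_cos, ← Complex.ofReal_sin]
    ring
  rw [e]
  refine tendsto_integral_filter_of_dominated_convergence (fun u => ‖f u‖) ?_ ?_ hf.norm ?_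
  · exact Eventually.of_forall fun ε => hf.aestronglyMeasurable.mul
      (Continuous.aestronglyMeasurable (by fun_prop))
  · filter_upwards [self_mem_nhdsWithin] with ε hε
    refine ae_restrict_of_forall_mem measurableSet_Ioi fun u hu => ?_
    rw [norm_mul]
    refine mul_le_of_le_one_right (norm_nonneg _) (norm_exp_mul_mul_I_le_one (le_of_lt hu) ?_)
    simpa using le_of_lt hε
  · refine Eventually.of_forall fun u => tendsto_nhdsWithin_of_tendsto_nhds ?_
    exact Continuous.tendsto (by fun_prop) (0 : ℝ)

lemma integrableOn_inv_sq_add {c : ℝ} (hc : 0 < c) :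
    IntegrableOn (fun s : ℝ => (s ^ 2 + c)⁻¹) (Ioi 0) := by
  have h := (integrable_mul_inv_sq_sub_sq (M := fun _ => 1) (z := √c * Complex.I)
    continuous_const (fun _ => by simp) (by simpa using hc)).norm.integrableOn (s := Ioi 0)
  refine h.congr (Eventually.of_forall fun s => ?_)
  have e : (s : ℂ) ^ 2 - (√c * Complex.I) ^ 2 = ((s ^ 2 + c : ℝ) : ℂ) := by
    rw [mul_pow, Complex.I_sq, ← Complex.ofReal_pow √c, Real.sq_sqrt hc.le]
    push_cast
    ring
  beta_reduce
  rw [e, one_mul, norm_inv, Complex.norm_real, Real.norm_of_nonneg (by positivity)]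

lemma tendsto_integral_laplace_kernel (hf : IntegrableOn f (Ioi 0)) (hx : 0 < x) :
    Tendsto (fun ε : ℝ => ∫ u in Ioi (0 : ℝ), f u * ∫ s in Ioi (0 : ℝ),
        (Real.exp (-(s * u)) : ℂ) * ((s : ℂ) ^ 2 + (((-x : ℝ) : ℂ) + ε * Complex.I) ^ 2)⁻¹)
      (nhdsWithin 0 (Ioi 0)) (nhds (∫ u in Ioi (0 : ℝ), f u * ∫ s in Ioi (0 : ℝ),
        (Real.exp (-(s * u)) : ℂ) * ((s : ℂ) ^ 2 + (x : ℂ) ^ 2)⁻¹)) := by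
  have hx2 : 0 < x ^ 2 / 2 := by positivity
  have hre : ∀ s ε : ℝ, ((s : ℂ) ^ 2 + (((-x : ℝ) : ℂ) + ε * Complex.I) ^ 2).re =
      s ^ 2 + x ^ 2 - ε ^ 2 := by
    intro s ε
    simp [pow_two]
    ring
  have hlow : ∀ ε : ℝ, ε ^ 2 < x ^ 2 / 2 → ∀ s : ℝ,
      s ^ 2 + x ^ 2 / 2 ≤ ‖(s : ℂ) ^ 2 + (((-x : ℝ) : ℂ) + ε * Complex.I) ^ 2‖ := by
    intro ε hε s
    refine le_trans ?_ (Complex.re_le_norm _)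
    rw [hre]
    linarith
  have hne : ∀ ε : ℝ, ε ^ 2 < x ^ 2 / 2 → ∀ s : ℝ,
      (s : ℂ) ^ 2 + (((-x : ℝ) : ℂ) + ε * Complex.I) ^ 2 ≠ 0 := fun ε hε s =>
    norm_pos_iff.1 (lt_of_lt_of_le (by positivity) (hlow ε hε s))
  set μ := volume.restrict (Ioi (0 : ℝ)) with hμ
  let F : ℝ → ℝ × ℝ → ℂ := fun ε p => f p.1 * ((Real.exp (-(p.2 * p.1)) : ℂ) *
    ((p.2 : ℂ) ^ 2 + (((-x : ℝ) : ℂ) + ε * Complex.I) ^ 2)⁻¹)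
  have hbi : Integrable (fun p : ℝ × ℝ => ‖f p.1‖ * (p.2 ^ 2 + x ^ 2 / 2)⁻¹) (μ.prod μ) :=
    Integrable.mul_prod hf.norm (integrableOn_inv_sq_add hx2)
  have hFm : ∀ ε : ℝ, ε ^ 2 < x ^ 2 / 2 → AEStronglyMeasurable (F ε) (μ.prod μ) := fun ε hε =>
    hf.aestronglyMeasurable.comp_fst.mul (Continuous.aestronglyMeasurable
      (Continuous.mul (by fun_prop) (Continuous.inv₀ (by fun_prop) fun p => hne ε hε p.2)))
  have hFb : ∀ ε : ℝ, ε ^ 2 < x ^ 2 / 2 →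
      ∀ᵐ p ∂(μ.prod μ), ‖F ε p‖ ≤ ‖f p.1‖ * (p.2 ^ 2 + x ^ 2 / 2)⁻¹ := by
    intro ε hε
    rw [hμ, Measure.prod_restrict]
    refine ae_restrict_of_forall_mem (measurableSet_Ioi.prod measurableSet_Ioi) fun p hp => ?_
    have h1 : 0 < p.1 := hp.1
    have h2 : 0 < p.2 := hp.2
    rw [norm_mul, norm_mul, norm_inv, Complex.norm_real, Real.norm_of_nonneg (exp_pos _).le]
    have h3 : Real.exp (-(p.2 * p.1)) ≤ 1 := by
      rw [Real.exp_le_one_iff]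
      nlinarith [mul_pos h2 h1]
    have h4 := inv_anti₀ (by positivity) (hlow ε hε p.2)
    refine mul_le_mul_of_nonneg_left ?_ (norm_nonneg _)
    calc _ ≤ 1 * (p.2 ^ 2 + x ^ 2 / 2)⁻¹ := by gcongr
      _ = _ := one_mul _
  have hsmall : ∀ᶠ ε : ℝ in nhdsWithin 0 (Ioi 0), ε ^ 2 < x ^ 2 / 2 := by
    have : Tendsto (fun ε : ℝ => ε ^ 2) (nhdsWithin 0 (Ioi 0)) (nhds ((0 : ℝ) ^ 2)) :=
      tendsto_nhdsWithin_of_tendsto_nhds (Continuous.tendsto (by fun_prop) _)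
    exact this.eventually_lt_const (by simpa using hx2)
  have hzero : (0 : ℝ) ^ 2 < x ^ 2 / 2 := by simpa using hx2
  have hprod : ∀ ε : ℝ, ε ^ 2 < x ^ 2 / 2 → ∫ p, F ε p ∂(μ.prod μ) =
      ∫ u in Ioi (0 : ℝ), f u * ∫ s in Ioi (0 : ℝ), (Real.exp (-(s * u)) : ℂ) *
        ((s : ℂ) ^ 2 + (((-x : ℝ) : ℂ) + ε * Complex.I) ^ 2)⁻¹ := by
    intro ε hε
    rw [integral_prod _ (hbi.mono' (hFm ε hε) (hFb ε hε))]
    simp only [F, integral_const_mul, hμ]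
  have hlim : Tendsto (fun ε => ∫ p, F ε p ∂(μ.prod μ)) (nhdsWithin 0 (Ioi 0))
      (nhds (∫ p, F 0 p ∂(μ.prod μ))) := by
    refine tendsto_integral_filter_of_dominated_convergence _ (hsmall.mono hFm)
      (hsmall.mono hFb) hbi (Eventually.of_forall fun p => tendsto_nhdsWithin_of_tendsto_nhds ?_)
    exact tendsto_const_nhds.mul (tendsto_const_nhds.mul
      ((Continuous.tendsto (by fun_prop) (0 : ℝ)).inv₀ (hne 0 hzero p.2)))
  rw [hprod 0 hzero] at hlim
  have e0 : ((((-x : ℝ) : ℂ) + (0 : ℝ) * Complex.I) ^ 2) = (x : ℂ) ^ 2 := by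
    push_cast
    ring
  rw [e0] at hlim
  refine hlim.congr' ?_
  filter_upwards [hsmall] with ε hε using hprod ε hε

end HilbertOfTransform

section HilbertTransformOfSine

variable {g H : ℝ → ℂ} {x : ℝ}

lemma integrableOn_inv_sq_sub_sq {z : ℂ} (hz : 0 < z.im) :
    IntegrableOn (fun t : ℝ => ((t : ℂ) ^ 2 - z ^ 2)⁻¹) (Ioi 0) := by
  have h := (integrable_mul_inv_sq_sub_sq (M := fun _ => 1) continuous_const
    (fun _ => by simp) hz).integrableOn (s := Ioi 0)
  simpa only [one_mul] using h

lemma integral_sinTransform_div_eq (w : ℂ) :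
    ∫ t in Ioi (0 : ℝ), (t : ℂ) * (sinTransform g t / t) / ((t : ℂ) ^ 2 - w) =
      ∫ t in Ioi (0 : ℝ), sinTransform g t * ((t : ℂ) ^ 2 - w)⁻¹ := by
  refine setIntegral_congr_fun measurableSet_Ioi fun t ht => ?_
  have ht' : (t : ℂ) ≠ 0 := by exact_mod_cast (ne_of_gt ht)
  rw [mul_div_cancel₀ _ ht', div_eq_mul_inv]

/-- The boundary value from above of the Cauchy integral of a sine transform which is also a
cosine transform. -/
lemma mul_eq_neg_sinTransform {A : ℂ} (hx : 0 < x) (hHi : IntegrableOn H (Ioi 0))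
    (hHg : ∀ ξ : ℝ, 0 < ξ → cosTransform H ξ = sinTransform g ξ)
    (hlim : Tendsto (fun ε : ℝ => ∫ t in Ioi (0 : ℝ), (t : ℂ) * (sinTransform g t / t) /
        ((t : ℂ) ^ 2 - ((x : ℂ) + (1 : ℝ) * ε * Complex.I) ^ 2)) (nhdsWithin 0 (Ioi 0))
      (nhds (π / 2 * (A + (1 : ℝ) * Complex.I * (sinTransform g x / x))))) :
    x * A = -sinTransform H x := by
  have hxC : (x : ℂ) ≠ 0 := by exact_mod_cast hx.ne'
  have hpi : (π : ℂ) ≠ 0 := by exact_mod_cast Real.pi_ne_zero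
  have hz : Tendsto (fun ε : ℝ => (π * Complex.I / (2 * ((x : ℂ) + ε * Complex.I)) : ℂ))
      (nhdsWithin 0 (Ioi 0)) (nhds (π * Complex.I / (2 * ((x : ℂ) + (0 : ℝ) * Complex.I)))) := by
    refine tendsto_nhdsWithin_of_tendsto_nhds (tendsto_const_nhds.div
      (Continuous.tendsto (by fun_prop) (0 : ℝ)) ?_)
    simpa using hxC
  have h := hz.mul (tendsto_integral_mul_exp hHi x)
  have huniq := tendsto_nhds_unique (hlim.congr' ?_) h
  · rw [hHg x hx] at huniq
    generalize sinTransform g x = a at huniq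
    generalize sinTransform H x = b at huniq ⊢
    push_cast at huniq
    simp only [zero_mul, add_zero, one_mul] at huniq
    field_simp at huniq
    linear_combination huniq + b * Complex.I_sq
  · filter_upwards [self_mem_nhdsWithin] with ε hε
    have hε' : 0 < ε := hε
    have him : 0 < ((x : ℂ) + ε * Complex.I).im := by simpa using hε'
    rw [Complex.ofReal_one, one_mul, integral_sinTransform_div_eq]
    rw [setIntegral_congr_fun measurableSet_Ioi fun t ht =>
      show _ = cosTransform H t * ((t : ℂ) ^ 2 - ((x : ℂ) + ε * Complex.I) ^ 2)⁻¹ by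
        rw [hHg t ht]]
    simp only [cosTransform]
    rw [integral_integral_mul_comp_mul (β := fun s => (Real.cos s : ℂ)) hHi
      (integrableOn_inv_sq_sub_sq him) (by fun_prop) fun s => by
        rw [Complex.norm_real]; exact Real.abs_cos_le_one _]
    rw [← integral_const_mul]
    refine setIntegral_congr_fun measurableSet_Ioi fun u hu => ?_
    rw [integral_cos_mul_inv_sq_sub_sq him (le_of_lt hu)]
    ring

/-- The boundary value from below of the Cauchy integral of a sine transform. -/
lemma mul_eq_cosTransform_sub {A : ℂ} (hx : 0 < x) (hg : IntegrableOn g (Ioi 0))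
    (hlim : Tendsto (fun ε : ℝ => ∫ t in Ioi (0 : ℝ), (t : ℂ) * (sinTransform g t / t) /
        ((t : ℂ) ^ 2 - ((x : ℂ) + (-1 : ℝ) * ε * Complex.I) ^ 2)) (nhdsWithin 0 (Ioi 0))
      (nhds (π / 2 * (A + (-1 : ℝ) * Complex.I * (sinTransform g x / x))))) :
    x * A = cosTransform (fun t => g t -
      (4 / π ^ 2 : ℂ) * poissonAverage (poissonAverage g) t) x := by
  have hxC : (x : ℂ) ≠ 0 := by exact_mod_cast hx.ne'
  have hpi : (π : ℂ) ≠ 0 := by exact_mod_cast Real.pi_ne_zero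
  have hS := integrableOn_poissonAverage hg
  have hSS := integrableOn_poissonAverage hS
  have hq : cosTransform (fun t => g t -
      (4 / π ^ 2 : ℂ) * poissonAverage (poissonAverage g) t) x =
      cosTransform g x - 4 / π ^ 2 * (π / 2 * (x * ∫ u in Ioi (0 : ℝ), g u *
        ∫ s in Ioi (0 : ℝ), (Real.exp (-(s * u)) : ℂ) * ((s : ℂ) ^ 2 + (x : ℂ) ^ 2)⁻¹)) := by
    have h1 : ∫ u in Ioi (0 : ℝ), g u * ∫ s in Ioi (0 : ℝ),
        (Real.exp (-(s * u)) : ℂ) * (x * ((s : ℂ) ^ 2 + (x : ℂ) ^ 2)⁻¹) =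
        x * ∫ u in Ioi (0 : ℝ), g u *
        ∫ s in Ioi (0 : ℝ), (Real.exp (-(s * u)) : ℂ) * ((s : ℂ) ^ 2 + (x : ℂ) ^ 2)⁻¹ := by
      simp_rw [mul_left_comm _ (x : ℂ), integral_const_mul, mul_left_comm _ (x : ℂ),
        integral_const_mul]
    rw [← h1, ← integral_poissonAverage_mul_exp hg hx, ← cosTransform_poissonAverage hS hx]
    simp only [cosTransform]
    rw [← integral_const_mul, ← integral_sub (integrableOn_mul_cos hg x)
      ((integrableOn_mul_cos hSS x).const_mul _)]
    refine integral_congr_ae (Eventually.of_forall fun t => ?_)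
    beta_reduce
    ring
  have hz : Tendsto (fun ε : ℝ => (-(π / (2 * (((-x : ℝ) : ℂ) + ε * Complex.I))) : ℂ))
      (nhdsWithin 0 (Ioi 0))
      (nhds (-(π / (2 * (((-x : ℝ) : ℂ) + (0 : ℝ) * Complex.I))))) := by
    refine tendsto_nhdsWithin_of_tendsto_nhds (tendsto_const_nhds.div
      (Continuous.tendsto (by fun_prop) (0 : ℝ)) ?_).neg
    simpa using hxC
  have h := (hz.mul (tendsto_integral_mul_exp hg (-x))).sub (tendsto_integral_laplace_kernel hg hx)
  have huniq := tendsto_nhds_unique (hlim.congr' ?_) h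
  · have hc : cosTransform g (-x) = cosTransform g x := by simp [cosTransform]
    have hs : sinTransform g (-x) = -sinTransform g x := by
      simp [sinTransform, integral_neg]
    rw [hq]
    rw [hc, hs] at huniq
    generalize sinTransform g x = a at huniq
    generalize cosTransform g x = b at huniq ⊢
    generalize (∫ u in Ioi (0 : ℝ), g u * ∫ s in Ioi (0 : ℝ),
      (Real.exp (-(s * u)) : ℂ) * ((s : ℂ) ^ 2 + (x : ℂ) ^ 2)⁻¹) = N at huniq ⊢
    push_cast at huniq
    simp only [zero_mul, add_zero, mul_neg, div_neg, neg_neg] at huniq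
    field_simp at huniq ⊢
    linear_combination 2 * huniq
  · filter_upwards [self_mem_nhdsWithin] with ε hε
    have hε' : 0 < ε := hε
    have him : 0 < (((-x : ℝ) : ℂ) + ε * Complex.I).im := by simpa using hε'
    have hre : (((-x : ℝ) : ℂ) + ε * Complex.I).re < 0 := by simpa using hx
    have hsq : ((x : ℂ) + (-1 : ℝ) * ε * Complex.I) ^ 2 =
        (((-x : ℝ) : ℂ) + ε * Complex.I) ^ 2 := by
      push_cast
      ring
    rw [hsq, integral_sinTransform_div_eq]
    simp only [sinTransform]
    have hsin : ∀ s : ℝ, ‖(Real.sin s : ℂ)‖ ≤ 1 := fun s => by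
      rw [Complex.norm_real]
      exact Real.abs_sin_le_one _
    rw [integral_integral_mul_comp_mul (β := fun s => (Real.sin s : ℂ)) hg
      (integrableOn_inv_sq_sub_sq him) (by fun_prop) hsin]
    set z := ((-x : ℝ) : ℂ) + ε * Complex.I with hzdef
    have i1 : IntegrableOn (fun u : ℝ => g u * Complex.exp (u * z * Complex.I)) (Ioi 0) := by
      refine Integrable.mul_bdd (c := 1) hg (Continuous.aestronglyMeasurable (by fun_prop)) ?_
      exact ae_restrict_of_forall_mem measurableSet_Ioi fun u hu =>
        norm_exp_mul_mul_I_le_one (le_of_lt hu) him.le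
    have i2 := integrableOn_mul_integral_comp_mul (β := fun s => (Real.sin s : ℂ)) hg
      (integrableOn_inv_sq_sub_sq him) (by fun_prop) hsin
    rw [eq_sub_iff_add_eq, ← eq_sub_iff_add_eq', ← integral_const_mul,
      ← integral_sub (i1.const_mul _) i2]
    refine setIntegral_congr_fun measurableSet_Ioi fun u hu => ?_
    rw [integral_sin_mul_inv_sq_sub_sq him hre (le_of_lt hu)]
    ring

/-- The odd Hilbert transform `A` of `sinTransform g x / x` satisfies
`x * A x = cosTransform q x = -sinTransform H x`. -/
lemma ae_mul_eq_cosTransform_and_eq_neg_sinTransform {A : ℝ → ℂ} (hg : IntegrableOn g (Ioi 0))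
    (hHi : IntegrableOn H (Ioi 0))
    (hHg : ∀ ξ : ℝ, 0 < ξ → cosTransform H ξ = sinTransform g ξ)
    (hA : ∀ x : ℝ, 0 < x → Tendsto (fun δ : ℝ => ((2 / π : ℝ) : ℂ) *
      ∫ t in {t : ℝ | 0 < t ∧ δ < |t - x|},
        (t : ℂ) * (sinTransform g t / t) / ((t : ℂ) ^ 2 - (x : ℂ) ^ 2))
      (nhdsWithin 0 (Ioi 0)) (nhds (A x)))
    (hT : IntegrableOn (fun t : ℝ => sinTransform g t / t) (Ioi 0)) :
    ∀ᵐ x ∂(volume.restrict (Ioi (0 : ℝ))), x * A x = cosTransform (fun t => g t -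
      (4 / π ^ 2 : ℂ) * poissonAverage (poissonAverage g) t) x ∧
        x * A x = -sinTransform H x := by
  have havg := ae_tendsto_symm_average ((integrable_indicator_iff measurableSet_Ioi).2 hT)
  filter_upwards [ae_restrict_of_ae havg, ae_restrict_mem measurableSet_Ioi] with x hL hx
  rw [indicator_of_mem hx] at hL
  exact ⟨mul_eq_cosTransform_sub hx hg
      (tendsto_integral_div_sq_sub_sq hT hx (hA x hx) hL (σ := -1) (by norm_num)),
    mul_eq_neg_sinTransform hx hHi hHg
      (tendsto_integral_div_sq_sub_sq hT hx (hA x hx) hL (σ := 1) (by norm_num))⟩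

lemma integral_norm_sub_poissonAverage_le (hg : IntegrableOn g (Ioi 0)) :
    ∫ t in Ioi (0 : ℝ), ‖g t - (4 / π ^ 2 : ℂ) * poissonAverage (poissonAverage g) t‖ ≤
      2 * ∫ t in Ioi (0 : ℝ), ‖g t‖ := by
  have hS := integrableOn_poissonAverage hg
  have hSS := integrableOn_poissonAverage hS
  have h1 := integral_norm_poissonAverage_le hg
  have h2 := integral_norm_poissonAverage_le hS
  have hc : ‖(4 / π ^ 2 : ℂ)‖ = 4 / π ^ 2 := by
    rw [norm_div, norm_pow, Complex.norm_real, Real.norm_of_nonneg pi_pos.le]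
    norm_num
  have h3 : ∫ t in Ioi (0 : ℝ), ‖g t - (4 / π ^ 2 : ℂ) * poissonAverage (poissonAverage g) t‖ ≤
      (∫ t in Ioi (0 : ℝ), ‖g t‖) +
        4 / π ^ 2 * ∫ t in Ioi (0 : ℝ), ‖poissonAverage (poissonAverage g) t‖ := by
    rw [← integral_const_mul, ← integral_add hg.norm (hSS.norm.const_mul _)]
    refine integral_mono (Integrable.sub hg (hSS.const_mul _)).norm
      (Integrable.add hg.norm (hSS.norm.const_mul _)) fun t => ?_
    refine (norm_sub_le _ _).trans ?_
    rw [norm_mul, hc]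
  have hpi := pi_pos
  calc _ ≤ _ := h3
    _ ≤ (∫ t in Ioi (0 : ℝ), ‖g t‖) +
        4 / π ^ 2 * (π / 2 * (π / 2 * ∫ t in Ioi (0 : ℝ), ‖g t‖)) := by
      gcongr
      exact h2.trans (by gcongr)
    _ = _ := by
      generalize ∫ t in Ioi (0 : ℝ), ‖g t‖ = a
      field_simp
      ring

lemma integrableOn_sinTransform_div (hg : IntegrableOn g (Ioi 0)) (hHi : IntegrableOn H (Ioi 0))
    (hHg : ∀ ξ : ℝ, 0 < ξ → cosTransform H ξ = sinTransform g ξ) :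
    IntegrableOn (fun t : ℝ => sinTransform g t / t) (Ioi 0) :=
  ⟨((continuous_sinTransform hg).measurable.div
      Complex.continuous_ofReal.measurable).aestronglyMeasurable,
    (lintegral_sinTransform_div_le hHi hg hHg).trans_lt ENNReal.ofReal_lt_top⟩

theorem integrableOn_hilbert_and_integral_norm_le {A : ℝ → ℂ} (hg : IntegrableOn g (Ioi 0))
    (hHi : IntegrableOn H (Ioi 0))
    (hHg : ∀ ξ : ℝ, 0 < ξ → cosTransform H ξ = sinTransform g ξ)
    (hA : ∀ x : ℝ, 0 < x → Tendsto (fun δ : ℝ => ((2 / π : ℝ) : ℂ) *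
      ∫ t in {t : ℝ | 0 < t ∧ δ < |t - x|},
        (t : ℂ) * (sinTransform g t / t) / ((t : ℂ) ^ 2 - (x : ℂ) ^ 2))
      (nhdsWithin 0 (Ioi 0)) (nhds (A x))) :
    IntegrableOn A (Ioi 0) ∧ ∫ x in Ioi (0 : ℝ), ‖A x‖ ≤
      64 * ((∫ t in Ioi (0 : ℝ), ‖g t‖) + ∫ t in Ioi (0 : ℝ), ‖H t‖) := by
  set q : ℝ → ℂ := fun t => g t - (4 / π ^ 2 : ℂ) * poissonAverage (poissonAverage g) t with hqdef
  have hq : IntegrableOn q (Ioi 0) := Integrable.sub hg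
    ((integrableOn_poissonAverage (integrableOn_poissonAverage hg)).const_mul _)
  have hae := ae_mul_eq_cosTransform_and_eq_neg_sinTransform hg hHi hHg hA
    (integrableOn_sinTransform_div hg hHi hHg)
  have hneg : ∀ ξ, sinTransform (fun t => -H t) ξ = -sinTransform H ξ := fun ξ => by
    simp [sinTransform, integral_neg]
  have hHn : IntegrableOn (fun t => -H t) (Ioi 0) := hHi.neg
  have heq : EqOn (cosTransform q) (sinTransform fun t => -H t) (Ioi 0) := by
    refine Measure.eqOn_open_of_ae_eq (μ := volume) ?_ isOpen_Ioi
      (continuous_cosTransform hq).continuousOn (continuous_sinTransform hHn).continuousOn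
    filter_upwards [hae] with x hx
    rw [hneg, ← hx.1, hx.2]
  have hb := lintegral_sinTransform_div_le hq hHn heq
  have hAe : (fun x : ℝ => sinTransform (fun t => -H t) x / x) =ᵐ[volume.restrict (Ioi 0)] A := by
    filter_upwards [hae, ae_restrict_mem measurableSet_Ioi] with x hx hx0
    have hx' : (x : ℂ) ≠ 0 := by exact_mod_cast (ne_of_gt hx0)
    rw [hneg, ← hx.2, mul_div_cancel_left₀ _ hx']
  have hi := integrableOn_sinTransform_div hHn hq heq
  refine ⟨Integrable.congr hi hAe, ?_⟩
  have h1 : ∫ x in Ioi (0 : ℝ), ‖A x‖ =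
      ∫ x in Ioi (0 : ℝ), ‖sinTransform (fun t => -H t) x / x‖ := by
    refine integral_congr_ae ?_
    filter_upwards [hAe] with x hx
    rw [hx]
  have hnn : ∀ f : ℝ → ℂ, 0 ≤ ∫ t in Ioi (0 : ℝ), ‖f t‖ :=
    fun f => integral_nonneg fun _ => norm_nonneg _
  have hqn := hnn q
  have hHnn := hnn H
  have hgn := hnn g
  rw [h1, integral_norm_eq_lintegral_enorm hi.aestronglyMeasurable]
  refine (ENNReal.toReal_le_of_le_ofReal (by have := hnn fun t => -H t; positivity) hb).trans ?_
  simp only [norm_neg]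
  linarith [integral_norm_sub_poissonAverage_le hg]

end HilbertTransformOfSine

/-- **Proposition 1.** If `g` is an integrable function on `(0,∞)` (identified with an
odd integrable function on `ℝ`) whose odd Hilbert transform `H₀g` is also Lebesgue
integrable on `(0,∞)` (i.e. `g ∈ H₀¹(ℝ₊)`), then `H₀(T_g)` is Lebesgue integrable on
`(0,∞)` with `‖H₀(T_g)‖_{L¹(0,∞)} ≤ C (‖g‖_{L¹(0,∞)} + ‖H₀g‖_{L¹(0,∞)})` for an
absolute constant `C > 0`, where `T_g(u) = ĝ_s(u)/u`. -/
theorem hilbert_of_T_transform_bounded_by_H01_norm :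
    ∃ C : ℝ, 0 < C ∧
      ∀ (g H0g H0Tg : ℝ → ℂ),
        -- g is Lebesgue integrable on (0,∞)
        MeasureTheory.IntegrableOn g (Set.Ioi 0) →
        -- H0g is the odd Hilbert transform (principal value) of g
        (∀ x : ℝ, 0 < x →
          Filter.Tendsto (fun δ : ℝ =>
              ((2 / Real.pi : ℝ) : ℂ) *
                ∫ t in {t : ℝ | 0 < t ∧ δ < |t - x|},
                  (t : ℂ) * g t / ((t : ℂ) ^ 2 - (x : ℂ) ^ 2))
            (nhdsWithin 0 (Set.Ioi 0)) (nhds (H0g x))) →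
        -- g ∈ H₀¹(ℝ₊) : H₀g is Lebesgue integrable on (0,∞)
        MeasureTheory.IntegrableOn H0g (Set.Ioi 0) →
        -- H0Tg is the odd Hilbert transform (principal value) of T_g(u) = ĝ_s(u)/u
        (∀ x : ℝ, 0 < x →
          Filter.Tendsto (fun δ : ℝ =>
              ((2 / Real.pi : ℝ) : ℂ) *
                ∫ t in {t : ℝ | 0 < t ∧ δ < |t - x|},
                  (t : ℂ) *
                      ((∫ u in Set.Ioi (0 : ℝ), g u * (Real.sin (t * u) : ℂ)) / (t : ℂ)) /
                    ((t : ℂ) ^ 2 - (x : ℂ) ^ 2))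
            (nhdsWithin 0 (Set.Ioi 0)) (nhds (H0Tg x))) →
        MeasureTheory.IntegrableOn H0Tg (Set.Ioi 0) ∧
          (∫ x in Set.Ioi (0 : ℝ), ‖H0Tg x‖) ≤
            C * ((∫ t in Set.Ioi (0 : ℝ), ‖g t‖) + ∫ x in Set.Ioi (0 : ℝ), ‖H0g x‖) := by
  exact ⟨64, by norm_num, fun _ _ _ hg hH hHi hA =>
    integrableOn_hilbert_and_integral_norm_le hg hHi
      (fun _ hξ => cosTransform_hilbert hg hH hHi hξ) hA⟩
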